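/- Let G be a finite subgroup of GL(n,ℂ). If for every g ∈ G the quotient ℂⁿ/⟨g⟩ has canonical singularities, then ℂⁿ/G has canonical singularities. -/

import Mathlib

open Matrix Polynomial

/-- The normalized angle in `[0,1)` of a complex number (for a root of unity `e^{2πia/m}`
this is the fractional part `{a/m}`). -/
noncomputable def argFrac (z : ℂ) : ℝ := Int.fract (Complex.arg z / (2 * Real.pi))

/-- The Reid–Tai sum (age) of a finite-order matrix: the sum of `{a_i/m}` over the
eigenvalues `ζ^{a_i}` (the roots of the characteristic polynomial). -/
noncomputable def reidTaiSum {n : ℕ} (g : Matrix (Fin n) (Fin n) ℂ) : ℝ :=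
  (g.charpoly.roots.map argFrac).sum

/-- A quasi-reflection: exactly one eigenvalue is different from `1`. -/
def IsQuasiReflection {n : ℕ} (g : Matrix (Fin n) (Fin n) ℂ) : Prop :=
  letI := Classical.decEq ℂ
  Multiset.card (g.charpoly.roots.filter (fun z => z ≠ 1)) = 1

/-- The action of `g ∈ GL(n,ℂ)` on polynomial functions on `ℂⁿ`. -/
noncomputable def glAct {n : ℕ} (g : GL (Fin n) ℂ) :
    MvPolynomial (Fin n) ℂ →ₐ[ℂ] MvPolynomial (Fin n) ℂ :=
  MvPolynomial.aeval (fun i => ∑ j, (g : Matrix (Fin n) (Fin n) ℂ) i j • MvPolynomial.X j)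

/-- The invariant ring `ℂ[z₁,…,zₙ]^G`, the coordinate ring of the quotient `ℂⁿ/G`. -/
noncomputable def invariantRing {n : ℕ} (G : Subgroup (GL (Fin n) ℂ)) :
    Subalgebra ℂ (MvPolynomial (Fin n) ℂ) where
  carrier := {p | ∀ g ∈ G, glAct g p = p}
  mul_mem' := by
    intro a b ha hb g hg
    rw [Set.mem_setOf_eq] at *
    rw [_root_.map_mul, ha g hg, hb g hg]
  add_mem' := by
    intro a b ha hb g hg
    rw [Set.mem_setOf_eq] at *
    rw [_root_.map_add, ha g hg, hb g hg]
  algebraMap_mem' := by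
    intro c g hg
    exact (glAct g).commutes c

/-- `ℂⁿ/G` has canonical singularities: by the Prill/Chevalley reduction and the
Reid–Tai criterion, this holds iff the quotient is isomorphic (same invariant ring)
to a quotient `ℂⁿ/G'` by a small group `G'` (one containing no quasi-reflections)
all of whose nontrivial elements have age (Reid–Tai sum) at least `1`. -/
def HasCanonicalQuotSings {n : ℕ} (G : Subgroup (GL (Fin n) ℂ)) : Prop :=
  ∃ G' : Subgroup (GL (Fin n) ℂ), Finite G' ∧
    (∀ g ∈ G', ¬ IsQuasiReflection ((g : GL (Fin n) ℂ) : Matrix (Fin n) (Fin n) ℂ)) ∧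
    Nonempty (invariantRing G ≃ₐ[ℂ] invariantRing G') ∧
    ∀ g ∈ G', g ≠ 1 → 1 ≤ reidTaiSum ((g : GL (Fin n) ℂ) : Matrix (Fin n) (Fin n) ℂ)

open Matrix Polynomial

/-! ### Hahn series with rational exponents -/

/-- The field of Hahn series with rational exponents. -/
abbrev Om (L : Type) [Field L] : Type := HahnSeries ℚ L

section Puiseux
variable {L : Type} [Field L]

theorem om_le_iff {x : Om L} {q : ℚ} :
    (q : WithTop ℚ) ≤ x.orderTop ↔ ∀ i < q, x.coeff i = 0 := by
  rw [HahnSeries.le_orderTop_iff_forall]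
  constructor
  · intro h i hi
    by_contra hc
    exact absurd (WithTop.coe_lt_coe.2 hi) (by simpa using h i (by exact_mod_cast hi) |> fun h' => (hc h').elim)
  · intro h i hi
    exact h i (by exact_mod_cast hi)

/-- the valuation ring of the Hahn series field -/
noncomputable def omO (L : Type) [Field L] : Subring (Om L) where
  carrier := {x | 0 ≤ x.orderTop}
  mul_mem' := by
    intro a b ha hb
    simp only [Set.mem_ofPred_eq] at *
    rw [HahnSeries.orderTop_mul]
    exact add_nonneg ha hb
  one_mem' := by simp
  add_mem' := by
    intro a b ha hb
    change 0 ≤ (a + b).orderTop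
    exact le_trans (le_min (α := WithTop ℚ) ha hb) HahnSeries.min_orderTop_le_orderTop_add
  zero_mem' := by simp
  neg_mem' := by
    intro a ha
    simpa using ha

theorem mem_omO {x : Om L} : x ∈ omO L ↔ 0 ≤ x.orderTop := Iff.rfl

theorem om_decomp (x : Om L) (hx : 0 ≤ x.orderTop) :
    0 < (x - HahnSeries.C (x.coeff 0)).orderTop := by
  by_contra hcon
  push Not at hcon
  have h0 : 0 ≤ (x - HahnSeries.C (x.coeff 0)).orderTop := by
    refine le_trans (le_min hx ?_) HahnSeries.min_orderTop_le_orderTop_sub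
    exact HahnSeries.orderTop_single_le
  have h1 : (x - HahnSeries.C (x.coeff 0)).orderTop = ((0 : ℚ) : WithTop ℚ) := le_antisymm hcon h0
  have := HahnSeries.coeff_orderTop_ne h1
  simp [HahnSeries.C_apply] at this

theorem om_coeff_zero_of_pos {x : Om L} (hx : 0 < x.orderTop) : x.coeff 0 = 0 :=
  HahnSeries.coeff_eq_zero_of_lt_orderTop (by exact_mod_cast hx)

theorem om_pos_of_coeff_zero {x : Om L} (hx : 0 ≤ x.orderTop) (h : x.coeff 0 = 0) :
    0 < x.orderTop := by
  have := om_decomp x hx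
  simpa [h] using this

theorem om_coeff_mul {x y : Om L} (hx : 0 ≤ x.orderTop) (hy : 0 ≤ y.orderTop) :
    (x * y).coeff 0 = x.coeff 0 * y.coeff 0 := by
  have h1 := om_decomp x hx
  have h2 := om_decomp y hy
  set a := x.coeff 0
  set b := y.coeff 0
  have e : x * y = HahnSeries.C (a * b) + ((x - HahnSeries.C a) * y +
      HahnSeries.C a * (y - HahnSeries.C b)) := by
    rw [map_mul]; ring
  have e1 : ((x - HahnSeries.C a) * y).coeff 0 = 0 := by
    apply om_coeff_zero_of_pos
    rw [HahnSeries.orderTop_mul]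
    exact lt_of_lt_of_le h1 (le_add_of_nonneg_right hy)
  have e2 : (HahnSeries.C a * (y - HahnSeries.C b)).coeff 0 = 0 := by
    apply om_coeff_zero_of_pos
    rw [HahnSeries.orderTop_mul]
    exact lt_of_lt_of_le h2 (le_add_of_nonneg_left HahnSeries.orderTop_single_le)
  rw [e, HahnSeries.coeff_add, HahnSeries.coeff_add, e1, e2]
  simp [HahnSeries.C_apply]

/-- residue map -/
noncomputable def omRes (L : Type) [Field L] : omO L →+* L where
  toFun x := (x : Om L).coeff 0
  map_one' := by simp
  map_mul' x y := om_coeff_mul x.2 y.2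
  map_zero' := by simp
  map_add' x y := by simp

theorem omRes_apply (x : omO L) : omRes L x = (x : Om L).coeff 0 := rfl

theorem omRes_eq_zero {x : omO L} : omRes L x = 0 ↔ 0 < (x : Om L).orderTop :=
  ⟨fun h => om_pos_of_coeff_zero x.2 h, fun h => om_coeff_zero_of_pos h⟩

theorem omO_isUnit {x : omO L} (h : omRes L x ≠ 0) : IsUnit x := by
  have hx0 : (x : Om L) ≠ 0 := by
    intro h0
    apply h
    rw [omRes_apply, h0]; simp
  have hv : (x : Om L).orderTop = 0 := by
    have h1 : ¬ 0 < (x : Om L).orderTop := fun h' => h (omRes_eq_zero.2 h')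
    exact le_antisymm (not_lt.1 h1) x.2
  have hm : (x : Om L) * (x : Om L)⁻¹ = 1 := mul_inv_cancel₀ hx0
  have hi : ((x : Om L)⁻¹).orderTop = 0 := by
    have := congrArg HahnSeries.orderTop hm
    rw [HahnSeries.orderTop_mul, hv] at this
    simpa using this
  refine IsUnit.of_mul_eq_one ⟨(x : Om L)⁻¹, hi.ge⟩ ?_
  ext1
  exact hm

/-- the element `t^ε` -/
noncomputable def omT (L : Type) [Field L] (ε : ℚ) : Om L := HahnSeries.single ε 1

theorem omT_order (ε : ℚ) : (omT L ε).orderTop = ε := HahnSeries.orderTop_single one_ne_zero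

theorem omT_mul (a b : ℚ) : omT L a * omT L b = omT L (a + b) := by
  simp [omT]

theorem omT_zero : omT L 0 = 1 := rfl

theorem omT_pow (a : ℚ) (k : ℕ) : omT L a ^ k = omT L (k * a) := by
  simp [omT]

theorem omT_ne (a : ℚ) : omT L a ≠ 0 := by simp [omT]

theorem om_complete (ε : ℚ) (hε : 0 < ε) (a : ℕ → Om L)
    (ha : ∀ k, (((k + 1 : ℕ) * ε : ℚ) : WithTop ℚ) ≤ (a (k + 1) - a k).orderTop) :
    ∃ x : Om L, ∀ k, (((k + 1 : ℕ) * ε : ℚ) : WithTop ℚ) ≤ (x - a k).orderTop := by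
  have hst : ∀ k m, k ≤ m → ∀ i : ℚ, i < (k + 1 : ℕ) * ε → (a m).coeff i = (a k).coeff i := by
    intro k m hkm
    induction m, hkm using Nat.le_induction with
    | base => intros; rfl
    | succ m hm ih =>
      intro i hi
      rw [← ih i hi]
      have h1 := (om_le_iff.1 (ha m)) i (lt_of_lt_of_le hi (by gcongr))
      rw [HahnSeries.coeff_sub] at h1
      exact sub_eq_zero.1 h1
  have hN : ∀ i : ℚ, ∃ k : ℕ, i < (k + 1 : ℕ) * ε := by
    intro i
    obtain ⟨k, hk⟩ := exists_nat_gt (i / ε)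
    refine ⟨k, ?_⟩
    rw [div_lt_iff₀ hε] at hk
    push_cast
    nlinarith
  choose N hN using hN
  let x : Om L := 
    { coeff := fun i => (a (N i)).coeff i
      isPWO_support' := by
        rw [Set.isPWO_iff_isWF, Set.isWF_iff_no_descending_seq]
        intro f hf hmem
        have h1 : ∀ n, f n ∈ (a (N (f 0))).support := by
          intro n
          have hle : f n ≤ f 0 := hf.antitone (Nat.zero_le n)
          have h2 := hmem n
          rw [Function.mem_support] at h2
          rw [HahnSeries.mem_support]
          rcases le_total (N (f n)) (N (f 0)) with h | h
          · rw [hst _ _ h _ (hN _)]; exact h2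
          · rw [← hst _ _ h _ (lt_of_le_of_lt hle (hN _))]; exact h2
        exact (Set.isWF_iff_no_descending_seq.1 (a (N (f 0))).isWF_support) f hf h1 }
  refine ⟨x, fun k => om_le_iff.2 fun i hi => ?_⟩
  rw [HahnSeries.coeff_sub, sub_eq_zero]
  change (a (N i)).coeff i = _
  rcases le_total (N i) k with h | h
  · rw [hst _ _ h _ (hN _)]
  · rw [hst _ _ h _ hi]

end Puiseux

open Matrix Polynomial

section Puiseux2
variable {L : Type} [Field L]

theorem omO_dvd {ε : ℚ} (hε : 0 < ε) {k : ℕ} {x : omO L} :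
    (⟨omT L ε, by rw [mem_omO, omT_order]; exact_mod_cast hε.le⟩ : omO L) ^ k ∣ x ↔
      ((k * ε : ℚ) : WithTop ℚ) ≤ (x : Om L).orderTop := by
  constructor
  · rintro ⟨y, rfl⟩
    push_cast
    rw [HahnSeries.orderTop_mul, omT_pow, omT_order]
    exact le_add_of_nonneg_right y.2
  · intro h
    have hy : 0 ≤ (omT L (-(k * ε)) * (x : Om L)).orderTop := by
      rw [HahnSeries.orderTop_mul, omT_order]
      calc (0 : WithTop ℚ) = ((-(k * ε) : ℚ) : WithTop ℚ) + ((k * ε : ℚ) : WithTop ℚ) := by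
            rw [← WithTop.coe_add]; simp
        _ ≤ _ := by gcongr
    refine ⟨⟨_, hy⟩, ?_⟩
    ext1
    push_cast
    rw [omT_pow, ← mul_assoc, omT_mul]
    simp [omT_zero]

theorem om_hensel (F : (omO L)[X]) (h0 : omRes L (F.eval 0) = 0)
    (h1 : omRes L (F.derivative.eval 0) ≠ 0) : ∃ a : omO L, omRes L a = 0 ∧ F.eval a = 0 := by
  by_cases hF : F.eval 0 = 0
  · exact ⟨0, map_zero _, hF⟩
  have hF' : ((F.eval 0 : omO L) : Om L) ≠ 0 := fun h => hF (by ext1; simpa using h)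
  obtain ⟨ε, hε'⟩ := WithTop.ne_top_iff_exists.1 (HahnSeries.orderTop_ne_top.2 hF')
  have hε : 0 < ε := by
    have := omRes_eq_zero.1 h0
    rw [← hε'] at this
    exact_mod_cast this
  set π : omO L := ⟨omT L ε, by rw [mem_omO, omT_order]; exact_mod_cast hε.le⟩ with hπ
  have hdv : ∀ (k : ℕ) (x : omO L), π ^ k ∣ x ↔ ((k * ε : ℚ) : WithTop ℚ) ≤ (x : Om L).orderTop :=
    fun k x => omO_dvd hε
  have hresπ : omRes L π = 0 := by
    rw [omRes_eq_zero]
    change 0 < (omT L ε).orderTop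
    rw [omT_order]; exact_mod_cast hε
  have step : ∀ k : ℕ, ∀ a : omO L, omRes L a = 0 → π ^ (k + 1) ∣ F.eval a →
      ∃ a' : omO L, omRes L a' = 0 ∧ π ^ (k + 2) ∣ F.eval a' ∧ π ^ (k + 1) ∣ a' - a := by
    intro k a ha hd
    have hu : omRes L (F.derivative.eval a) ≠ 0 := by
      have e : ∀ b, omRes L (F.derivative.eval b) = (F.derivative.map (omRes L)).eval (omRes L b) := by
        intro b; rw [eval_map, eval₂_hom]
      rw [e, ha]
      rw [e, map_zero] at h1
      exact h1
    obtain ⟨u, hu⟩ := omO_isUnit hu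
    obtain ⟨z, hz⟩ := hd
    set y : omO L := - (↑u⁻¹ * F.eval a) with hy
    have hyd : π ^ (k + 1) ∣ y := ⟨-(↑u⁻¹ * z), by rw [hy, hz]; ring⟩
    obtain ⟨w, hw⟩ := F.binomExpansion a y
    refine ⟨a + y, ?_, ?_, by simpa using hyd⟩
    · obtain ⟨y', hy'⟩ := hyd
      rw [map_add, ha, hy', pow_succ]
      simp [hresπ]
    · rw [hw, ← hu]
      have : F.eval a + ↑u * y = 0 := by
        rw [hy, mul_neg, Units.mul_inv_cancel_left]; ring
      rw [this, zero_add]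
      obtain ⟨y', hy'⟩ := hyd
      refine ⟨w * π ^ k * y' ^ 2, ?_⟩
      rw [hy']; ring
  let S : ℕ → Type := fun k => {a : omO L // omRes L a = 0 ∧ π ^ (k + 1) ∣ F.eval a}
  have s0 : π ^ 1 ∣ F.eval 0 := by
    rw [hdv, ← hε']
    simp
  let seq : ∀ k, S k := fun k => Nat.rec (motive := S) ⟨0, map_zero _, by simpa using s0⟩
    (fun k a => ⟨Classical.choose (step k a.1 a.2.1 a.2.2),
      (Classical.choose_spec (step k a.1 a.2.1 a.2.2)).1,
      (Classical.choose_spec (step k a.1 a.2.1 a.2.2)).2.1⟩) k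
  have hseq : ∀ k, π ^ (k + 1) ∣ (seq (k + 1)).1 - (seq k).1 := fun k =>
    (Classical.choose_spec (step k (seq k).1 (seq k).2.1 (seq k).2.2)).2.2
  obtain ⟨x, hx⟩ := om_complete ε hε (fun k => ((seq k).1 : Om L)) (fun k => by
    have := hseq k
    rw [hdv] at this
    simpa using this)
  have hxO : x ∈ omO L := by
    have h2 : x - (seq 0).1 ∈ omO L := by
      rw [mem_omO]
      refine le_trans ?_ (hx 0)
      simpa using hε.le
    have := (omO L).add_mem h2 (seq 0).1.2
    simpa using this
  have hd : ∀ k, π ^ (k + 1) ∣ (⟨x, hxO⟩ : omO L) - (seq k).1 := by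
    intro k
    rw [hdv]
    exact hx k
  refine ⟨⟨x, hxO⟩, ?_, ?_⟩
  · obtain ⟨y', hy'⟩ := hd 0
    have h3 : (⟨x, hxO⟩ : omO L) = (seq 0).1 + π ^ (0 + 1) * y' := by rw [← hy']; ring
    rw [h3, map_add, (seq 0).2.1]
    simp [hresπ]
  · have hall : ∀ k, π ^ (k + 1) ∣ F.eval (⟨x, hxO⟩ : omO L) := by
      intro k
      have h4 := (hd k).trans (F.sub_dvd_eval_sub (⟨x, hxO⟩ : omO L) (seq k).1)
      have := dvd_add h4 (seq k).2.2
      simpa using this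
    by_contra hne
    have hne' : ((F.eval (⟨x, hxO⟩ : omO L) : omO L) : Om L) ≠ 0 :=
      fun h => hne (by ext1; simpa using h)
    obtain ⟨q, hq⟩ := WithTop.ne_top_iff_exists.1 (HahnSeries.orderTop_ne_top.2 hne')
    obtain ⟨k, hk⟩ := exists_nat_gt (q / ε)
    have := hall k
    rw [hdv, ← hq] at this
    rw [div_lt_iff₀ hε] at hk
    have h5 : ((k + 1 : ℕ) : ℚ) * ε ≤ q := by exact_mod_cast this
    push_cast at h5
    nlinarith

/-- rescaling a polynomial -/
theorem om_rescale (p : (Om L)[X]) (r : ℕ) (hi : ∃ i < r, p.coeff i ≠ 0)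
    (hge : ∀ i, r ≤ i → (i = r ∨ p.coeff i = 0 ∨ (∀ j < r, 0 < (p.coeff j).orderTop)) ∧
      0 ≤ (p.coeff i).orderTop) :
    ∃ (l : ℚ) (G : (omO L)[X]), 
      (∀ x : omO L, G.eval x = 0 → p.eval (omT L l * x) = 0) ∧
      (∀ i, p.coeff i = 0 → G.coeff i = 0) ∧
      (∀ i, r < i → omRes L (G.coeff i) = 0) ∧
      ((G.coeff r : omO L) : Om L) = p.coeff r ∧
      (∃ i < r, omRes L (G.coeff i) ≠ 0) ∧
      ((∀ j < r, 0 < (p.coeff j).orderTop) → 0 < l) := by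
  classical
  obtain ⟨i₀, hi₀, hmin⟩ := Finset.exists_min_image
    ((Finset.range r).filter (fun i => p.coeff i ≠ 0))
    (fun i => (p.coeff i).order / ((r : ℚ) - i))
    (by obtain ⟨i, h1, h2⟩ := hi; exact ⟨i, by simp [h1, h2]⟩)
  rw [Finset.mem_filter, Finset.mem_range] at hi₀
  set l : ℚ := (p.coeff i₀).order / ((r : ℚ) - i₀) with hl
  have hri : ∀ i < r, (0 : ℚ) < (r : ℚ) - i := by
    intro i h; have : (i : ℚ) < r := by exact_mod_cast h
    linarith
  set q : (Om L)[X] := C (omT L (-(r * l))) * p.comp (C (omT L l) * X) with hq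
  have hqc : ∀ i : ℕ, q.coeff i = omT L (((i : ℚ) - r) * l) * p.coeff i := by
    intro i
    rw [hq, coeff_C_mul, comp_C_mul_X_coeff, omT_pow, mul_comm (p.coeff i), ← mul_assoc, omT_mul]
    congr 2; ring
  have hlpos : (∀ j < r, 0 < (p.coeff j).orderTop) → 0 < l := by
    intro h
    have := h i₀ hi₀.1
    rw [← HahnSeries.order_eq_orderTop_of_ne_zero hi₀.2] at this
    exact div_pos (by exact_mod_cast this) (hri _ hi₀.1)
  have hqord : ∀ i, p.coeff i ≠ 0 →
      (q.coeff i).orderTop = ((((i : ℚ) - r) * l + (p.coeff i).order : ℚ) : WithTop ℚ) := by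
    intro i hi
    rw [hqc, HahnSeries.orderTop_mul, omT_order, ← HahnSeries.order_eq_orderTop_of_ne_zero hi]
    rfl
  have hO : ∀ i, q.coeff i ∈ omO L := by
    intro i
    by_cases h : p.coeff i = 0
    · rw [hqc, h, mul_zero]; exact zero_mem _
    rw [mem_omO, hqord i h]
    rcases lt_or_ge i r with hir | hir
    · have := hmin i (by simp [hir, h])
      rw [le_div_iff₀ (hri i hir)] at this
      have h2 : 0 ≤ ((i : ℚ) - r) * l + (p.coeff i).order := by linarith
      exact_mod_cast h2
    · obtain ⟨h1, h2⟩ := hge i hir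
      rw [← HahnSeries.order_eq_orderTop_of_ne_zero h] at h2
      have h3 : 0 ≤ (p.coeff i).order := by exact_mod_cast h2
      have h4 : 0 ≤ ((i : ℚ) - r) * l := by
        rcases h1 with rfl | h1 | h1
        · simp
        · exact absurd h1 h
        · have : (r : ℚ) ≤ i := by exact_mod_cast hir
          exact mul_nonneg (by linarith) (hlpos h1).le
      have : 0 ≤ ((i : ℚ) - r) * l + (p.coeff i).order := by linarith
      exact_mod_cast this
  have hsub : (↑q.coeffs : Set (Om L)) ⊆ (omO L : Set (Om L)) := by
    intro x hx
    rw [Finset.mem_coe, mem_coeffs_iff] at hx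
    obtain ⟨n, _, rfl⟩ := hx
    exact hO n
  set G := q.toSubring (omO L) hsub with hG
  have hGc : ∀ i, ((G.coeff i : omO L) : Om L) = q.coeff i := fun i => coeff_toSubring' ..
  have hGm : G.map (omO L).subtype = q := by
    ext1 i; rw [coeff_map]; exact hGc i
  refine ⟨l, G, ?_, ?_, ?_, ?_, ?_, hlpos⟩
  · intro x hx
    have h1 : q.eval (x : Om L) = 0 := by
      rw [← hGm, eval_map]
      have := eval₂_hom (p := G) (omO L).subtype x
      rw [hx, map_zero] at this
      exact this
    rw [hq, eval_mul, eval_C, eval_comp] at h1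
    have := (mul_eq_zero.1 h1).resolve_left (omT_ne _)
    simpa using this
  · intro i h
    ext1
    rw [hGc, hqc, h]; simp
  · intro i hir
    by_cases h : p.coeff i = 0
    · have : G.coeff i = 0 := by ext1; rw [hGc, hqc, h]; simp
      rw [this, map_zero]
    rw [omRes_eq_zero, hGc, hqord i h]
    obtain ⟨h1, h2⟩ := hge i hir.le
    rw [← HahnSeries.order_eq_orderTop_of_ne_zero h] at h2
    have h3 : 0 ≤ (p.coeff i).order := by exact_mod_cast h2
    have h4 : 0 < ((i : ℚ) - r) * l := by
      rcases h1 with rfl | h1 | h1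
      · simp at hir
      · exact absurd h1 h
      · have : (r : ℚ) < i := by exact_mod_cast hir
        exact mul_pos (by linarith) (hlpos h1)
    have : 0 < ((i : ℚ) - r) * l + (p.coeff i).order := by linarith
    exact_mod_cast this
  · rw [hGc, hqc]; simp [omT_zero]
  · refine ⟨i₀, hi₀.1, ?_⟩
    intro hcon
    rw [omRes_eq_zero, hGc, hqord _ hi₀.2] at hcon
    have h1 : 0 < ((i₀ : ℚ) - r) * l + (p.coeff i₀).order := by exact_mod_cast hcon
    have h2 := hri _ hi₀.1
    have h3 : l * ((r : ℚ) - i₀) = (p.coeff i₀).order := div_mul_cancel₀ _ h2.ne'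
    nlinarith

end Puiseux2

open Matrix Polynomial

section Puiseux3
variable {L : Type} [Field L]

theorem om_root_step [CharZero L] [IsAlgClosed L] (r : ℕ) : ∀ F : (omO L)[X], 1 ≤ r →
    (∀ i < r, omRes L (F.coeff i) = 0) → omRes L (F.coeff r) ≠ 0 → ∃ a, F.eval a = 0 := by
  induction r using Nat.strong_induction_on with
  | _ r ih =>
  intro F hr hlow htop
  have hH : ∃ a : omO L, omRes L a = 0 ∧ (hasseDeriv (r - 1) F).eval a = 0 := by
    apply om_hensel
    · rw [← coeff_zero_eq_eval_zero, hasseDeriv_coeff]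
      simp only [zero_add, Nat.choose_self, Nat.cast_one, one_mul]
      exact hlow _ (by omega)
    · rw [← coeff_zero_eq_eval_zero, coeff_derivative, hasseDeriv_coeff]
      have e1 : 0 + 1 + (r - 1) = r := by omega
      have e2 : r.choose (r - 1) = r := by
        conv_lhs => rw [show r = (r - 1) + 1 by omega]
        simp
        omega
      rw [e1, e2]
      simp only [Nat.cast_zero, zero_add, mul_one, map_mul, map_natCast]
      exact mul_ne_zero (by exact_mod_cast (by omega : r ≠ 0)) htop
  obtain ⟨a, ha, hFa⟩ := hH
  set F1 := taylor a F with hF1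
  have hres : F1.map (omRes L) = F.map (omRes L) := by
    rw [hF1, taylor_apply, Polynomial.map_comp]
    simp [ha]
  have hresc : ∀ i, omRes L (F1.coeff i) = omRes L (F.coeff i) := by
    intro i
    have := congrArg (fun p => p.coeff i) hres
    simpa using this
  have hF1r : F1.coeff (r - 1) = 0 := by rw [hF1, taylor_coeff]; exact hFa
  have hroot : ∀ x, F1.eval x = 0 → ∃ a, F.eval a = 0 := by
    intro x hx
    refine ⟨x + a, ?_⟩
    rw [hF1, taylor_eval] at hx
    exact hx
  by_cases hall : ∀ i < r, F1.coeff i = 0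
  · apply hroot 0
    rw [← coeff_zero_eq_eval_zero]
    exact hall 0 (by omega)
  push Not at hall
  set p : (Om L)[X] := F1.map (omO L).subtype with hp
  have hpc : ∀ i, p.coeff i = ((F1.coeff i : omO L) : Om L) := by
    intro i; rw [hp, coeff_map]; rfl
  have hposs : ∀ j < r, 0 < (p.coeff j).orderTop := by
    intro j hj
    rw [hpc, ← omRes_eq_zero, hresc, hlow j hj]
  obtain ⟨l, G, hG1, hG2, hG3, hG4, hG5, hG6⟩ := om_rescale p r
    (by obtain ⟨i, h1, h2⟩ := hall
        refine ⟨i, h1, ?_⟩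
        rw [hpc]; intro h; exact h2 (by ext1; simpa using h))
    (by
      intro i hi
      refine ⟨Or.inr (Or.inr hposs), ?_⟩
      rw [hpc]; exact (F1.coeff i).2)
  have hl : 0 < l := hG6 hposs
  have hGroot : (∃ x, G.eval x = 0) → ∃ a, F.eval a = 0 := by
    rintro ⟨x, hx⟩
    have h1 := hG1 x hx
    have hT : omT L l ∈ omO L := by rw [mem_omO, omT_order]; exact_mod_cast hl.le
    apply hroot (⟨omT L l, hT⟩ * x)
    have h2 := eval₂_hom (p := F1) (omO L).subtype (⟨omT L l, hT⟩ * x)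
    rw [← eval_map, ← hp] at h2
    have h3 : (omO L).subtype (⟨omT L l, hT⟩ * x) = omT L l * x := rfl
    rw [h3, h1] at h2
    ext1
    exact h2.symm
  apply hGroot
  set Gb := G.map (omRes L) with hGb
  have hGbc : ∀ i, Gb.coeff i = omRes L (G.coeff i) := fun i => coeff_map ..
  have hGr : Gb.coeff r ≠ 0 := by
    rw [hGbc]
    have : G.coeff r = F1.coeff r := by ext1; rw [hG4, hpc]
    rw [this, hresc]; exact htop
  have hdeg : Gb.natDegree = r := by
    apply natDegree_eq_of_le_of_coeff_ne_zero _ hGr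
    rw [natDegree_le_iff_coeff_eq_zero]
    intro i hi
    rw [hGbc, hG3 i hi]
  have hGb0 : Gb ≠ 0 := fun h => hGr (by rw [h]; simp)
  have hGr1 : Gb.coeff (r - 1) = 0 := by
    rw [hGbc, hG2 (r - 1) (by rw [hpc, hF1r]; rfl), map_zero]
  obtain ⟨b, hb⟩ := IsAlgClosed.exists_root Gb (by
    rw [degree_eq_natDegree hGb0, hdeg]; exact_mod_cast (by omega : r ≠ 0))
  -- multiplicity
  set m := Gb.rootMultiplicity b with hm
  have hm1 : 1 ≤ m := (rootMultiplicity_pos hGb0).2 hb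
  have hmr : m < r := by
    have hle : m ≤ r := by
      classical
      rw [hm, ← hdeg, ← count_roots]; exact (Multiset.count_le_card _ _).trans (card_roots' _)
    rcases lt_or_eq_of_le hle with h | h
    · exact h
    exfalso
    obtain ⟨q, hq⟩ := pow_rootMultiplicity_dvd Gb b
    rw [← hm, h] at hq
    have hq0 : q ≠ 0 := by rintro rfl; exact hGb0 (by rw [hq]; simp)
    have hqd : q.natDegree = 0 := by
      have := congrArg natDegree hq
      rw [natDegree_mul (pow_ne_zero _ (X_sub_C_ne_zero b)) hq0, natDegree_pow,
        natDegree_X_sub_C, hdeg] at this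
      omega
    obtain ⟨c, rfl⟩ := natDegree_eq_zero.1 hqd
    have hc : c ≠ 0 := by rintro rfl; exact hq0 (by simp)
    have h1 := hGr1
    rw [hq, coeff_mul_C, sub_eq_add_neg, ← C_neg, coeff_X_add_C_pow] at h1
    have e2 : r.choose (r - 1) = r := by
      conv_lhs => rw [show r = (r - 1) + 1 by omega]
      simp
      omega
    rw [e2, show r - (r - 1) = 1 by omega, pow_one] at h1
    have hr0 : (r : L) ≠ 0 := by exact_mod_cast (by omega : r ≠ 0)
    have hb0 : b = 0 := by
      simpa [hc, hr0] using h1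
    obtain ⟨i, hi, hi2⟩ := hG5
    apply hi2
    rw [← hGbc, hq, hb0, C_0, sub_zero, coeff_mul_C, coeff_X_pow, if_neg (by omega)]
    simp
  have hbO : (HahnSeries.C b : Om L) ∈ omO L := HahnSeries.orderTop_single_le
  set b' : omO L := ⟨HahnSeries.C b, hbO⟩ with hb'
  have hb'r : omRes L b' = b := by
    rw [omRes_apply]
    simp [hb', HahnSeries.C_apply]
  have hmt : (taylor b Gb).natTrailingDegree = m := by
    rw [taylor_apply, hm, rootMultiplicity_eq_natTrailingDegree]
  have htb : (taylor b' G).map (omRes L) = taylor b Gb := by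
    rw [taylor_apply, taylor_apply, Polynomial.map_comp]
    simp [hb'r, hGb]
  have htbc : ∀ i, omRes L ((taylor b' G).coeff i) = (taylor b Gb).coeff i := by
    intro i; rw [← htb, coeff_map]
  have hT0 : taylor b Gb ≠ 0 := by
    intro h
    exact hGb0 (taylor_injective b (by rw [h, map_zero]))
  obtain ⟨x, hx⟩ := ih m hmr (taylor b' G) hm1
    (by intro i hi
        rw [htbc]; exact coeff_eq_zero_of_lt_natTrailingDegree (by rw [hmt]; exact hi))
    (by rw [htbc, ← hmt]
        exact trailingCoeff_nonzero_iff_nonzero.2 hT0)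
  refine ⟨x + b', ?_⟩
  rw [taylor_eval] at hx
  exact hx

theorem om_root_of_res [CharZero L] [IsAlgClosed L] (G : (omO L)[X]) 
    (hd : ∃ r, 1 ≤ r ∧ omRes L (G.coeff r) ≠ 0) : ∃ a, G.eval a = 0 := by
  obtain ⟨r, hr, hr2⟩ := hd
  set Gb := G.map (omRes L) with hGb
  have hGbc : ∀ i, Gb.coeff i = omRes L (G.coeff i) := fun i => coeff_map ..
  have hGb0 : Gb ≠ 0 := fun h => hr2 (by rw [← hGbc, h]; simp)
  obtain ⟨b, hb⟩ := IsAlgClosed.exists_root Gb (by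
    rw [degree_eq_natDegree hGb0]
    have : r ≤ Gb.natDegree := le_natDegree_of_ne_zero (by rw [hGbc]; exact hr2)
    exact_mod_cast (by omega : Gb.natDegree ≠ 0))
  set m := Gb.rootMultiplicity b with hm
  have hm1 : 1 ≤ m := (rootMultiplicity_pos hGb0).2 hb
  have hbO : (HahnSeries.C b : Om L) ∈ omO L := HahnSeries.orderTop_single_le
  set b' : omO L := ⟨HahnSeries.C b, hbO⟩ with hb'
  have hb'r : omRes L b' = b := by
    rw [omRes_apply]
    simp [hb', HahnSeries.C_apply]
  have hmt : (taylor b Gb).natTrailingDegree = m := by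
    rw [taylor_apply, hm, rootMultiplicity_eq_natTrailingDegree]
  have htb : (taylor b' G).map (omRes L) = taylor b Gb := by
    rw [taylor_apply, taylor_apply, Polynomial.map_comp]
    simp [hb'r, hGb]
  have htbc : ∀ i, omRes L ((taylor b' G).coeff i) = (taylor b Gb).coeff i := by
    intro i; rw [← htb, coeff_map]
  have hT0 : taylor b Gb ≠ 0 := by
    intro h
    exact hGb0 (taylor_injective b (by rw [h, map_zero]))
  obtain ⟨x, hx⟩ := om_root_step m (taylor b' G) hm1
    (by intro i hi
        rw [htbc]; exact coeff_eq_zero_of_lt_natTrailingDegree (by rw [hmt]; exact hi))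
    (by rw [htbc, ← hmt]
        exact trailingCoeff_nonzero_iff_nonzero.2 hT0)
  refine ⟨x + b', ?_⟩
  rw [taylor_eval] at hx
  exact hx

instance om_isAlgClosed [CharZero L] [IsAlgClosed L] : IsAlgClosed (Om L) := by
  apply IsAlgClosed.of_exists_root
  intro p hmon hirr
  set r := p.natDegree with hr
  have hr1 : 1 ≤ r := hirr.natDegree_pos
  by_cases hall : ∀ i < r, p.coeff i = 0
  · refine ⟨0, ?_⟩
    rw [← coeff_zero_eq_eval_zero]
    exact hall 0 (by omega)
  push Not at hall
  have hpr : p.coeff r = 1 := hmon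
  obtain ⟨l, G, hG1, hG2, hG3, hG4, hG5, hG6⟩ := om_rescale p r hall (by
    intro i hi
    rcases eq_or_lt_of_le hi with rfl | h
    · exact ⟨Or.inl rfl, by rw [hpr]; simp⟩
    · have : p.coeff i = 0 := coeff_eq_zero_of_natDegree_lt h
      exact ⟨Or.inr (Or.inl this), by rw [this]; simp⟩)
  obtain ⟨x, hx⟩ := om_root_of_res G ⟨r, hr1, by
    rw [omRes_apply, hG4, hpr]; simp⟩
  exact ⟨_, hG1 x hx⟩

end Puiseux3

open Matrix Polynomial

set_option linter.unusedSectionVars false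
section Om4
variable {L : Type} [Field L] [Algebra ℂ L]

noncomputable instance omAlg (L : Type) [Field L] [Algebra ℂ L] : Algebra ℂ (Om L) :=
  HahnSeries.instAlgebra

theorem omAlg_apply (r : ℂ) : algebraMap ℂ (Om L) r = HahnSeries.C (algebraMap ℂ L r) := rfl

/-- apply a coefficientwise map -/
noncomputable def omMap (φ : ℚ → L → L) (hφ : ∀ q, φ q 0 = 0) (x : Om L) : Om L where
  coeff q := φ q (x.coeff q)
  isPWO_support' := x.isPWO_support.mono (by
    intro q hq
    rw [Function.mem_support] at hq
    rw [HahnSeries.mem_support]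
    intro h
    exact hq (by rw [h, hφ]))

theorem omMap_support (φ : ℚ → L → L) (hφ : ∀ q, φ q 0 = 0) (x : Om L) :
    (omMap φ hφ x).support ⊆ x.support := by
  intro q hq
  rw [HahnSeries.mem_support] at *
  intro h
  apply hq
  change φ q (x.coeff q) = 0
  rw [h, hφ]

theorem omMap_order (φ : ℚ → L → L) (hφ : ∀ q, φ q 0 = 0) (x : Om L) :
    x.orderTop ≤ (omMap φ hφ x).orderTop := by
  rw [HahnSeries.le_orderTop_iff_forall]
  intro i hi
  change φ i (x.coeff i) = 0
  rw [HahnSeries.coeff_eq_zero_of_lt_orderTop hi, hφ]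

/-- coefficientwise derivation plus a multiple of `t d/dt` -/
noncomputable def omD (δ : Derivation ℂ L L) (b : L) : Derivation ℂ (Om L) (Om L) where
  toFun := omMap (fun q c => δ c + (q : L) * b * c) (by simp)
  map_add' x y := by
    ext q
    simp only [omMap, HahnSeries.coeff_add, map_add]
    ring
  map_smul' r x := by
    ext q
    simp only [omMap, HahnSeries.coeff_smul, RingHom.id_apply, smul_add]
    rw [Derivation.map_smul, mul_smul_comm]
  map_one_eq_zero' := by
    ext q
    change δ ((1 : Om L).coeff q) + (q : L) * b * (1 : Om L).coeff q = 0
    rw [HahnSeries.coeff_one]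
    split_ifs with h
    · simp [h]
    · simp
  leibniz' x y := by
    set φ : ℚ → L → L := fun q c => δ c + (q : L) * b * c with hφd
    have hφ : ∀ q, φ q 0 = 0 := by simp [hφd]
    ext q
    change φ q ((x * y).coeff q) = (x * omMap φ hφ y + y * omMap φ hφ x).coeff q
    rw [mul_comm y, HahnSeries.coeff_add, HahnSeries.coeff_mul,
      HahnSeries.coeff_mul_left' x.isPWO_support (omMap_support φ hφ x),
      HahnSeries.coeff_mul_right' y.isPWO_support (omMap_support φ hφ y)]
    rw [← Finset.sum_add_distrib]
    simp only [hφd, map_sum, Finset.mul_sum]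
    rw [← Finset.sum_add_distrib]
    apply Finset.sum_congr rfl
    intro ij hij
    have h := (Finset.mem_antidiagonal.1 hij).2.2
    simp only [omMap]
    rw [← h, Derivation.leibniz]
    simp only [smul_eq_mul]
    by_cases hc : CharZero L
    · push_cast
      ring
    · exact (hc (charZero_of_injective_algebraMap (algebraMap ℂ L).injective)).elim

theorem omD_coeff (δ : Derivation ℂ L L) (b : L) (x : Om L) (q : ℚ) :
    (omD δ b x).coeff q = δ (x.coeff q) + (q : L) * b * x.coeff q := rfl

theorem omD_order (δ : Derivation ℂ L L) (b : L) (x : Om L) :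
    x.orderTop ≤ (omD δ b x).orderTop :=
  omMap_order (fun q c => δ c + (q : L) * b * c) (by simp) x

/-- `e(q) = exp(2πiq)` -/
noncomputable def ee (q : ℚ) : ℂ := Complex.exp (2 * Real.pi * Complex.I * q)

theorem ee_zero : ee 0 = 1 := by simp [ee]

theorem ee_add (a b : ℚ) : ee (a + b) = ee a * ee b := by
  simp only [ee]
  rw [← Complex.exp_add]
  push_cast
  ring_nf

theorem ee_ne (a : ℚ) : ee a ≠ 0 := Complex.exp_ne_zero _

theorem ee_int (a : ℤ) : ee a = 1 := by
  simp only [ee]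
  rw [Complex.exp_eq_one_iff]
  exact ⟨a, by push_cast; ring⟩

theorem ee_eq_one {a : ℚ} (h : ee a = 1) : ∃ k : ℤ, a = k := by
  simp only [ee] at h
  rw [Complex.exp_eq_one_iff] at h
  obtain ⟨k, hk⟩ := h
  refine ⟨k, ?_⟩
  have h2 : (2 * Real.pi * Complex.I : ℂ) ≠ 0 := Complex.two_pi_I_ne_zero
  have : (a : ℂ) = k := by
    apply mul_left_cancel₀ h2
    rw [hk]; ring
  exact_mod_cast this

theorem ee_eq {a b : ℚ} (h : ee a = ee b) : ∃ k : ℤ, a = b + k := by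
  have h1 : ee (a - b) = 1 := by
    have := ee_add (a - b) b
    rw [sub_add_cancel, h] at this
    exact mul_right_cancel₀ (ee_ne b) (by rw [← this, one_mul])
  obtain ⟨k, hk⟩ := ee_eq_one h1
  exact ⟨k, by rw [← hk]; ring⟩

theorem ee_natmul (k : ℕ) (a : ℚ) : ee (k * a) = ee a ^ k := by
  induction k with
  | zero => simp [ee_zero]
  | succ k ih => rw [pow_succ, ← ih, ← ee_add]; congr 1; push_cast; ring

theorem ee_sum {ι : Type*} (s : Finset ι) (f : ι → ℚ) : ee (∑ i ∈ s, f i) = ∏ i ∈ s, ee (f i) := by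
  classical
  induction s using Finset.induction_on with
  | empty => simp [ee_zero]
  | insert a s h ih => rw [Finset.sum_insert h, Finset.prod_insert h, ee_add, ih]

/-- monodromy -/
noncomputable def omS (L : Type) [Field L] [Algebra ℂ L] : Om L →ₐ[ℂ] Om L where
  toFun := omMap (fun q c => ee q • c) (by simp)
  map_one' := by
    ext q
    change ee q • (1 : Om L).coeff q = (1 : Om L).coeff q
    rw [HahnSeries.coeff_one]
    split_ifs with h
    · simp [h, ee_zero]
    · simp
  map_zero' := by ext q; simp [omMap]
  map_add' x y := by ext q; simp [omMap]
  map_mul' x y := by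
    set φ : ℚ → L → L := fun q c => ee q • c with hφd
    have hφ : ∀ q, φ q 0 = 0 := by simp [hφd]
    ext q
    change φ q ((x * y).coeff q) = (omMap φ hφ x * omMap φ hφ y).coeff q
    rw [HahnSeries.coeff_mul, HahnSeries.coeff_mul_left' x.isPWO_support (omMap_support φ hφ x)]
    rw [Finset.sum_subset (s₁ := Finset.antidiagonal x.isPWO_support (omMap φ hφ y).isPWO_support q)
      (s₂ := Finset.antidiagonal x.isPWO_support y.isPWO_support q)]
    · simp only [hφd, Finset.smul_sum]
      apply Finset.sum_congr rfl
      intro ij hij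
      have h := (Finset.mem_antidiagonal.1 hij).2.2
      simp only [omMap]
      rw [← h, ee_add, smul_mul_smul_comm]
    · intro ij hij
      rw [Finset.mem_antidiagonal] at *
      exact ⟨hij.1, omMap_support φ hφ y hij.2.1, hij.2.2⟩
    · intro ij hij hij2
      rw [Finset.mem_antidiagonal] at *
      have : ij.2 ∉ (omMap φ hφ y).support := fun h => hij2 ⟨hij.1, h, hij.2.2⟩
      rw [HahnSeries.mem_support, not_not] at this
      rw [this, mul_zero]
  commutes' r := by
    ext q
    change ee q • (algebraMap ℂ (Om L) r).coeff q = (algebraMap ℂ (Om L) r).coeff q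
    rw [omAlg_apply, HahnSeries.C_apply, HahnSeries.coeff_single]
    split_ifs with h
    · simp [h, ee_zero]
    · simp

theorem omS_coeff (x : Om L) (q : ℚ) : (omS L x).coeff q = ee q • x.coeff q := rfl

/-- support of an eigenvector of the monodromy -/
theorem omS_eig {x : Om L} {β : ℚ} (h : omS L x = ee β • x) {q : ℚ} (hq : x.coeff q ≠ 0) :
    ∃ k : ℤ, q = β + k := by
  have h1 := congrArg (fun y => HahnSeries.coeff y q) h
  simp only [omS_coeff, HahnSeries.coeff_smul] at h1
  exact ee_eq (smul_left_injective ℂ hq h1)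

theorem omS_eig_order {x : Om L} {β : ℚ} (h : omS L x = ee β • x) (hx : 0 ≤ x.orderTop)
    (hβ : β < 1) : (β : WithTop ℚ) ≤ x.orderTop := by
  rw [om_le_iff]
  intro i hi
  by_contra hc
  obtain ⟨k, hk⟩ := omS_eig h hc
  have h0 : 0 ≤ i := by
    by_contra hneg
    exact hc ((om_le_iff (q := 0)).1 (by exact_mod_cast hx) i (not_le.1 hneg))
  have hk0 : (k : ℚ) < 0 := by linarith
  have : k ≤ -1 := by
    have : k < 0 := by exact_mod_cast hk0
    omega
  have : (k : ℚ) ≤ -1 := by exact_mod_cast this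
  linarith

theorem omS_t (a : ℚ) (c : L) :
    omS L (HahnSeries.single a c) = ee a • HahnSeries.single a c := by
  ext q
  rw [omS_coeff, HahnSeries.coeff_smul, HahnSeries.coeff_single]
  split_ifs with h
  · rw [h]
  · simp

end Om4

/-- data: algebraically closed field with log derivations -/
theorem exists_logfield (n : ℕ) : ∃ (L : Type) (_ : Field L) (_ : Algebra ℂ L) (_ : IsAlgClosed L)
    (w : Fin n → L) (D : Fin n → Derivation ℂ L L), (∀ i, w i ≠ 0) ∧
    ∀ i j, D i (w j) = if i = j then w j else 0 := by
  induction n with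
  | zero => exact ⟨ℂ, inferInstance, inferInstance, inferInstance, Fin.elim0, Fin.elim0,
      fun i => i.elim0, fun i => i.elim0⟩
  | succ n ih =>
    obtain ⟨L, _, _, _, w, D, hw, hD⟩ := ih
    have : CharZero L := charZero_of_injective_algebraMap (algebraMap ℂ L).injective
    refine ⟨Om L, inferInstance, omAlg L, inferInstance,
      Fin.cons (omT L 1) (fun i => HahnSeries.C (w i)),
      Fin.cons (omD 0 1) (fun i => omD (D i) 0), ?_, ?_⟩
    · intro i
      refine Fin.cases ?_ (fun i => ?_) i
      · simp [omT]
      · simp [hw i]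
    · intro i j
      refine Fin.cases ?_ (fun i => ?_) i <;> refine Fin.cases ?_ (fun j => ?_) j
      · ext q
        simp only [Fin.cons_zero, if_true, omD_coeff, omT, HahnSeries.coeff_single]
        split_ifs with h <;> simp [h]
      · ext q
        simp only [Fin.cons_zero, Fin.cons_succ, omD_coeff, HahnSeries.C_apply,
          HahnSeries.coeff_single]
        split_ifs with h h' h' <;> simp_all
        exact (Fin.succ_ne_zero _ h'.symm).elim
      · ext q
        simp only [Fin.cons_zero, Fin.cons_succ, omD_coeff, omT,
          HahnSeries.coeff_single]
        split_ifs with h h' h' <;> simp_all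
      · ext q
        simp only [Fin.cons_succ, omD_coeff, HahnSeries.C_apply,
          HahnSeries.coeff_single, Fin.succ_inj]
        split_ifs with h h' h' <;> simp_all

open Matrix Polynomial

/-! ### polynomial derivative generalities -/

theorem mv_pderiv_deg {σ : Type*} (P : MvPolynomial σ ℂ) (k : σ) (h : 0 < P.totalDegree) :
    (MvPolynomial.pderiv k P).totalDegree < P.totalDegree := by
  rw [MvPolynomial.totalDegree, Finset.sup_lt_iff (by exact h)]
  intro m hm
  rw [MvPolynomial.mem_support_iff, MvPolynomial.coeff_pderiv] at hm
  have h1 : P.coeff (m + Finsupp.single k 1) ≠ 0 := left_ne_zero_of_mul hm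
  have h2 := MvPolynomial.le_totalDegree (MvPolynomial.mem_support_iff.2 h1)
  have h3 : (m + Finsupp.single k 1).sum (fun _ e => e) = m.sum (fun _ e => e) + 1 := by
    rw [Finsupp.sum_add_index'] <;> simp
  omega

theorem mv_pderiv_exists {σ : Type*} (P : MvPolynomial σ ℂ) (h : 0 < P.totalDegree) :
    ∃ k, MvPolynomial.pderiv k P ≠ 0 := by
  classical
  by_contra hcon
  push Not at hcon
  have : ∀ m ∈ P.support, m = 0 := by
    intro m hm
    ext k
    by_contra hk
    have h1 := congrArg (MvPolynomial.coeff (m - Finsupp.single k 1)) (hcon k)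
    rw [MvPolynomial.coeff_pderiv] at h1
    have h2 : m - Finsupp.single k 1 + Finsupp.single k 1 = m :=
      tsub_add_cancel_of_le (by
        rw [Finsupp.single_le_iff]
        simp only [Finsupp.coe_zero, Pi.zero_apply] at hk
        omega)
    rw [h2] at h1
    rw [MvPolynomial.mem_support_iff] at hm
    rw [MvPolynomial.coeff_zero] at h1
    rcases mul_eq_zero.1 h1 with h3 | h3
    · exact hm h3
    · exact Nat.cast_add_one_ne_zero _ h3
  have h0 : P.totalDegree = 0 := by
    rw [← Nat.le_zero, MvPolynomial.totalDegree]
    apply Finset.sup_le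
    intro m hm
    rw [this m hm]; simp
  omega

theorem chain_rule {σ : Type*} [Fintype σ] {K : Type*} [CommRing K] [Algebra ℂ K] (D : Derivation ℂ K K)
    (κ : MvPolynomial σ ℂ →ₐ[ℂ] K) (f : MvPolynomial σ ℂ) :
    D (κ f) = ∑ k, D (κ (MvPolynomial.X k)) * κ (MvPolynomial.pderiv k f) := by
  classical
  induction f using MvPolynomial.induction_on with
  | C a =>
    have : κ (MvPolynomial.C a) = algebraMap ℂ K a := κ.commutes a
    simp [this]
  | add p q hp hq =>
    simp only [map_add, hp, hq, mul_add, Finset.sum_add_distrib]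
  | mul_X p i hp =>
    rw [map_mul, Derivation.leibniz, hp]
    simp only [MvPolynomial.pderiv_mul, map_add, map_mul, MvPolynomial.pderiv_X, mul_add,
      Finset.sum_add_distrib, smul_eq_mul, Finset.mul_sum]
    rw [add_comm]
    congr 1
    · exact Finset.sum_congr rfl fun k _ => by ring
    · rw [Finset.sum_eq_single i]
      · simp; ring
      · intro b _ hb
        simp [Pi.single_apply, hb]
      · simp

/-- matrix of derivatives -/
def dmat {n : ℕ} {K : Type*} [CommRing K] [Algebra ℂ K] (D : Fin n → Derivation ℂ K K)
    (x : Fin n → K) : Matrix (Fin n) (Fin n) K := Matrix.of fun i j => D i (x j)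

theorem dmat_apply {n : ℕ} {K : Type*} [CommRing K] [Algebra ℂ K] (D : Fin n → Derivation ℂ K K)
    (x : Fin n → K) (i j) : dmat D x i j = D i (x j) := rfl

/-- Jacobian determinant -/
noncomputable def jac {n : ℕ} (F : Fin n → MvPolynomial (Fin n) ℂ) : MvPolynomial (Fin n) ℂ :=
  (Matrix.of fun i j => MvPolynomial.pderiv i (F j)).det

theorem det_chain {n : ℕ} {K : Type*} [CommRing K] [Algebra ℂ K] (D : Fin n → Derivation ℂ K K)
    (κ : MvPolynomial (Fin n) ℂ →ₐ[ℂ] K) (F : Fin n → MvPolynomial (Fin n) ℂ) :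
    (dmat D (fun j => κ (F j))).det =
      (dmat D (fun j => κ (MvPolynomial.X j))).det * κ (jac F) := by
  rw [jac, AlgHom.map_det, ← Matrix.det_mul]
  congr 1
  ext i j
  rw [dmat_apply, chain_rule]
  rfl

/-- independence -/
theorem indep_of_det {n : ℕ} {K : Type*} [Field K] [Algebra ℂ K] (D : Fin n → Derivation ℂ K K)
    (x : Fin n → K) (h : (dmat D x).det ≠ 0) (P : MvPolynomial (Fin n) ℂ)
    (hP : MvPolynomial.aeval x P = 0) : P = 0 := by
  generalize hd : P.totalDegree = d
  induction d using Nat.strong_induction_on generalizing P with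
  | _ d ih =>
    by_cases hd0 : d = 0
    · rw [hd0, MvPolynomial.totalDegree_eq_zero_iff_eq_C] at hd
      rw [hd] at hP
      rw [MvPolynomial.aeval_C] at hP
      rw [hd, (map_eq_zero (algebraMap ℂ K)).1 hP, MvPolynomial.C_0]
    · exfalso
      have hpos : 0 < P.totalDegree := by omega
      obtain ⟨k, hk⟩ := mv_pderiv_exists P hpos
      apply hk
      refine ih _ (by rw [← hd]; exact mv_pderiv_deg P k hpos) _ ?_ rfl
      have hv : (dmat D x).mulVec (fun k => MvPolynomial.aeval x (MvPolynomial.pderiv k P)) = 0 := by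
        ext i
        have := chain_rule (D i) (MvPolynomial.aeval x) P
        rw [hP, map_zero] at this
        simp only [MvPolynomial.aeval_X] at this
        exact this.symm
      have := Matrix.eq_zero_of_mulVec_eq_zero h hv
      exact congrFun this k

/-! ### group action on polynomials -/

section act
variable {n : ℕ}

theorem glAct_X (g : GL (Fin n) ℂ) (i : Fin n) : glAct g (MvPolynomial.X i) =
    ∑ j, (g : Matrix (Fin n) (Fin n) ℂ) i j • MvPolynomial.X j := by
  simp [glAct]

theorem glAct_mul (g h : GL (Fin n) ℂ) (p : MvPolynomial (Fin n) ℂ) :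
    glAct g (glAct h p) = glAct (h * g) p := by
  rw [← AlgHom.comp_apply]
  congr 1
  apply MvPolynomial.algHom_ext
  intro i
  rw [AlgHom.comp_apply, glAct_X, glAct_X, map_sum]
  simp only [map_smul, glAct_X, Finset.smul_sum, smul_smul]
  rw [Finset.sum_comm]
  apply Finset.sum_congr rfl
  intro j _
  rw [← Finset.sum_smul]
  simp [Matrix.mul_apply]

theorem glAct_one (p : MvPolynomial (Fin n) ℂ) : glAct (1 : GL (Fin n) ℂ) p = p := by
  have : glAct (1 : GL (Fin n) ℂ) = AlgHom.id ℂ _ := by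
    apply MvPolynomial.algHom_ext
    intro i
    rw [glAct_X]
    simp [Matrix.one_apply]
  rw [this]; rfl

theorem glAct_inj (g : GL (Fin n) ℂ) : Function.Injective (glAct g) := by
  intro a b h
  have := congrArg (glAct g⁻¹) h
  simpa [glAct_mul, glAct_one] using this

theorem mem_invariantRing {G : Subgroup (GL (Fin n) ℂ)} {p : MvPolynomial (Fin n) ℂ} :
    p ∈ invariantRing G ↔ ∀ g ∈ G, glAct g p = p := Iff.rfl

/-- characteristic polynomial of an element -/
noncomputable def chP (G : Subgroup (GL (Fin n) ℂ)) [Fintype G] (s : MvPolynomial (Fin n) ℂ) :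
    (MvPolynomial (Fin n) ℂ)[X] := ∏ g : G, (X - C (glAct g.1 s))

theorem chP_monic (G : Subgroup (GL (Fin n) ℂ)) [Fintype G] (s : MvPolynomial (Fin n) ℂ) :
    (chP G s).Monic := monic_prod_of_monic _ _ fun _ _ => monic_X_sub_C _

theorem chP_eval (G : Subgroup (GL (Fin n) ℂ)) [Fintype G] (s : MvPolynomial (Fin n) ℂ) :
    (chP G s).eval s = 0 := by
  rw [chP, eval_prod]
  apply Finset.prod_eq_zero (Finset.mem_univ (1 : G))
  simp [glAct_one]

theorem chP_coeff (G : Subgroup (GL (Fin n) ℂ)) [Fintype G] (s : MvPolynomial (Fin n) ℂ) (i : ℕ) :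
    (chP G s).coeff i ∈ invariantRing G := by
  intro h hh
  have : (chP G s).map (glAct h : _ →+* _) = chP G s := by
    rw [chP, Polynomial.map_prod]
    simp only [Polynomial.map_sub, map_X, map_C]
    refine Fintype.prod_equiv (Equiv.mulRight (⟨h, hh⟩ : G)) _ _ ?_
    intro g
    congr 2
    change glAct h (glAct g.1 s) = _
    rw [glAct_mul]
    rfl
  conv_rhs => rw [← this]
  rw [coeff_map]
  rfl

theorem integral_invariantRing (G : Subgroup (GL (Fin n) ℂ)) [Finite G]
    (s : MvPolynomial (Fin n) ℂ) : IsIntegral (invariantRing G) s := by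
  have := Fintype.ofFinite G
  have hl : chP G s ∈ lifts (algebraMap (invariantRing G) (MvPolynomial (Fin n) ℂ)) := by
    rw [lifts_iff_coeff_lifts]
    intro i
    exact ⟨⟨_, chP_coeff G s i⟩, rfl⟩
  obtain ⟨q, hq, -, hm⟩ := lifts_and_degree_eq_and_monic hl (chP_monic G s)
  refine ⟨q, hm, ?_⟩
  rw [← eval_map, hq, chP_eval]

theorem gal_exists (G : Subgroup (GL (Fin n) ℂ)) [Finite G] {K : Type*} [Field K] [Algebra ℂ K]
    (κ κ' : MvPolynomial (Fin n) ℂ →ₐ[ℂ] K) (h : ∀ p ∈ invariantRing G, κ p = κ' p) :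
    ∃ g ∈ G, ∀ p, κ' p = κ (glAct g p) := by
  have := Fintype.ofFinite G
  have key : ∀ s, ∃ g : G, κ' s = κ (glAct g.1 s) := by
    intro s
    have h1 : (chP G s).map (κ : _ →+* K) = (chP G s).map (κ' : _ →+* K) := by
      ext i
      rw [coeff_map, coeff_map]
      exact h _ (chP_coeff G s i)
    have h2 : ((chP G s).map (κ' : _ →+* K)).eval (κ' s) = 0 := by
      have := eval₂_hom (p := chP G s) (κ' : _ →+* K) s
      rw [chP_eval, map_zero] at this
      rw [eval_map]
      exact this
    rw [← h1, chP, Polynomial.map_prod, eval_prod, Finset.prod_eq_zero_iff] at h2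
    obtain ⟨g, -, hg⟩ := h2
    refine ⟨g, ?_⟩
    simp only [Polynomial.map_sub, map_X, map_C, eval_sub, eval_X, eval_C] at hg
    exact sub_eq_zero.1 hg
  let p : G → Subspace ℂ (MvPolynomial (Fin n) ℂ) := fun g =>
    LinearMap.eqLocus κ'.toLinearMap (κ.comp (glAct g.1)).toLinearMap
  obtain ⟨g, hg⟩ := Subspace.exists_eq_top_of_iUnion_eq_univ (p := p) (by
    rw [Set.eq_univ_iff_forall]
    intro s
    obtain ⟨g, hg⟩ := key s
    exact Set.mem_iUnion.2 ⟨g, hg⟩)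
  refine ⟨g.1, g.2, fun s => ?_⟩
  have : s ∈ p g := by rw [hg]; trivial
  exact this

end act

/-! ### valuations -/
section val
variable {L : Type} [Field L] [Algebra ℂ L]

theorem om_integral {x : Om L} (hx : IsIntegral (omO L) x) : 0 ≤ x.orderTop := by
  by_contra hcon
  push Not at hcon
  have hx0 : x ≠ 0 := by rintro rfl; simp at hcon
  obtain ⟨p, hm, hp⟩ := hx
  have hm' : x⁻¹.orderTop + x.orderTop = 0 := by
    rw [← HahnSeries.orderTop_mul, inv_mul_cancel₀ hx0]; simp
  have hpos : 0 < x⁻¹.orderTop := by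
    by_contra hc
    push Not at hc
    have : x⁻¹.orderTop + x.orderTop ≤ x.orderTop := by
      calc _ ≤ 0 + x.orderTop := by gcongr
        _ = _ := zero_add _
    rw [hm'] at this
    exact absurd hcon (not_lt.2 this)
  letI : Invertible x := invertibleOfNonzero hx0
  have h1 := (eval₂_reverse_eq_zero_iff (algebraMap (omO L) (Om L)) x p).2 hp
  rw [invOf_eq_inv] at h1
  set y : omO L := ⟨x⁻¹, hpos.le⟩
  have h2 : (reverse p).eval y = 0 := by
    have := eval₂_hom (p := reverse p) (omO L).subtype y
    ext1
    exact this.symm.trans h1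
  have h3 : omRes L y = 0 := omRes_eq_zero.2 hpos
  have h4 := congrArg (omRes L) h2
  rw [← eval₂_hom, h3, eval₂_at_zero, map_zero, coeff_zero_reverse, hm.leadingCoeff, map_one] at h4
  exact one_ne_zero h4

theorem om_le_sum {ι : Type*} (s : Finset ι) (f : ι → Om L) (q : WithTop ℚ)
    (h : ∀ i ∈ s, q ≤ (f i).orderTop) : q ≤ (∑ i ∈ s, f i).orderTop := by
  classical
  induction s using Finset.induction_on with
  | empty => simp
  | insert a s ha ih =>
    rw [Finset.sum_insert ha]
    exact le_trans (le_min (h a (by simp)) (ih fun i hi => h i (by simp [hi])))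
      HahnSeries.min_orderTop_le_orderTop_add

theorem om_prod {ι : Type*} (s : Finset ι) (f : ι → Om L) :
    (∏ i ∈ s, f i).orderTop = ∑ i ∈ s, (f i).orderTop := by
  classical
  induction s using Finset.induction_on with
  | empty => simp
  | insert a s ha ih => rw [Finset.prod_insert ha, Finset.sum_insert ha, HahnSeries.orderTop_mul, ih]

theorem om_det {n : ℕ} (δ : Fin n → Derivation ℂ L L) (x : Fin n → Om L) (q : Fin n → ℚ)
    (h : ∀ j, (q j : WithTop ℚ) ≤ (x j).orderTop) :
    ((∑ j, q j : ℚ) : WithTop ℚ) ≤ (dmat (fun i => omD (δ i) 0) x).det.orderTop := by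
  rw [Matrix.det_apply]
  apply om_le_sum
  intro s _
  have : ((∑ j, q j : ℚ) : WithTop ℚ) ≤ (∏ i, dmat (fun i => omD (δ i) 0) x (s i) i).orderTop := by
    rw [om_prod]
    push_cast
    apply Finset.sum_le_sum
    intro i _
    exact (h i).trans (omD_order _ _ _)
  rcases Int.units_eq_one_or (Equiv.Perm.sign s) with hs | hs <;> rw [hs]
  · simpa using this
  · simpa using this

end val

open Matrix Polynomial

theorem argFrac_ee {c : ℚ} (h0 : 0 ≤ c) (h1 : c < 1) : argFrac (ee c) = c := by
  have e1 : ee c = Complex.exp (((2 * Real.pi * c : ℝ) : ℂ) * Complex.I) := by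
    rw [ee]; congr 1; push_cast; ring
  rw [argFrac, e1, Complex.arg_exp_mul_I, toIocMod]
  have hpi : (2 * Real.pi) ≠ 0 := by positivity
  have e2 : (2 * Real.pi * (c : ℝ) - toIocDiv Real.two_pi_pos (-Real.pi) (2 * Real.pi * c) • (2 * Real.pi)) / (2 * Real.pi)
      = c - (toIocDiv Real.two_pi_pos (-Real.pi) (2 * Real.pi * c) : ℤ) := by
    rw [zsmul_eq_mul]
    field_simp
  rw [e2, Int.fract_sub_intCast, Int.fract_eq_self]
  exact ⟨by exact_mod_cast h0, by exact_mod_cast h1⟩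

theorem exists_ee {z : ℂ} {m : ℕ} (hm : 0 < m) (hz : z ^ m = 1) :
    ∃ c : ℚ, 0 ≤ c ∧ c < 1 ∧ z = ee c := by
  have : NeZero m := ⟨hm.ne'⟩
  obtain ⟨i, hi, h⟩ := (Complex.isPrimitiveRoot_exp m hm.ne').eq_pow_of_pow_eq_one hz
  have hmq : (0 : ℚ) < m := by exact_mod_cast hm
  refine ⟨i / m, by positivity, ?_, ?_⟩
  · rw [div_lt_one hmq]; exact_mod_cast hi
  · rw [← h, ← Complex.exp_nat_mul, ee]
    congr 1
    push_cast
    ring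

theorem roots_of_conj {n : ℕ} {g P : GL (Fin n) ℂ} {d : Fin n → ℂ}
    (h : ((P * g * P⁻¹ : GL (Fin n) ℂ) : Matrix (Fin n) (Fin n) ℂ) = Matrix.diagonal d) :
    (g : Matrix (Fin n) (Fin n) ℂ).charpoly.roots = Multiset.map d Finset.univ.val := by
  have h1 : (g : Matrix (Fin n) (Fin n) ℂ).charpoly = (Matrix.diagonal d).charpoly := by
    rw [← h]
    rw [Units.val_mul, Units.val_mul, Matrix.coe_units_inv]
    exact (Matrix.charpoly_units_conj P g.1).symm
  rw [h1, Matrix.charpoly_diagonal]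
  rw [Polynomial.roots_prod _ _ (Finset.prod_ne_zero_iff.2 fun i _ => X_sub_C_ne_zero _)]
  simp

theorem quasi_of_conj {n : ℕ} {g P : GL (Fin n) ℂ} {d : Fin n → ℂ}
    (h : ((P * g * P⁻¹ : GL (Fin n) ℂ) : Matrix (Fin n) (Fin n) ℂ) = Matrix.diagonal d) :
    IsQuasiReflection (g : Matrix (Fin n) (Fin n) ℂ) ↔
      ∃ i, d i ≠ 1 ∧ ∀ j, j ≠ i → d j = 1 := by
  classical
  rw [IsQuasiReflection, roots_of_conj h]
  have e : Multiset.filter (fun z => z ≠ 1) (Multiset.map d Finset.univ.val) = 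
     Multiset.map d (Finset.univ.filter fun i => d i ≠ 1).val := by
    rw [Multiset.filter_map]; rfl
  have e2 : Multiset.card (Multiset.filter (fun z => z ≠ 1) (Multiset.map d Finset.univ.val)) =
      (Finset.univ.filter fun i => d i ≠ 1).card := by
    rw [e, Multiset.card_map]; rfl
  have e3 : ∀ (inst : DecidablePred fun z : ℂ => z ≠ 1),
      Multiset.card (@Multiset.filter _ (fun z => z ≠ 1) inst (Multiset.map d Finset.univ.val)) =
      (Finset.univ.filter fun i => d i ≠ 1).card := by
    intro inst
    convert e2
  rw [e3, Finset.card_eq_one]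
  constructor
  · rintro ⟨a, ha⟩
    refine ⟨a, ?_, ?_⟩
    · have : a ∈ (Finset.univ.filter fun i => d i ≠ 1) := by rw [ha]; simp
      simpa using this
    · intro j hj
      by_contra hc
      have : j ∈ (Finset.univ.filter fun i => d i ≠ 1) := by simpa using hc
      rw [ha] at this
      exact hj (by simpa using this)
  · rintro ⟨i, hi, h⟩
    refine ⟨i, ?_⟩
    ext j
    simp only [Finset.mem_filter, Finset.mem_univ, true_and, Finset.mem_singleton]
    constructor
    · intro hj
      by_contra hc
      exact hj (h j hc)
    · rintro rfl; exact hi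

theorem diag_exists {n : ℕ} (g : GL (Fin n) ℂ) {m : ℕ} (hm : 0 < m) (hg : g ^ m = 1) :
    ∃ (P : GL (Fin n) ℂ) (c : Fin n → ℚ), (∀ i, 0 ≤ c i ∧ c i < 1) ∧
      ((P * g * P⁻¹ : GL (Fin n) ℂ) : Matrix (Fin n) (Fin n) ℂ) =
        Matrix.diagonal (fun i => ee (c i)) ∧
      reidTaiSum (g : Matrix (Fin n) (Fin n) ℂ) = ((∑ i, c i : ℚ) : ℝ) := by
  set f : Module.End ℂ (Fin n → ℂ) := Matrix.toLin' (g : Matrix (Fin n) (Fin n) ℂ) with hf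
  have hfm : f ^ m = 1 := by
    rw [hf, ← Matrix.toLin'_pow, ← Units.val_pow_eq_pow_val, hg]
    simp; rfl
  have hss : f.IsSemisimple := by
    refine Module.End.isSemisimple_of_squarefree_aeval_eq_zero (p := X ^ m - C 1) ?_ ?_
    · exact (separable_X_pow_sub_C (1 : ℂ) (by exact_mod_cast hm.ne') one_ne_zero).squarefree
    · simp [hfm]
  have htop := hss.iSup_eigenspace_eq_top
  set s : Set (Fin n → ℂ) := {v | ∃ μ : ℂ, f v = μ • v}
  have hs : ⊤ ≤ Submodule.span ℂ s := by
    rw [← htop]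
    apply iSup_le
    intro μ v hv
    exact Submodule.subset_span ⟨μ, Module.End.mem_eigenspace_iff.1 hv⟩
  let b0 := Module.Basis.ofSpan hs
  have hb0 : ∀ i, b0 i ∈ s := fun i => Module.Basis.ofSpan_subset hs ⟨i, rfl⟩
  let e := b0.indexEquiv (Pi.basisFun ℂ (Fin n))
  let b := b0.reindex e
  have hb : ∀ i, ∃ μ : ℂ, f (b i) = μ • b i := by
    intro i
    have : b i = b0 (e.symm i) := by simp [b]
    rw [this]; exact hb0 _
  choose d hd using hb
  have hdm : ∀ i, d i ^ m = 1 := by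
    intro i
    have h1 : ∀ k : ℕ, (f ^ k) (b i) = d i ^ k • b i := by
      intro k
      induction k with
      | zero => simp
      | succ k ih => rw [pow_succ', Module.End.mul_apply, ih, map_smul, hd, smul_smul, pow_succ]
    have h2 := h1 m
    rw [hfm, Module.End.one_apply] at h2
    by_contra hc
    have h3 : (d i ^ m - 1) • b i = 0 := by rw [sub_smul, ← h2, one_smul, sub_self]
    rcases smul_eq_zero.1 h3 with h4 | h4
    · exact hc (sub_eq_zero.1 h4)
    · exact b.ne_zero i h4
  choose c hc0 hc1 hc using fun i => exists_ee hm (hdm i)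
  -- matrix of eigenvectors
  let Q : Matrix (Fin n) (Fin n) ℂ := (Pi.basisFun ℂ (Fin n)).toMatrix b
  have hQ1 : Q * b.toMatrix (Pi.basisFun ℂ (Fin n)) = 1 := Module.Basis.toMatrix_mul_toMatrix_flip ..
  have hQ2 : b.toMatrix (Pi.basisFun ℂ (Fin n)) * Q = 1 := Module.Basis.toMatrix_mul_toMatrix_flip ..
  let U : GL (Fin n) ℂ := ⟨Q, _, hQ1, hQ2⟩
  have hgQ : (g : Matrix (Fin n) (Fin n) ℂ) * Q = Q * Matrix.diagonal (fun i => ee (c i)) := by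
    ext i j
    rw [Matrix.mul_diagonal]
    have := congrFun (hd j) i
    rw [hf, Matrix.toLin'_apply] at this
    rw [← hc j]
    have hQa : ∀ i j, Q i j = b j i := fun i j => by simp [Q, Module.Basis.toMatrix_apply]
    rw [hQa, mul_comm, Matrix.mul_apply]
    simp only [hQa]
    exact this
  have hconj : ((U⁻¹ * g * U⁻¹⁻¹ : GL (Fin n) ℂ) : Matrix (Fin n) (Fin n) ℂ) =
        Matrix.diagonal (fun i => ee (c i)) := by
    rw [inv_inv, Units.val_mul, Units.val_mul, Matrix.mul_assoc]
    change _ * (_ * Q) = _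
    rw [hgQ, ← Matrix.mul_assoc]
    have : ((U⁻¹ : GL (Fin n) ℂ) : Matrix (Fin n) (Fin n) ℂ) * Q = 1 := U.inv_mul
    rw [this, Matrix.one_mul]
  refine ⟨U⁻¹, c, fun i => ⟨hc0 i, hc1 i⟩, hconj, ?_⟩
  rw [reidTaiSum, roots_of_conj hconj, Multiset.map_map]
  push_cast
  change (Finset.univ.sum _) = _
  apply Finset.sum_congr rfl
  intro i _
  exact argFrac_ee (hc0 i) (hc1 i)

theorem not_quasi_of_age {n : ℕ} (g : GL (Fin n) ℂ) {m : ℕ} (hm : 0 < m) (hg : g ^ m = 1)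
    (h : g ≠ 1 → 1 ≤ reidTaiSum (g : Matrix (Fin n) (Fin n) ℂ)) :
    ¬ IsQuasiReflection (g : Matrix (Fin n) (Fin n) ℂ) := by
  obtain ⟨P, c, hc, hP, hage⟩ := diag_exists g hm hg
  rw [quasi_of_conj hP]
  rintro ⟨i, hi, hj⟩
  have hg1 : g ≠ 1 := by
    rintro rfl
    apply hi
    rw [mul_one, mul_inv_cancel] at hP
    have := congrFun (congrFun hP i) i
    simpa using this.symm
  have h1 := h hg1
  rw [hage] at h1
  have h2 : ∑ j, c j = c i := by
    apply Finset.sum_eq_single i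
    · intro j _ hji
      obtain ⟨k, hk⟩ := ee_eq_one (hj j hji)
      have h3 := hc j
      rw [hk] at h3 ⊢
      have h4 : 0 ≤ k := by exact_mod_cast h3.1
      have h5 : k < 1 := by exact_mod_cast h3.2
      have : k = 0 := by omega
      simp [this]
    · simp
  rw [h2] at h1
  have : (1 : ℚ) ≤ c i := by exact_mod_cast h1
  exact absurd (hc i).2 (not_lt.2 this)

open Matrix Polynomial

set_option linter.unusedSectionVars false
section cst
variable {n : ℕ}

theorem glAct_homog (g : GL (Fin n) ℂ) {p : MvPolynomial (Fin n) ℂ} {d : ℕ}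
    (hp : p.IsHomogeneous d) : (glAct g p).IsHomogeneous d := by
  have h := MvPolynomial.IsHomogeneous.aeval hp
    (fun i => ∑ j, (g : Matrix (Fin n) (Fin n) ℂ) i j • (MvPolynomial.X j : MvPolynomial (Fin n) ℂ)) (n := 1) (by
      intro i
      apply MvPolynomial.IsHomogeneous.sum
      intro j _
      rw [MvPolynomial.smul_eq_C_mul]
      exact (MvPolynomial.isHomogeneous_X _ _).C_mul _)
  rwa [one_mul] at h

theorem glAct_comp (g : GL (Fin n) ℂ) (p : MvPolynomial (Fin n) ℂ) (d : ℕ) :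
    MvPolynomial.homogeneousComponent d (glAct g p) =
      glAct g (MvPolynomial.homogeneousComponent d p) := by
  classical
  conv_lhs => rw [← MvPolynomial.sum_homogeneousComponent p]
  rw [map_sum, map_sum]
  have : ∀ i, MvPolynomial.homogeneousComponent d (glAct g (MvPolynomial.homogeneousComponent i p)) =
      if i = d then glAct g (MvPolynomial.homogeneousComponent i p) else 0 := by
    intro i
    rw [MvPolynomial.homogeneousComponent_of_mem
      (glAct_homog g (MvPolynomial.homogeneousComponent_isHomogeneous i p))]
    simp only [eq_comm]
  simp only [this]
  rw [Finset.sum_ite_eq']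
  split_ifs with h
  · rfl
  · have : MvPolynomial.homogeneousComponent d p = 0 := by
      apply MvPolynomial.homogeneousComponent_eq_zero
      simpa using h
    rw [this, map_zero]

theorem glAct_const (g : GL (Fin n) ℂ) (p : MvPolynomial (Fin n) ℂ) :
    MvPolynomial.constantCoeff (glAct g p) = MvPolynomial.constantCoeff p := by
  have h : (MvPolynomial.aeval (0 : Fin n → ℂ)).comp (glAct g) = MvPolynomial.aeval (0 : Fin n → ℂ) := by
    apply MvPolynomial.algHom_ext
    intro i
    rw [AlgHom.comp_apply, glAct_X]
    simp
  have := congrArg (fun f => f p) h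
  simp only [AlgHom.comp_apply] at this
  rwa [MvPolynomial.aeval_zero, MvPolynomial.aeval_zero] at this

theorem glAct_deg (g : GL (Fin n) ℂ) (p : MvPolynomial (Fin n) ℂ) :
    (glAct g p).totalDegree ≤ p.totalDegree := by
  conv_lhs => rw [← MvPolynomial.sum_homogeneousComponent p]
  rw [map_sum]
  apply MvPolynomial.totalDegree_finsetSum_le
  intro i hi
  refine ((glAct_homog g (MvPolynomial.homogeneousComponent_isHomogeneous i p)).totalDegree_le).trans ?_
  simpa [Nat.lt_succ_iff] using hi

/-- averaging -/
noncomputable def avg (H : Subgroup (GL (Fin n) ℂ)) [Fintype H] :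
    MvPolynomial (Fin n) ℂ →ₗ[ℂ] MvPolynomial (Fin n) ℂ :=
  (Fintype.card H : ℂ)⁻¹ • ∑ h : H, (glAct h.1).toLinearMap

variable (H : Subgroup (GL (Fin n) ℂ)) [Fintype H]

theorem avg_apply (p : MvPolynomial (Fin n) ℂ) :
    avg H p = (Fintype.card H : ℂ)⁻¹ • ∑ h : H, glAct h.1 p := by
  simp [avg]

theorem avg_mem (p : MvPolynomial (Fin n) ℂ) : avg H p ∈ invariantRing H := by
  intro g hg
  rw [avg_apply, map_smul, map_sum]
  congr 1
  refine Fintype.sum_equiv (Equiv.mulRight (⟨g, hg⟩ : H)) _ _ ?_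
  intro h
  rw [glAct_mul]; rfl

theorem avg_mul {f : MvPolynomial (Fin n) ℂ} (hf : f ∈ invariantRing H) (p : MvPolynomial (Fin n) ℂ) :
    avg H (p * f) = avg H p * f := by
  rw [avg_apply, avg_apply, smul_mul_assoc, Finset.sum_mul]
  congr 1
  apply Finset.sum_congr rfl
  intro h _
  rw [map_mul, hf h.1 h.2]

theorem avg_of_mem {f : MvPolynomial (Fin n) ℂ} (hf : f ∈ invariantRing H) : avg H f = f := by
  rw [avg_apply, Finset.sum_congr rfl (fun h _ => hf h.1 h.2)]
  rw [Finset.sum_const, Finset.card_univ, ← Nat.cast_smul_eq_nsmul ℂ, smul_smul, inv_mul_cancel₀, one_smul]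
  exact_mod_cast Fintype.card_ne_zero

theorem avg_const (p : MvPolynomial (Fin n) ℂ) :
    MvPolynomial.constantCoeff (avg H p) = MvPolynomial.constantCoeff p := by
  rw [avg_apply, MvPolynomial.smul_eq_C_mul, map_mul, map_sum]
  simp only [glAct_const]
  rw [Finset.sum_const, Finset.card_univ, nsmul_eq_mul, ← mul_assoc, MvPolynomial.constantCoeff_C,
    inv_mul_cancel₀, one_mul]
  exact_mod_cast Fintype.card_ne_zero

/-- positive invariants -/
def Rp (H : Subgroup (GL (Fin n) ℂ)) : Set (MvPolynomial (Fin n) ℂ) :=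
  {f | f ∈ invariantRing H ∧ MvPolynomial.constantCoeff f = 0}

/-- reflection -/
def IsLinRefl (s : GL (Fin n) ℂ) : Prop := ∃ l : MvPolynomial (Fin n) ℂ, l ≠ 0 ∧ l.IsHomogeneous 1 ∧
  ∀ p, l ∣ glAct s p - p

theorem isRefl_of_quasi {s : GL (Fin n) ℂ} {m : ℕ} (hm : 0 < m) (hs : s ^ m = 1)
    (h : IsQuasiReflection (s : Matrix (Fin n) (Fin n) ℂ)) : IsLinRefl s := by
  obtain ⟨P, c, hc, hP, hage⟩ := diag_exists s hm hs
  obtain ⟨i0, hi0, hj⟩ := (quasi_of_conj hP).1 h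
  set d : Fin n → ℂ := fun i => ee (c i) with hd
  have hs1 : ∀ i j, (s : Matrix (Fin n) (Fin n) ℂ) i j = (1 : Matrix (Fin n) (Fin n) ℂ) i j +
      (P⁻¹ : GL (Fin n) ℂ).1 i i0 * (d i0 - 1) * P.1 i0 j := by
    intro i j
    have e1 : s = P⁻¹ * (P * s * P⁻¹) * P := by group
    have e2 : (s : Matrix (Fin n) (Fin n) ℂ) = (P⁻¹ : GL (Fin n) ℂ).1 * Matrix.diagonal d * P.1 := by
      conv_lhs => rw [e1, Units.val_mul, Units.val_mul, hP]
    have e3 : (P⁻¹ : GL (Fin n) ℂ).1 * P.1 = 1 := P.inv_mul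
    have e4 : Matrix.diagonal d = 1 + Matrix.diagonal (fun i => d i - 1) := by
      ext a b
      by_cases hab : a = b
      · subst hab; simp
      · simp [hab]
    rw [e2, e4, mul_add, add_mul, mul_one, e3, Matrix.add_apply, Matrix.mul_apply]
    congr 1
    rw [Finset.sum_eq_single i0]
    · rw [Matrix.mul_diagonal]
    · intro b _ hb
      have hdb : d b = 1 := hj b hb
      rw [Matrix.mul_diagonal, hdb]; ring
    · simp
  set l : MvPolynomial (Fin n) ℂ := ∑ j, P.1 i0 j • MvPolynomial.X j with hl
  refine ⟨l, ?_, ?_, ?_⟩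
  · intro h0
    have h1 : P.1 i0 = 0 := by
      ext j
      have := congrArg (MvPolynomial.coeff (Finsupp.single j 1)) h0
      simp only [hl, MvPolynomial.coeff_sum, MvPolynomial.coeff_smul, MvPolynomial.coeff_X,
        Finsupp.single_left_inj (one_ne_zero), MvPolynomial.coeff_zero, smul_eq_mul] at this
      simpa using this
    have h2 : P.1 * (P⁻¹ : GL (Fin n) ℂ).1 = 1 := P.mul_inv
    have h3 := congrFun (congrFun h2 i0) i0
    rw [Matrix.mul_apply] at h3
    simp [h1] at h3
  · apply MvPolynomial.IsHomogeneous.sum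
    intro j _
    rw [MvPolynomial.smul_eq_C_mul]
    exact (MvPolynomial.isHomogeneous_X _ _).C_mul _
  · intro p
    induction p using MvPolynomial.induction_on with
    | C a =>
      have : glAct s (MvPolynomial.C a) = MvPolynomial.C a := (glAct s).commutes a
      rw [this, sub_self]; exact dvd_zero _
    | add p q hp hq =>
      rw [map_add, add_sub_add_comm]; exact dvd_add hp hq
    | mul_X p i hp =>
      have h1 : glAct s (MvPolynomial.X i) - MvPolynomial.X i =
          ((P⁻¹ : GL (Fin n) ℂ).1 i i0 * (d i0 - 1)) • l := by
        rw [glAct_X]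
        simp only [hs1, add_smul, Finset.sum_add_distrib]
        rw [hl, Finset.smul_sum]
        simp [Matrix.one_apply, smul_smul]
      have h2 : glAct s (p * MvPolynomial.X i) - p * MvPolynomial.X i =
        glAct s p * (glAct s (MvPolynomial.X i) - MvPolynomial.X i) +
          (glAct s p - p) * MvPolynomial.X i := by
        rw [map_mul]; ring
      rw [h2]
      apply dvd_add
      · rw [h1]
        exact Dvd.dvd.mul_left (Dvd.intro_left (MvPolynomial.C _) (MvPolynomial.smul_eq_C_mul _ _).symm) _
      · exact hp.mul_right _

theorem span_refl_div {a : Set (MvPolynomial (Fin n) ℂ)} (haR : ∀ f ∈ a, f ∈ invariantRing H)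
    {s : GL (Fin n) ℂ} (hs : s ∈ H) {l : MvPolynomial (Fin n) ℂ} (hl : ∀ p, l ∣ glAct s p - p)
    {f : MvPolynomial (Fin n) ℂ} (hf : f ∈ Ideal.span a) :
    ∃ f' ∈ Ideal.span a, glAct s f - f = l * f' := by
  induction hf using Submodule.span_induction with
  | mem x h => exact ⟨0, zero_mem _, by rw [haR x h s hs]; simp⟩
  | zero => exact ⟨0, zero_mem _, by simp⟩
  | add x y _ _ h1 h2 =>
    obtain ⟨x', hx', ex⟩ := h1
    obtain ⟨y', hy', ey⟩ := h2
    exact ⟨x' + y', add_mem hx' hy', by rw [map_add, add_sub_add_comm, ex, ey, mul_add]⟩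
  | smul r x hx h1 =>
    obtain ⟨x', hx', ex⟩ := h1
    obtain ⟨r', er⟩ := hl r
    refine ⟨glAct s r * x' + r' * x, add_mem (Ideal.mul_mem_left _ _ hx') (Ideal.mul_mem_left _ _ hx), ?_⟩
    rw [smul_eq_mul, map_mul]
    have e : glAct s r * glAct s x - r * x = glAct s r * (glAct s x - x) + (glAct s r - r) * x := by ring
    rw [e, ex, er]; ring

theorem cst_key (T : Set (GL (Fin n) ℂ)) (hT : ∀ s ∈ T, s ∈ H ∧ IsLinRefl s)
    (hH : H = Subgroup.closure T)
    (a : Submodule ℂ (MvPolynomial (Fin n) ℂ)) (haR : ∀ f ∈ a, f ∈ invariantRing H)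
    (ham : ∀ f ∈ a, ∀ r ∈ invariantRing H, r * f ∈ a)
    (g : MvPolynomial (Fin n) ℂ) (hgR : g ∈ invariantRing H) (hga : g ∉ a)
    (hRg : ∀ r ∈ Rp H, r * g ∈ a) (p : MvPolynomial (Fin n) ℂ)
    (hp : g * p ∈ Ideal.span (a : Set (MvPolynomial (Fin n) ℂ))) : p ∈ Ideal.span (Rp H) := by
  generalize hd : p.totalDegree = d
  induction d using Nat.strong_induction_on generalizing p with
  | _ d ih =>
    have hg0 : g ≠ 0 := by rintro rfl; exact hga (zero_mem _)
    -- reflections fix p mod I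
    have h1 : ∀ s ∈ T, glAct s p - p ∈ Ideal.span (Rp H) := by
      intro s hs
      obtain ⟨hsH, l, hl0, hl1, hl⟩ := hT s hs
      obtain ⟨q, hq⟩ := hl p
      obtain ⟨f', hf', ef⟩ := span_refl_div H haR hsH hl hp
      have e1 : g * q = f' := by
        rw [map_mul, hgR s hsH, ← mul_sub, hq] at ef
        apply mul_left_cancel₀ hl0
        rw [← ef]; ring
      by_cases hq0 : q = 0
      · rw [hq, hq0, mul_zero]; exact zero_mem _
      rw [hq]
      apply Ideal.mul_mem_left
      refine ih q.totalDegree ?_ q (by rw [e1]; exact hf') rfl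
      have e2 : (l * q).totalDegree = l.totalDegree + q.totalDegree :=
        MvPolynomial.totalDegree_mul_of_isDomain hl0 hq0
      have e3 : l.totalDegree = 1 := hl1.totalDegree hl0
      have e4 : (l * q).totalDegree ≤ p.totalDegree := by
        rw [← hq]
        exact (MvPolynomial.totalDegree_sub _ _).trans (max_le (glAct_deg s p) le_rfl)
      omega
    have hI : ∀ s ∈ H, ∀ f ∈ Ideal.span (Rp H), glAct s f ∈ Ideal.span (Rp H) := by
      intro s hs f hf
      induction hf using Submodule.span_induction with
      | mem x h => rw [h.1 s hs]; exact Ideal.subset_span h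
      | zero => simp
      | add x y _ _ h1 h2 => rw [map_add]; exact add_mem h1 h2
      | smul r x hx h1 => rw [smul_eq_mul, map_mul]; exact Ideal.mul_mem_left _ _ h1
    have h2 : ∀ s ∈ H, glAct s p - p ∈ Ideal.span (Rp H) := by
      have : ∀ s ∈ Subgroup.closure T, s ∈ H ∧ glAct s p - p ∈ Ideal.span (Rp H) := by
        intro s hs
        induction hs using Subgroup.closure_induction with
        | mem x hx => exact ⟨(hT x hx).1, h1 x hx⟩
        | one => exact ⟨one_mem _, by rw [glAct_one, sub_self]; exact zero_mem _⟩
        | mul x y _ _ hx hy =>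
          refine ⟨mul_mem hx.1 hy.1, ?_⟩
          rw [← glAct_mul]
          have := add_mem (hI y hy.1 _ hx.2) hy.2
          rwa [map_sub, sub_add_sub_cancel] at this
        | inv x _ hx =>
          refine ⟨inv_mem hx.1, ?_⟩
          have := neg_mem (hI x⁻¹ (inv_mem hx.1) _ hx.2)
          rwa [map_sub, glAct_mul, mul_inv_cancel, glAct_one, neg_sub] at this
      intro s hs
      exact (this s (hH ▸ hs)).2
    have h3 : avg H p - p ∈ Ideal.span (Rp H) := by
      have e : avg H p - p = (MvPolynomial.C (Fintype.card H : ℂ)⁻¹) * ∑ h : H, (glAct h.1 p - p) := by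
        rw [avg_apply, Finset.sum_sub_distrib, mul_sub, MvPolynomial.smul_eq_C_mul]
        congr 1
        rw [Finset.sum_const, Finset.card_univ, nsmul_eq_mul, ← mul_assoc,
          ← map_natCast (MvPolynomial.C (σ := Fin n) (R := ℂ)), ← map_mul, inv_mul_cancel₀, map_one, one_mul]
        exact_mod_cast Fintype.card_ne_zero
      rw [e]
      apply Ideal.mul_mem_left
      exact sum_mem fun h _ => h2 h.1 h.2
    set c := MvPolynomial.constantCoeff p with hc
    have h4 : avg H p - MvPolynomial.C c ∈ Ideal.span (Rp H) := by
      apply Ideal.subset_span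
      refine ⟨sub_mem (avg_mem H p) ((invariantRing H).algebraMap_mem c), ?_⟩
      rw [map_sub, avg_const, MvPolynomial.constantCoeff_C, sub_self]
    have h5 : p - MvPolynomial.C c ∈ Ideal.span (Rp H) := by
      have := sub_mem h4 h3
      rwa [sub_sub_sub_cancel_left] at this
    by_cases hc0 : c = 0
    · rwa [hc0, MvPolynomial.C_0, sub_zero] at h5
    exfalso
    have h6 : ∀ f ∈ Ideal.span (Rp H), f * g ∈ Ideal.span (a : Set (MvPolynomial (Fin n) ℂ)) := by
      intro f hf
      induction hf using Submodule.span_induction with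
      | mem x h => exact Ideal.subset_span (hRg x h)
      | zero => simp
      | add x y _ _ h1 h2 => rw [add_mul]; exact add_mem h1 h2
      | smul r x hx h1 => rw [smul_eq_mul, mul_assoc]; exact Ideal.mul_mem_left _ _ h1
    have h7 : MvPolynomial.C c * g ∈ Ideal.span (a : Set (MvPolynomial (Fin n) ℂ)) := by
      have := sub_mem hp (h6 _ h5)
      rwa [sub_mul, mul_comm g p, sub_sub_cancel] at this
    have h8 : ∀ f ∈ Ideal.span (a : Set (MvPolynomial (Fin n) ℂ)), ∀ r, avg H (r * f) ∈ a := by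
      intro f hf
      induction hf using Submodule.span_induction with
      | mem x h => 
        intro r
        rw [avg_mul H (haR x h)]
        exact ham x h _ (avg_mem H r)
      | zero => simp
      | add x y _ _ h1 h2 => intro r; rw [mul_add, map_add]; exact add_mem (h1 r) (h2 r)
      | smul r' x hx h1 => intro r; rw [smul_eq_mul, ← mul_assoc]; exact h1 _
    have h9 := h8 _ h7 1
    have hcg : MvPolynomial.C c * g ∈ invariantRing H :=
      mul_mem ((invariantRing H).algebraMap_mem c) hgR
    rw [one_mul, avg_of_mem H hcg] at h9
    have h10 := a.smul_mem c⁻¹ h9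
    rw [← MvPolynomial.smul_eq_C_mul, smul_smul, inv_mul_cancel₀ hc0, one_smul] at h10
    exact hga h10

end cst

open Matrix Polynomial

set_option linter.unusedSectionVars false
section cst2
variable {n : ℕ} (H : Subgroup (GL (Fin n) ℂ)) [Fintype H]

/-- `R_+^2` -/
noncomputable def Rp2 (H : Subgroup (GL (Fin n) ℂ)) : Submodule ℂ (MvPolynomial (Fin n) ℂ) :=
  Submodule.span ℂ {f | ∃ a ∈ Rp H, ∃ b ∈ Rp H, f = a * b}

theorem avg_I {f : MvPolynomial (Fin n) ℂ} (hf : f ∈ Ideal.span (Rp H)) (r : MvPolynomial (Fin n) ℂ)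
    (hr : MvPolynomial.constantCoeff r = 0) : avg H (r * f) ∈ Rp2 H := by
  induction hf using Submodule.span_induction generalizing r with
  | mem x h =>
    rw [avg_mul H h.1]
    exact Submodule.subset_span ⟨_, ⟨avg_mem H r, by rw [avg_const, hr]⟩, _, h, rfl⟩
  | zero => simp
  | add x y _ _ h1 h2 => rw [mul_add, map_add]; exact add_mem (h1 r hr) (h2 r hr)
  | smul r' x hx h1 =>
    rw [smul_eq_mul, ← mul_assoc]; exact h1 _ (by rw [map_mul, hr, zero_mul])

/-- degree of exponent -/
def edeg (m : Fin n →₀ ℕ) : ℕ := ∑ i, m i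

theorem edeg_add (a b : Fin n →₀ ℕ) : edeg (a + b) = edeg a + edeg b := by
  simp [edeg, Finset.sum_add_distrib]

theorem edeg_pos {a : Fin n →₀ ℕ} (h : a ≠ 0) : 0 < edeg a := by
  obtain ⟨i, hi⟩ := Finsupp.ne_iff.1 h
  simp only [Finsupp.coe_zero, Pi.zero_apply] at hi
  exact lt_of_lt_of_le (Nat.pos_of_ne_zero hi) (Finset.single_le_sum (f := fun i => a i) (fun _ _ => Nat.zero_le _) (Finset.mem_univ i))

theorem cst_indep (T : Set (GL (Fin n) ℂ)) (hT : ∀ s ∈ T, s ∈ H ∧ IsLinRefl s)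
    (hH : H = Subgroup.closure T) {ι : Type} [Fintype ι] (y : ι → MvPolynomial (Fin n) ℂ)
    (d : ι → ℕ) (hyd : ∀ i, (y i).IsHomogeneous (d i)) (hd : ∀ i, d i ≠ 0)
    (hyR : ∀ i, y i ∈ invariantRing H)
    (hlin : ∀ c : ι → ℂ, ∑ i, c i • y i ∈ Rp2 H → c = 0)
    (P : MvPolynomial ι ℂ) (hP : MvPolynomial.aeval y P = 0) : P = 0 := by
  classical
  generalize htd : P.totalDegree = N
  induction N using Nat.strong_induction_on generalizing P with
  | _ N ih =>
    by_cases hN : N = 0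
    · rw [hN, MvPolynomial.totalDegree_eq_zero_iff_eq_C] at htd
      rw [htd, MvPolynomial.aeval_C] at hP
      have : P.coeff 0 = 0 := by
        have := congrArg MvPolynomial.constantCoeff hP
        simpa using this
      rw [htd, this, MvPolynomial.C_0]
    exfalso
    have hpos : 0 < P.totalDegree := by omega
    set g : ι → MvPolynomial (Fin n) ℂ := fun i => MvPolynomial.aeval y (MvPolynomial.pderiv i P) with hg
    have hgR : ∀ i, g i ∈ invariantRing H := by
      intro i s hs
      have h1 : (glAct s).comp (MvPolynomial.aeval y) = MvPolynomial.aeval y := by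
        apply MvPolynomial.algHom_ext
        intro j
        simp [hyR j s hs]
      exact congrArg (fun f => f (MvPolynomial.pderiv i P)) h1
    obtain ⟨k0, hk0⟩ := mv_pderiv_exists P hpos
    have hgk0 : g k0 ≠ 0 := by
      intro h
      exact hk0 (ih _ (by rw [← htd]; exact mv_pderiv_deg P k0 hpos) _ h rfl)
    -- minimal exponent
    have hex : ∃ D : ℕ, ∃ i α, edeg α = D ∧ (g i).coeff α ≠ 0 := by
      obtain ⟨α, hα⟩ := MvPolynomial.ne_zero_iff.1 hgk0
      exact ⟨_, k0, α, rfl, hα⟩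
    obtain ⟨i1, α, hαD, hα⟩ := Nat.find_spec hex
    have hmin : ∀ i β, edeg β < edeg α → (g i).coeff β = 0 := by
      intro i β hβ
      by_contra hc
      rw [hαD] at hβ
      exact Nat.find_min hex hβ ⟨i, β, rfl, hc⟩
    let a : Submodule ℂ (MvPolynomial (Fin n) ℂ) :=
      { carrier := {f | f ∈ invariantRing H ∧ (∀ β, edeg β < edeg α → f.coeff β = 0) ∧ f.coeff α = 0}
        add_mem' := by
          rintro f f' ⟨h1, h2, h3⟩ ⟨h1', h2', h3'⟩
          refine ⟨add_mem h1 h1', ?_, ?_⟩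
          · intro β hβ; rw [MvPolynomial.coeff_add, h2 β hβ, h2' β hβ, add_zero]
          · rw [MvPolynomial.coeff_add, h3, h3', add_zero]
        zero_mem' := ⟨zero_mem _, by simp, by simp⟩
        smul_mem' := by
          rintro c f ⟨h1, h2, h3⟩
          refine ⟨(invariantRing H).smul_mem h1 c, ?_, ?_⟩
          · intro β hβ; rw [MvPolynomial.coeff_smul, h2 β hβ, smul_zero]
          · rw [MvPolynomial.coeff_smul, h3, smul_zero] }
    have ham : ∀ f ∈ a, ∀ r ∈ invariantRing H, r * f ∈ a := by
      rintro f ⟨h1, h2, h3⟩ r hr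
      have hall : ∀ β, edeg β < edeg α ∨ β = α → f.coeff β = 0 := by
        rintro β (h | h)
        · exact h2 β h
        · rw [h]; exact h3
      have key : ∀ β, edeg β < edeg α ∨ β = α → (r * f).coeff β = 0 := by
        intro β hβ
        rw [MvPolynomial.coeff_mul]
        apply Finset.sum_eq_zero
        rintro ⟨u, v⟩ huv
        rw [Finset.HasAntidiagonal.mem_antidiagonal] at huv
        simp only at huv ⊢
        rw [hall v, mul_zero]
        by_cases hu : u = 0
        · rw [hu, zero_add] at huv; rw [huv]; exact hβ
        · left
          have := edeg_pos hu
          have h4 := edeg_add u v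
          rw [huv] at h4
          rcases hβ with h | h
          · omega
          · rw [h] at h4; omega
      exact ⟨mul_mem hr h1, fun β hβ => key β (Or.inl hβ), key α (Or.inr rfl)⟩
    have hRg : ∀ r ∈ Rp H, r * g i1 ∈ a := by
      rintro r ⟨hr, hr0⟩
      have key : ∀ β, edeg β ≤ edeg α → (r * g i1).coeff β = 0 := by
        intro β hβ
        rw [MvPolynomial.coeff_mul]
        apply Finset.sum_eq_zero
        rintro ⟨u, v⟩ huv
        rw [Finset.HasAntidiagonal.mem_antidiagonal] at huv
        simp only at huv ⊢
        by_cases hu : u = 0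
        · have : r.coeff 0 = 0 := hr0
          rw [hu, this, zero_mul]
        · have := edeg_pos hu
          have h4 := edeg_add u v
          rw [huv] at h4
          rw [hmin i1 v (by omega), mul_zero]
      exact ⟨mul_mem hr (hgR i1), fun β hβ => key β hβ.le, key α le_rfl⟩
    set c : ι → ℂ := fun i => (g i).coeff α / (g i1).coeff α with hc
    have hga : ∀ i, g i - c i • g i1 ∈ a := by
      intro i
      refine ⟨sub_mem (hgR i) ((invariantRing H).smul_mem (hgR i1) _), ?_, ?_⟩
      · intro β hβ
        rw [MvPolynomial.coeff_sub, MvPolynomial.coeff_smul, hmin i β hβ, hmin i1 β hβ]; simp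
      · rw [MvPolynomial.coeff_sub, MvPolynomial.coeff_smul, hc]
        simp only [smul_eq_mul]
        rw [div_mul_cancel₀ _ hα, sub_self]
    set y' : MvPolynomial (Fin n) ℂ := ∑ i, c i • y i with hy'
    have hpd : ∀ k, MvPolynomial.pderiv k y' ∈ Ideal.span (Rp H) := by
      intro k
      apply cst_key H T hT hH a (fun f hf => hf.1) ham (g i1) (hgR i1) (fun h => hα h.2.2) hRg
      have h1 := chain_rule (MvPolynomial.pderiv k) (MvPolynomial.aeval y) P
      rw [hP, map_zero] at h1
      simp only [MvPolynomial.aeval_X] at h1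
      have h2 : g i1 * MvPolynomial.pderiv k y' =
          - ∑ i, MvPolynomial.pderiv k (y i) * (g i - c i • g i1) := by
        have : ∑ i, MvPolynomial.pderiv k (y i) * (g i - c i • g i1) =
          ∑ i, MvPolynomial.pderiv k (y i) * g i - g i1 * MvPolynomial.pderiv k y' := by
          rw [hy', map_sum, Finset.mul_sum, ← Finset.sum_sub_distrib]
          apply Finset.sum_congr rfl
          intro i _
          rw [Derivation.map_smul, MvPolynomial.smul_eq_C_mul, MvPolynomial.smul_eq_C_mul]
          ring
        rw [this, ← h1]; ring
      rw [h2]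
      apply neg_mem
      exact sum_mem fun i _ => Ideal.mul_mem_left _ _ (Ideal.subset_span (hga i))
    have heul : ∑ i, (c i * d i) • y i = ∑ k, MvPolynomial.X k * MvPolynomial.pderiv k y' := by
      have : ∀ i, (c i * d i) • y i = ∑ k, MvPolynomial.X k * MvPolynomial.pderiv k (c i • y i) := by
        intro i
        have h := (hyd i).sum_X_mul_pderiv
        simp only [Derivation.map_smul, mul_smul_comm]
        rw [← Finset.smul_sum, h, mul_smul, ← Nat.cast_smul_eq_nsmul ℂ]
      rw [Finset.sum_congr rfl fun i _ => this i, Finset.sum_comm]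
      apply Finset.sum_congr rfl
      intro k _
      rw [hy', map_sum, Finset.mul_sum]
    have hmem : ∑ i, (c i * d i) • y i ∈ Rp2 H := by
      have h1 : ∑ i, (c i * d i) • y i ∈ invariantRing H :=
        sum_mem fun i _ => (invariantRing H).smul_mem (hyR i) _
      rw [← avg_of_mem H h1, heul, map_sum]
      apply sum_mem
      intro k _
      exact avg_I H (hpd k) _ (by simp)
    have := congrFun (hlin _ hmem) i1
    simp only [hc, div_self hα, one_mul, Pi.zero_apply, Nat.cast_eq_zero] at this
    exact hd i1 this

end cst2

open Matrix Polynomial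

set_option linter.unusedSectionVars false
section cst3
variable {n : ℕ}

/-- equivariant complement -/
theorem equi_compl (G : Subgroup (GL (Fin n) ℂ)) [Finite G]
    (A B : Submodule ℂ (MvPolynomial (Fin n) ℂ)) (hBA : B ≤ A)
    (hA : ∀ g ∈ G, ∀ f ∈ A, glAct g f ∈ A) (hB : ∀ g ∈ G, ∀ f ∈ B, glAct g f ∈ B) :
    ∃ C : Submodule ℂ (MvPolynomial (Fin n) ℂ), C ≤ A ∧ (∀ g ∈ G, ∀ f ∈ C, glAct g f ∈ C) ∧
      (∀ f ∈ C, f ∈ B → f = 0) ∧ ∀ f ∈ A, ∃ c ∈ C, f - c ∈ B := by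
  have := Fintype.ofFinite G
  obtain ⟨π, hπ⟩ := LinearMap.exists_leftInverse_of_injective B.subtype B.ker_subtype
  have hπ' : ∀ f ∈ B, ((π f : B) : MvPolynomial (Fin n) ℂ) = f := by
    intro f hf
    have := congrArg (fun l => ((l ⟨f, hf⟩ : B) : MvPolynomial (Fin n) ℂ)) hπ
    simpa using this
  have hc : (Fintype.card G : ℂ) ≠ 0 := by exact_mod_cast Fintype.card_ne_zero
  let Q : MvPolynomial (Fin n) ℂ →ₗ[ℂ] MvPolynomial (Fin n) ℂ := (Fintype.card G : ℂ)⁻¹ •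
    ∑ h : G, (glAct (h.1)⁻¹).toLinearMap ∘ₗ B.subtype ∘ₗ π ∘ₗ (glAct h.1).toLinearMap
  have hQ : ∀ p, Q p = (Fintype.card G : ℂ)⁻¹ • ∑ h : G, glAct (h.1)⁻¹ (π (glAct h.1 p) : B).1 := by
    intro p; simp [Q]
  have hQB : ∀ p, Q p ∈ B := by
    intro p
    rw [hQ]
    refine B.smul_mem _ (B.sum_mem ?_)
    intro h _
    exact hB _ (G.inv_mem h.2) _ (π _).2
  have hQid : ∀ p ∈ B, Q p = p := by
    intro p hp
    rw [hQ]
    have : ∀ h : G, glAct (h.1)⁻¹ (π (glAct h.1 p) : B).1 = p := by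
      intro h
      rw [hπ' _ (hB _ h.2 _ hp), glAct_mul, mul_inv_cancel, glAct_one]
    simp only [this]
    rw [Finset.sum_const, Finset.card_univ, ← Nat.cast_smul_eq_nsmul ℂ, smul_smul, inv_mul_cancel₀ hc, one_smul]
  have hQg : ∀ g ∈ G, ∀ p, Q (glAct g p) = glAct g (Q p) := by
    intro g hg p
    rw [hQ, hQ, map_smul, map_sum]
    congr 1
    refine Fintype.sum_equiv (Equiv.mulLeft (⟨g, hg⟩ : G)) _ _ ?_
    intro h
    simp only [glAct_mul, Equiv.coe_mulLeft, Subgroup.coe_mul]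
    simp
  refine ⟨A ⊓ LinearMap.ker Q, inf_le_left, ?_, ?_, ?_⟩
  · rintro g hg f ⟨h1, h2⟩
    refine ⟨hA g hg f h1, ?_⟩
    have h2' : Q f = 0 := h2
    change Q (glAct g f) = 0
    rw [hQg g hg, h2', map_zero]
  · rintro f ⟨h1, h2⟩ hf
    have h2' : Q f = 0 := h2
    rw [← hQid f hf, h2']
  · intro f hf
    refine ⟨f - Q f, ⟨A.sub_mem hf (hBA (hQB f)), ?_⟩, ?_⟩
    · change Q (f - Q f) = 0
      rw [map_sub, hQid _ (hQB f), sub_self]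
    · simpa using hQB f

/-- graded pieces -/
def Agr (H : Subgroup (GL (Fin n) ℂ)) (d : ℕ) : Submodule ℂ (MvPolynomial (Fin n) ℂ) where
  carrier := {f | f ∈ Rp H ∧ f.IsHomogeneous d}
  add_mem' := by
    rintro a b ⟨⟨h1, h2⟩, h3⟩ ⟨⟨h4, h5⟩, h6⟩
    exact ⟨⟨add_mem h1 h4, by rw [map_add, h2, h5, add_zero]⟩, h3.add h6⟩
  zero_mem' := ⟨⟨zero_mem _, map_zero _⟩, MvPolynomial.isHomogeneous_zero _ _ _⟩
  smul_mem' := by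
    rintro c a ⟨⟨h1, h2⟩, h3⟩
    refine ⟨⟨Subalgebra.smul_mem _ h1 _, ?_⟩, ?_⟩
    · rw [MvPolynomial.smul_eq_C_mul, map_mul, h2, mul_zero]
    · rw [MvPolynomial.smul_eq_C_mul]; exact h3.C_mul _

theorem mem_Agr {H : Subgroup (GL (Fin n) ℂ)} {d : ℕ} {f : MvPolynomial (Fin n) ℂ} :
    f ∈ Agr H d ↔ f ∈ Rp H ∧ f.IsHomogeneous d := Iff.rfl

theorem comp_Agr {H : Subgroup (GL (Fin n) ℂ)} {f : MvPolynomial (Fin n) ℂ} (hf : f ∈ Rp H) (d : ℕ) :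
    MvPolynomial.homogeneousComponent d f ∈ Agr H d := by
  refine ⟨⟨?_, ?_⟩, MvPolynomial.homogeneousComponent_isHomogeneous _ _⟩
  · intro g hg
    rw [← glAct_comp, hf.1 g hg]
  · have h0 := hf.2
    rw [MvPolynomial.constantCoeff_eq] at h0 ⊢
    rw [MvPolynomial.coeff_homogeneousComponent, h0, ite_self]

theorem Agr_zero {H : Subgroup (GL (Fin n) ℂ)} {f : MvPolynomial (Fin n) ℂ} (hf : f ∈ Agr H 0) : f = 0 := by
  have h1 := MvPolynomial.totalDegree_eq_zero_iff_eq_C.1 (Nat.le_zero.1 hf.2.totalDegree_le)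
  have h2 := hf.1.2
  rw [MvPolynomial.constantCoeff_eq] at h2
  rw [h1, h2, map_zero]

theorem comp_Rp2 {H : Subgroup (GL (Fin n) ℂ)} (d : ℕ) (M : Submodule ℂ (MvPolynomial (Fin n) ℂ))
    (hM : ∀ i j, i + j = d → ∀ a ∈ Agr H i, ∀ b ∈ Agr H j, a * b ∈ M)
    {f : MvPolynomial (Fin n) ℂ} (hf : f ∈ Rp2 H) : MvPolynomial.homogeneousComponent d f ∈ M := by
  classical
  induction hf using Submodule.span_induction with
  | mem x h =>
    obtain ⟨a, ha, b, hb, rfl⟩ := h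
    rw [show a * b = _ from congrArg₂ (· * ·) (MvPolynomial.sum_homogeneousComponent a).symm
      (MvPolynomial.sum_homogeneousComponent b).symm]
    rw [Finset.sum_mul_sum, map_sum]
    refine M.sum_mem fun i _ => ?_
    rw [map_sum]
    refine M.sum_mem fun j _ => ?_
    rw [MvPolynomial.homogeneousComponent_of_mem
      ((MvPolynomial.homogeneousComponent_isHomogeneous i a).mul
        (MvPolynomial.homogeneousComponent_isHomogeneous j b))]
    split_ifs with h
    · exact hM i j h.symm _ (comp_Agr ha i) _ (comp_Agr hb j)
    · exact M.zero_mem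
  | zero => simp
  | add x y _ _ h1 h2 => rw [map_add]; exact add_mem h1 h2
  | smul r x _ h => rw [map_smul]; exact M.smul_mem _ h


/-- the reflection subgroup -/
def reflGrp (G : Subgroup (GL (Fin n) ℂ)) : Subgroup (GL (Fin n) ℂ) :=
  Subgroup.closure {g | g ∈ G ∧ IsQuasiReflection (g : Matrix (Fin n) (Fin n) ℂ)}

theorem reflGrp_le (G : Subgroup (GL (Fin n) ℂ)) : reflGrp G ≤ G := by
  refine (Subgroup.closure_le _).2 ?_
  rintro g ⟨h, _⟩; exact h

theorem reflGrp_mem {G : Subgroup (GL (Fin n) ℂ)} {g : GL (Fin n) ℂ} (hg : g ∈ G)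
    (h : IsQuasiReflection (g : Matrix (Fin n) (Fin n) ℂ)) : g ∈ reflGrp G :=
  Subgroup.subset_closure ⟨hg, h⟩

theorem reflGrp_conj (G : Subgroup (GL (Fin n) ℂ)) {g h : GL (Fin n) ℂ} (hg : g ∈ G)
    (hh : h ∈ reflGrp G) : g * h * g⁻¹ ∈ reflGrp G := by
  induction hh using Subgroup.closure_induction with
  | mem x hx =>
    refine reflGrp_mem (G.mul_mem (G.mul_mem hg hx.1) (G.inv_mem hg)) ?_
    have e : ((g * x * g⁻¹ : GL (Fin n) ℂ) : Matrix (Fin n) (Fin n) ℂ).charpoly =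
        (x : Matrix (Fin n) (Fin n) ℂ).charpoly := by
      rw [Units.val_mul, Units.val_mul, Matrix.coe_units_inv]
      exact Matrix.charpoly_units_conj g x.1
    have := hx.2
    unfold IsQuasiReflection at this ⊢
    rwa [e]
  | one => simp
  | mul x y _ _ h1 h2 =>
    have : g * (x * y) * g⁻¹ = (g * x * g⁻¹) * (g * y * g⁻¹) := by group
    rw [this]; exact Subgroup.mul_mem _ h1 h2
  | inv x _ h1 =>
    have : g * x⁻¹ * g⁻¹ = (g * x * g⁻¹)⁻¹ := by group
    rw [this]; exact Subgroup.inv_mem _ h1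

theorem Rp_act {G : Subgroup (GL (Fin n) ℂ)} {g : GL (Fin n) ℂ} (hg : g ∈ G)
    {f : MvPolynomial (Fin n) ℂ} (hf : f ∈ Rp (reflGrp G)) : glAct g f ∈ Rp (reflGrp G) := by
  refine ⟨?_, by rw [glAct_const, hf.2]⟩
  intro h hh
  have h1 := hf.1 _ (reflGrp_conj G hg hh)
  conv_rhs => rw [← h1]
  rw [glAct_mul, glAct_mul]
  simp

theorem Agr_act {G : Subgroup (GL (Fin n) ℂ)} {g : GL (Fin n) ℂ} (hg : g ∈ G) {d : ℕ}
    {f : MvPolynomial (Fin n) ℂ} (hf : f ∈ Agr (reflGrp G) d) : glAct g f ∈ Agr (reflGrp G) d :=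
  ⟨Rp_act hg hf.1, glAct_homog g hf.2⟩

theorem Rp2_act {G : Subgroup (GL (Fin n) ℂ)} {g : GL (Fin n) ℂ} (hg : g ∈ G)
    {f : MvPolynomial (Fin n) ℂ} (hf : f ∈ Rp2 (reflGrp G)) : glAct g f ∈ Rp2 (reflGrp G) := by
  induction hf using Submodule.span_induction with
  | mem x h =>
    obtain ⟨a, ha, b, hb, rfl⟩ := h
    rw [map_mul]
    exact Submodule.subset_span ⟨_, Rp_act hg ha, _, Rp_act hg hb, rfl⟩
  | zero => simp
  | add x y _ _ h1 h2 => rw [map_add]; exact add_mem h1 h2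
  | smul r x _ h => rw [map_smul]; exact Submodule.smul_mem _ _ h

/-- Chevalley-Shephard-Todd, equivariant version -/
theorem cst (G : Subgroup (GL (Fin n) ℂ)) [Finite G] : ∃ y : Fin n → MvPolynomial (Fin n) ℂ,
    AlgebraicIndependent ℂ y ∧ Algebra.adjoin ℂ (Set.range y) = invariantRing (reflGrp G) ∧
    ∀ g ∈ G, ∀ i, glAct g (y i) ∈ Submodule.span ℂ (Set.range y) := by
  classical
  set H := reflGrp G with hH
  have hHf : Finite H := Finite.of_injective _ (Subgroup.inclusion_injective (reflGrp_le G))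
  have := Fintype.ofFinite H
  have hC := fun d => equi_compl G (Agr H d) (Agr H d ⊓ Rp2 H) inf_le_left
    (fun g hg f hf => Agr_act hg hf) (fun g hg f hf => ⟨Agr_act hg hf.1, Rp2_act hg hf.2⟩)
  choose C hCA hCG hCB hCs using hC
  let b := fun d => Module.Basis.ofVectorSpace ℂ (C d)
  let y : (Σ d, Module.Basis.ofVectorSpaceIndex ℂ (C d)) → MvPolynomial (Fin n) ℂ :=
    fun s => (b s.1 s.2 : C s.1).1
  have hyC : ∀ s, y s ∈ C s.1 := fun s => (b s.1 s.2).2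
  have hyA : ∀ s, y s ∈ Agr H s.1 := fun s => hCA _ (hyC s)
  have hy0 : ∀ s, y s ≠ 0 := fun s h => (b s.1).ne_zero s.2 (Subtype.ext h)
  have hs0 : ∀ s : (Σ d, Module.Basis.ofVectorSpaceIndex ℂ (C d)), s.1 ≠ 0 := by
    rintro ⟨d, i⟩ h
    dsimp only at h
    subst h
    exact hy0 _ (Agr_zero (hyA ⟨0, i⟩))
  have hCspan : ∀ d, ∀ f ∈ C d, f ∈ Submodule.span ℂ (Set.range y) := by
    intro d f hf
    have h1 := (b d).mem_span (⟨f, hf⟩ : C d)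
    have h2 := Submodule.mem_map_of_mem (f := (C d).subtype) h1
    rw [Submodule.map_span] at h2
    refine Submodule.span_mono ?_ h2
    rintro _ ⟨_, ⟨i, rfl⟩, rfl⟩
    exact ⟨⟨d, i⟩, rfl⟩
  have hind : AlgebraicIndependent ℂ y := by
    apply algebraicIndependent_of_finite_type
    intro t ht
    have := ht.fintype
    refine (injective_iff_map_eq_zero _).2 ?_
    intro P hP
    refine cst_indep H {g | g ∈ G ∧ IsQuasiReflection (g : Matrix (Fin n) (Fin n) ℂ)} ?_ rfl
      (fun i : t => y i) (fun i => i.1.1) (fun i => (hyA i.1).2) (fun i => hs0 i.1)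
      (fun i => (hyA i.1).1.1) ?_ P hP
    · rintro s ⟨hs, hq⟩
      refine ⟨reflGrp_mem hs hq, ?_⟩
      have h1 : orderOf (⟨s, hs⟩ : G) ≠ 0 := (orderOf_pos _).ne'
      refine isRefl_of_quasi (m := orderOf (⟨s, hs⟩ : G)) (orderOf_pos _) ?_ hq
      have := pow_orderOf_eq_one (⟨s, hs⟩ : G)
      simpa [Subtype.ext_iff] using this
    · intro c hc
      funext s
      obtain ⟨⟨d, i⟩, hs⟩ := s
      have h1 := comp_Rp2 d (Rp2 H) (fun i j _ a ha b hb => Submodule.subset_span ⟨a, ha.1, b, hb.1, rfl⟩) hc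
      have h2 : MvPolynomial.homogeneousComponent d (∑ i, c i • y i.1) =
          ∑ i, (if i.1.1 = d then c i else 0) • y i.1 := by
        rw [map_sum]
        refine Finset.sum_congr rfl fun j _ => ?_
        rw [map_smul, MvPolynomial.homogeneousComponent_of_mem (hyA j.1).2]
        by_cases hj : j.1.1 = d
        · rw [if_pos hj, if_pos hj.symm]
        · rw [if_neg hj, if_neg (Ne.symm hj), smul_zero, zero_smul]
      rw [h2] at h1
      have h3 : ∑ i, (if i.1.1 = d then c i else 0) • y i.1 ∈ C d := by
        refine Submodule.sum_mem _ fun j _ => ?_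
        by_cases hj : j.1.1 = d
        · subst hj; exact Submodule.smul_mem _ _ (hyC _)
        · rw [if_neg hj, zero_smul]; exact Submodule.zero_mem _
      have h4 := hCB d _ h3 ⟨hCA d h3, h1⟩
      have hli : LinearIndependent ℂ (fun i => (b d i : C d).1) :=
        (b d).linearIndependent.map' (C d).subtype (C d).ker_subtype
      let e : Module.Basis.ofVectorSpaceIndex ℂ (C d) → ℂ := fun i =>
        if h : (⟨d, i⟩ : Σ d, Module.Basis.ofVectorSpaceIndex ℂ (C d)) ∈ t then c ⟨_, h⟩ else 0
      have hinj : Function.Injective (fun i => (⟨d, i⟩ : Σ d, Module.Basis.ofVectorSpaceIndex ℂ (C d))) :=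
        fun i j h => by simpa using h
      have hfin : {i | (⟨d, i⟩ : Σ d, Module.Basis.ofVectorSpaceIndex ℂ (C d)) ∈ t}.Finite :=
        ht.preimage hinj.injOn
      have h5 : ∑ i ∈ hfin.toFinset, e i • (b d i : C d).1 = 0 := by
        rw [← h4]
        symm
        let c' : (Σ d, Module.Basis.ofVectorSpaceIndex ℂ (C d)) → ℂ := fun s =>
          if h : s ∈ t then c ⟨s, h⟩ else 0
        have h7 : ∑ i : t, (if i.1.1 = d then c i else 0) • y i.1 =
            ∑ s ∈ t.toFinset, if s.1 = d then c' s • y s else 0 := by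
          rw [Finset.sum_subtype t.toFinset (p := (· ∈ t)) (by simp)]
          refine Finset.sum_congr rfl fun i _ => ?_
          simp only [c', i.2, dif_pos]
          split_ifs <;> simp
        rw [h7, ← Finset.sum_filter]
        have h8 : t.toFinset.filter (fun s => s.1 = d) = hfin.toFinset.map ⟨_, hinj⟩ := by
          ext ⟨d', i'⟩
          simp only [Finset.mem_filter, Set.mem_toFinset, Finset.mem_map, Set.Finite.mem_toFinset,
            Function.Embedding.coeFn_mk]
          constructor
          · rintro ⟨h, h'⟩; subst h'; exact ⟨i', h, rfl⟩
          · rintro ⟨j, h, h'⟩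
            cases h'
            exact ⟨h, rfl⟩
        rw [h8, Finset.sum_map]
        rfl
      have h6 := linearIndependent_iff'.1 hli hfin.toFinset e h5 i (by simpa using hs)
      simpa [e, hs] using h6
  have hgen : Algebra.adjoin ℂ (Set.range y) = invariantRing H := by
    apply le_antisymm
    · refine Algebra.adjoin_le ?_
      rintro _ ⟨s, rfl⟩
      exact (hyA s).1.1
    · have key : ∀ d, ∀ f ∈ Agr H d, f ∈ Algebra.adjoin ℂ (Set.range y) := by
        intro d
        induction d using Nat.strong_induction_on with
        | _ d ih =>
          intro f hf
          obtain ⟨c, hc, hb⟩ := hCs d f hf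
          have h1 : c ∈ Algebra.adjoin ℂ (Set.range y) :=
            Algebra.span_le_adjoin ℂ _ (hCspan d c hc)
          have h2 := comp_Rp2 d (Subalgebra.toSubmodule (Algebra.adjoin ℂ (Set.range y))) (by
            intro i j hij a ha b hb
            by_cases hi : i = 0
            · subst hi; rw [Agr_zero ha, zero_mul]; exact Submodule.zero_mem _
            by_cases hj : j = 0
            · subst hj; rw [Agr_zero hb, mul_zero]; exact Submodule.zero_mem _
            exact Subalgebra.mul_mem _ (ih i (by omega) a ha) (ih j (by omega) b hb)) hb.2
          rw [MvPolynomial.homogeneousComponent_of_mem hb.1.2, if_pos rfl] at h2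
          have h3 := Subalgebra.add_mem _ h2 h1
          simpa using h3
      intro f hf
      have h1 : f - MvPolynomial.C (MvPolynomial.constantCoeff f) ∈ Rp H := by
        refine ⟨sub_mem hf (Subalgebra.algebraMap_mem _ _), ?_⟩
        simp
      have h2 : f - MvPolynomial.C (MvPolynomial.constantCoeff f) ∈ Algebra.adjoin ℂ (Set.range y) := by
        rw [← MvPolynomial.sum_homogeneousComponent (f - MvPolynomial.C (MvPolynomial.constantCoeff f))]
        exact Subalgebra.sum_mem _ fun d _ => key d _ (comp_Agr h1 d)
      have h3 := Subalgebra.add_mem _ h2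
        (Subalgebra.algebraMap_mem (Algebra.adjoin ℂ (Set.range y)) (MvPolynomial.constantCoeff f))
      simpa [MvPolynomial.algebraMap_eq] using h3
  have htr : IsTranscendenceBasis ℂ y := by
    rw [hind.isTranscendenceBasis_iff_isAlgebraic, hgen]
    have : Algebra.IsIntegral (invariantRing H) (MvPolynomial (Fin n) ℂ) :=
      ⟨fun s => integral_invariantRing H s⟩
    infer_instance
  have hcard := (IsTranscendenceBasis.mvPolynomial (Fin n) ℂ).cardinalMk_eq htr
  obtain ⟨e⟩ := Cardinal.eq.1 hcard
  have hr : Set.range (y ∘ e) = Set.range y := e.surjective.range_comp y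
  refine ⟨y ∘ e, hind.comp e e.injective, by rw [hr, hgen], ?_⟩
  intro g hg i
  rw [hr]
  exact hCspan _ _ (hCG _ g hg _ (hyC _))

end cst3

open Matrix Polynomial

set_option linter.unusedSectionVars false
section rep
variable {n : ℕ}

theorem glAct_aeval {K : Type*} [CommRing K] [Algebra ℂ K] (y : Fin n → K) (P : GL (Fin n) ℂ)
    (p : MvPolynomial (Fin n) ℂ) :
    MvPolynomial.aeval y (glAct P p) = MvPolynomial.aeval (fun i => ∑ j, P.1 i j • y j) p := by
  have h : (MvPolynomial.aeval y).comp (glAct P) = MvPolynomial.aeval (fun i => ∑ j, P.1 i j • y j) := by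
    apply MvPolynomial.algHom_ext
    intro i
    rw [AlgHom.comp_apply, glAct_X]
    simp
  exact congrArg (fun f => f p) h

theorem rep_exists (G : Subgroup (GL (Fin n) ℂ)) (y : Fin n → MvPolynomial (Fin n) ℂ)
    (hy : AlgebraicIndependent ℂ y)
    (hG : ∀ g ∈ G, ∀ i, glAct g (y i) ∈ Submodule.span ℂ (Set.range y)) :
    ∃ A : G →* GL (Fin n) ℂ, ∀ (g : G) (i : Fin n), glAct g.1 (y i) = ∑ j, (A g).1 i j • y j := by
  have h1 : ∀ (g : G) (i : Fin n), ∃ a : Fin n → ℂ, glAct g.1 (y i) = ∑ j, a j • y j := by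
    intro g i
    obtain ⟨c, hc⟩ := (Submodule.mem_span_range_iff_exists_fun ℂ).1 (hG g.1 g.2 i)
    exact ⟨c, hc.symm⟩
  choose a ha using h1
  have hli := hy.linearIndependent
  have huniq : ∀ u v : Fin n → ℂ, ∑ j, u j • y j = ∑ j, v j • y j → u = v := by
    intro u v h
    have h2 : ∑ j, (u j - v j) • y j = 0 := by
      simp only [sub_smul, Finset.sum_sub_distrib, h, sub_self]
    funext j
    exact sub_eq_zero.1 (Fintype.linearIndependent_iff.1 hli _ h2 j)
  let B : G →* Matrix (Fin n) (Fin n) ℂ :=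
    { toFun := fun g => Matrix.of (a g)
      map_one' := by
        ext i j
        have : a 1 i = (1 : Matrix (Fin n) (Fin n) ℂ) i := by
          apply huniq
          rw [← ha, Subgroup.coe_one, glAct_one]
          simp [Matrix.one_apply]
        simp [this]
      map_mul' := by
        intro g h
        ext i k
        have : a (g * h) i = fun k => ∑ j, a g i j * a h j k := by
          apply huniq
          rw [← ha, Subgroup.coe_mul, ← glAct_mul, ha, map_sum]
          simp only [map_smul, ha, Finset.smul_sum, Finset.sum_smul, smul_smul]
          rw [Finset.sum_comm]
        rw [Matrix.mul_apply]
        simp [this] }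
  refine ⟨B.toHomUnits, ?_⟩
  intro g i
  rw [ha]
  rfl

theorem rep_act (G : Subgroup (GL (Fin n) ℂ)) (y : Fin n → MvPolynomial (Fin n) ℂ)
    (A : G →* GL (Fin n) ℂ) (hA : ∀ (g : G) (i : Fin n), glAct g.1 (y i) = ∑ j, (A g).1 i j • y j)
    (g : G) (p : MvPolynomial (Fin n) ℂ) :
    glAct g.1 (MvPolynomial.aeval y p) = MvPolynomial.aeval y (glAct (A g) p) := by
  rw [glAct_aeval, ← AlgHom.comp_apply, MvPolynomial.comp_aeval]
  simp only [hA]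

theorem rep_iso (G : Subgroup (GL (Fin n) ℂ)) (y : Fin n → MvPolynomial (Fin n) ℂ)
    (hy : AlgebraicIndependent ℂ y) (hr : Algebra.adjoin ℂ (Set.range y) = invariantRing (reflGrp G))
    (A : G →* GL (Fin n) ℂ) (hA : ∀ (g : G) (i : Fin n), glAct g.1 (y i) = ∑ j, (A g).1 i j • y j) :
    Nonempty (invariantRing G ≃ₐ[ℂ] invariantRing A.range) := by
  have hinj : Function.Injective (MvPolynomial.aeval y : MvPolynomial (Fin n) ℂ →ₐ[ℂ] _) := hy
  have hmem : ∀ p, MvPolynomial.aeval y p ∈ invariantRing G ↔ p ∈ invariantRing A.range := by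
    intro p
    constructor
    · rintro h _ ⟨g, rfl⟩
      apply hinj
      rw [← rep_act G y A hA, h g.1 g.2]
    · intro h g hg
      rw [rep_act G y A hA ⟨g, hg⟩, h _ ⟨_, rfl⟩]
  let φ : invariantRing A.range →ₐ[ℂ] invariantRing G :=
    ((MvPolynomial.aeval y).comp (invariantRing A.range).val).codRestrict _
      (fun p => (hmem _).2 p.2)
  refine ⟨(AlgEquiv.ofBijective φ ⟨?_, ?_⟩).symm⟩
  · intro a b h
    apply Subtype.ext
    apply hinj
    exact congrArg Subtype.val h
  · rintro ⟨p, hp⟩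
    have h1 : p ∈ invariantRing (reflGrp G) := fun g hg => hp g (reflGrp_le G hg)
    rw [← hr, Algebra.adjoin_range_eq_range_aeval] at h1
    obtain ⟨q, rfl⟩ := h1
    exact ⟨⟨q, (hmem q).1 hp⟩, rfl⟩

/-- extension of homs -/
theorem ext_lift {Ω : Type} [Field Ω] [Algebra ℂ Ω] [IsAlgClosed Ω]
    (R : Subalgebra ℂ (MvPolynomial (Fin n) ℂ))
    (hIntg : ∀ s : MvPolynomial (Fin n) ℂ, IsIntegral R s) (φ : R →ₐ[ℂ] Ω)
    (hφ : Function.Injective φ) :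
    ∃ κ : MvPolynomial (Fin n) ℂ →ₐ[ℂ] Ω, ∀ r : R, κ r = φ r := by
  letI : Algebra R Ω := φ.toRingHom.toAlgebra
  have : Algebra.IsIntegral R (MvPolynomial (Fin n) ℂ) := ⟨hIntg⟩
  have : Module.IsTorsionFree R Ω := by
    rw [Module.isTorsionFree_iff_algebraMap_injective]
    exact hφ
  let l : MvPolynomial (Fin n) ℂ →ₐ[R] Ω := IsAlgClosed.lift
  have hl : ∀ r : R, l r = φ r := fun r => l.commutes r
  refine ⟨{ l.toRingHom with commutes' := ?_ }, hl⟩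
  intro c
  have := hl (algebraMap ℂ R c)
  rw [φ.commutes] at this
  exact this

end rep

open Matrix Polynomial

set_option linter.unusedSectionVars false
section jacs
variable {n : ℕ}

theorem jac_semi (g : GL (Fin n) ℂ) (F : Fin n → MvPolynomial (Fin n) ℂ)
    (hF : ∀ i, glAct g (F i) = F i) :
    jac F = MvPolynomial.C g.1.det * glAct g (jac F) := by
  have h := det_chain (fun i => MvPolynomial.pderiv i) (glAct g) F
  simp only [hF] at h
  have h1 : (dmat (fun i => MvPolynomial.pderiv i) F).det = jac F := rfl
  rw [h1] at h
  have h2 : (dmat (fun i => MvPolynomial.pderiv i)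
      (fun j => glAct g (MvPolynomial.X j))) = (MvPolynomial.C : ℂ →+* MvPolynomial (Fin n) ℂ).mapMatrix (g.1ᵀ) := by
    ext1 i j
    rw [dmat_apply, glAct_X, map_sum, Finset.sum_eq_single i]
    · simp [MvPolynomial.smul_eq_C_mul]
    · intro b _ hb
      simp [hb.symm]
    · simp
  rw [h2, ← RingHom.map_det, Matrix.det_transpose] at h
  exact h

theorem jac_pow_inv (G : Subgroup (GL (Fin n) ℂ)) [Fintype G] (F : Fin n → MvPolynomial (Fin n) ℂ)
    (hF : ∀ i, F i ∈ invariantRing G) : jac F ^ Fintype.card G ∈ invariantRing G := by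
  intro g hg
  have h1 := jac_semi g F (fun i => hF i g hg)
  have h2 : g.1.det ^ Fintype.card G = 1 := by
    have h3 : (⟨g, hg⟩ : G) ^ Fintype.card G = 1 := pow_card_eq_one
    have h4 : g ^ Fintype.card G = 1 := congrArg Subtype.val h3
    have h5 := congrArg (fun g : GL (Fin n) ℂ => g.1.det) h4
    simpa [Matrix.det_pow] using h5
  conv_rhs => rw [h1, mul_pow, ← map_pow, h2, map_one, one_mul]
  rw [map_pow]

/-- monomial with exponent -/
noncomputable def mon (a : Fin n → ℕ) : MvPolynomial (Fin n) ℂ := ∏ k, MvPolynomial.X k ^ a k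

theorem mon_ne (a : Fin n → ℕ) : mon a ≠ 0 :=
  Finset.prod_ne_zero_iff.2 fun k _ => pow_ne_zero _ (MvPolynomial.X_ne_zero k)

theorem mon_add (a b : Fin n → ℕ) : mon (a + b) = mon a * mon b := by
  simp [mon, pow_add, Finset.prod_mul_distrib]

theorem mon_pow (a : Fin n → ℕ) (k : ℕ) : mon a ^ k = mon (fun i => k * a i) := by
  simp [mon, Finset.prod_pow, ← Finset.prod_pow, ← pow_mul, mul_comm]

theorem mon_eq (a : Fin n → ℕ) : mon a = MvPolynomial.monomial (Finsupp.equivFunOnFinite.symm a) (1 : ℂ) := by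
  rw [MvPolynomial.monomial_eq, map_one, one_mul, Finsupp.prod_fintype _ _ (by simp)]
  rfl

theorem mon_deriv (a : Fin n → ℕ) (i : Fin n) :
    MvPolynomial.X i * MvPolynomial.pderiv i (mon a) = MvPolynomial.C (a i : ℂ) * mon a := by
  rw [mon_eq, MvPolynomial.X_mul_pderiv_monomial]
  simp [MvPolynomial.smul_eq_C_mul]

theorem jac_mon (a : Fin n → Fin n → ℕ) :
    (∏ i, MvPolynomial.X i) * jac (fun j => mon (a j)) =
      MvPolynomial.C (Matrix.of (fun i j => (a j i : ℂ))).det * ∏ j, mon (a j) := by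
  have h1 := Matrix.det_mul_column (fun i => (MvPolynomial.X i : MvPolynomial (Fin n) ℂ))
    (Matrix.of fun i j => MvPolynomial.pderiv i (mon (a j)))
  have h2 := Matrix.det_mul_row (fun j => mon (a j))
    ((MvPolynomial.C : ℂ →+* MvPolynomial (Fin n) ℂ).mapMatrix (Matrix.of fun i j => (a j i : ℂ)))
  rw [← RingHom.map_det] at h2
  rw [mul_comm (MvPolynomial.C _), ← h2]
  refine h1.symm.trans ?_
  congr 1
  ext1 i j
  simp only [Matrix.of_apply, RingHom.mapMatrix_apply, Matrix.map_apply]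
  rw [mon_deriv, mul_comm]

theorem det_ne (j : Fin n) (N : ℕ) (hN : N ≠ 0) (e : Fin n → ℕ) (he : e j ≠ 0) :
    (Matrix.of (fun i k => ((if k = j then e i else if k = i then N else 0 : ℕ) : ℂ))).det ≠ 0 := by
  classical
  intro h0
  obtain ⟨v, hv, h⟩ := Matrix.exists_vecMul_eq_zero_iff.2 h0
  apply hv
  have h1 : ∀ k, k ≠ j → v k = 0 := by
    intro k hk
    have := congrFun h k
    simpa [Matrix.vecMul, dotProduct, hk, hN] using this
  have h2 := congrFun h j
  simp only [Matrix.vecMul, dotProduct, Matrix.of_apply, if_true, Pi.zero_apply] at h2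
  rw [Finset.sum_eq_single j (by intro b _ hb; rw [h1 b hb, zero_mul]) (by simp)] at h2
  have h3 : v j = 0 := by
    rcases mul_eq_zero.1 h2 with h | h
    · exact h
    · exact absurd (by exact_mod_cast h) he
  funext k
  by_cases hk : k = j
  · rw [hk]; exact h3
  · exact h1 k hk

/-- The explicit jacobian -/
theorem jac_u (j : Fin n) (N : ℕ) (hN : N ≠ 0) (e : Fin n → ℕ) (he : e j ≠ 0) :
    ∃ (s : ℂ) (f : Fin n → ℕ), s ≠ 0 ∧ f j = 0 ∧
      jac (fun k => mon (if k = j then e else Pi.single k N)) =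
        MvPolynomial.C s * MvPolynomial.X j ^ (e j - 1) * mon f := by
  classical
  refine ⟨_, fun i => if i = j then 0 else N + e i - 1, det_ne j N hN e he, by simp, ?_⟩
  have h := jac_mon (fun k => if k = j then e else Pi.single k N)
  have h0 : (∏ i, MvPolynomial.X i : MvPolynomial (Fin n) ℂ) ≠ 0 :=
    Finset.prod_ne_zero_iff.2 fun k _ => MvPolynomial.X_ne_zero k
  apply mul_left_cancel₀ h0
  rw [h]
  have e1 : (Matrix.of (fun i k => (((if k = j then e else Pi.single k N) i : ℕ) : ℂ))) =
    Matrix.of (fun i k => ((if k = j then e i else if k = i then N else 0 : ℕ) : ℂ)) := by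
    ext1 i k
    simp only [Matrix.of_apply]
    by_cases hk : k = j
    · simp [hk]
    · by_cases hki : k = i
      · subst hki; simp [hk]
      · have : i ≠ k := Ne.symm hki
        simp [hk, hki, Pi.single_apply, this]
  rw [e1]
  have e2 : (∏ k, mon (if k = j then e else Pi.single k N)) =
      (∏ i, MvPolynomial.X i : MvPolynomial (Fin n) ℂ) * (MvPolynomial.X j ^ (e j - 1) *
        mon fun i => if i = j then 0 else N + e i - 1) := by
    have h1 : ∀ k, mon (if k = j then e else Pi.single k N) =
        (if k = j then mon e else MvPolynomial.X k ^ N) := by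
      intro k
      by_cases hk : k = j
      · simp [hk]
      · simp only [hk, if_false]
        rw [mon, Finset.prod_eq_single k]
        · simp
        · intro b _ hb; simp [hb]
        · simp
    simp only [h1]
    rw [← Finset.mul_prod_erase Finset.univ _ (Finset.mem_univ j),
      ← Finset.mul_prod_erase Finset.univ (fun i => (MvPolynomial.X i : MvPolynomial (Fin n) ℂ)) (Finset.mem_univ j)]
    have hE : ∏ k ∈ Finset.univ.erase j, (if k = j then mon e else MvPolynomial.X k ^ N) =
        ∏ k ∈ Finset.univ.erase j, (MvPolynomial.X k : MvPolynomial (Fin n) ℂ) ^ N :=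
      Finset.prod_congr rfl fun k hk => if_neg (Finset.ne_of_mem_erase hk)
    rw [hE]
    simp only [mon]
    rw [← Finset.mul_prod_erase Finset.univ (fun k => (MvPolynomial.X k : MvPolynomial (Fin n) ℂ) ^ e k) (Finset.mem_univ j),
      ← Finset.mul_prod_erase Finset.univ (fun k => (MvPolynomial.X k : MvPolynomial (Fin n) ℂ) ^ (if k = j then 0 else N + e k - 1)) (Finset.mem_univ j)]
    simp only [if_true, pow_zero, one_mul]
    have h2 : ∏ k ∈ Finset.univ.erase j, (MvPolynomial.X k : MvPolynomial (Fin n) ℂ) ^ (if k = j then 0 else N + e k - 1) *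
        MvPolynomial.X k = ∏ k ∈ Finset.univ.erase j, (MvPolynomial.X k ^ N * MvPolynomial.X k ^ e k) := by
      refine Finset.prod_congr rfl fun k hk => ?_
      have hk' := Finset.ne_of_mem_erase hk
      rw [if_neg hk', ← pow_succ, ← pow_add]
      congr 1; omega
    rw [Finset.prod_mul_distrib, Finset.prod_mul_distrib] at h2
    have h3 : (MvPolynomial.X j : MvPolynomial (Fin n) ℂ) ^ e j = MvPolynomial.X j * MvPolynomial.X j ^ (e j - 1) := by
      rw [← pow_succ']; congr 1; omega
    rw [h3]
    linear_combination (- MvPolynomial.X j * MvPolynomial.X j ^ (e j - 1)) * h2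
  rw [show (∏ k, mon ((fun k => if k = j then e else Pi.single k N) k)) = _ from e2]
  ring

/-- divisibility of the jacobian -/
theorem jac_dvd (j : Fin n) (d : ℕ) (Y : Fin n → MvPolynomial (Fin n) ℂ)
    (h : ∀ i, ∀ m ∈ (Y i).support, d ∣ m j) : MvPolynomial.X j ^ (d - 1) ∣ jac Y := by
  classical
  have h1 : ∀ i, MvPolynomial.X j ^ (d - 1) ∣ MvPolynomial.pderiv j (Y i) := by
    intro i
    rw [MvPolynomial.as_sum (Y i), map_sum]
    refine Finset.dvd_sum fun m hm => ?_
    rw [MvPolynomial.pderiv_monomial]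
    by_cases h0 : m j = 0
    · simp [h0]
    · have h2 := Nat.le_of_dvd (Nat.pos_of_ne_zero h0) (h i m hm)
      rw [MvPolynomial.X_pow_eq_monomial, MvPolynomial.monomial_dvd_monomial]
      refine ⟨Or.inr ?_, one_dvd _⟩
      rw [Finsupp.single_le_iff]
      simp only [Finsupp.coe_tsub, Pi.sub_apply, Finsupp.single_eq_same]
      omega
  choose F hF using h1
  refine ⟨((Matrix.of fun i k => MvPolynomial.pderiv i (Y k)).updateRow j F).det, ?_⟩
  rw [← Matrix.det_updateRow_smul]
  change (Matrix.of fun i k => MvPolynomial.pderiv i (Y k)).det = _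
  congr 1
  ext1 i k
  by_cases hi : i = j
  · subst hi
    simp [hF]
  · simp [hi]

end jacs

open Matrix Polynomial

set_option linter.unusedSectionVars false
section arith
variable {n : ℕ}

theorem arith_d (j : Fin n) (N : ℕ) (hN : N ≠ 0) (b : Fin n → ℤ) :
    ∃ (d : ℕ) (e : Fin n → ℕ) (k : ℕ), d ≠ 0 ∧ e j = d ∧ (N : ℤ) ∣ ∑ i, (e i : ℤ) * b i ∧
      (∀ i, i ≠ j → (N : ℤ) ∣ k * b i) ∧ ∃ t : ℤ, (d : ℤ) * (k * b j) = N * (1 + d * t) := by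
  classical
  let v : Fin n → ℤ := fun i => if i = j then (N : ℤ) else b i
  let I : Ideal ℤ := Ideal.span (Set.range v)
  obtain ⟨a, ha⟩ := (inferInstance : I.IsPrincipal)
  have ha' : I = Ideal.span {a} := ha
  have hdiv : ∀ i, a ∣ v i := by
    intro i
    have : v i ∈ I := Ideal.subset_span ⟨i, rfl⟩
    rwa [ha', Ideal.mem_span_singleton] at this
  have haN : a ∣ (N : ℤ) := by simpa [v] using hdiv j
  have hab : ∀ i, i ≠ j → a ∣ b i := by
    intro i hi; simpa [v, hi] using hdiv i
  have ha0 : a ≠ 0 := by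
    rintro rfl
    exact hN (by exact_mod_cast zero_dvd_iff.1 haN)
  have hg0 : (Int.gcd a (b j) : ℤ) ≠ 0 := by
    simp [Int.gcd_eq_zero_iff, ha0]
  set g : ℤ := (Int.gcd a (b j) : ℤ) with hg
  obtain ⟨a', ha1⟩ : g ∣ a := Int.gcd_dvd_left ..
  obtain ⟨b', hb1⟩ : g ∣ b j := Int.gcd_dvd_right ..
  have ha'0 : a' ≠ 0 := by rintro rfl; simp at ha1; exact ha0 ha1
  -- Bezout
  have hbez := Int.gcd_eq_gcd_ab a (b j)
  rw [← hg] at hbez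
  have hbez' : 1 = a' * Int.gcdA a (b j) + b' * Int.gcdB a (b j) := by
    apply mul_left_cancel₀ hg0
    calc g * 1 = a * Int.gcdA a (b j) + b j * Int.gcdB a (b j) := by rw [mul_one]; exact hbez
      _ = (g * a') * Int.gcdA a (b j) + (g * b') * Int.gcdB a (b j) := by rw [← ha1, ← hb1]
      _ = _ := by ring
  set A := Int.gcdA a (b j)
  set B := Int.gcdB a (b j)
  obtain ⟨k0, hk0⟩ := haN
  -- d = |a'|
  obtain ⟨ε, hε, hε2⟩ : ∃ ε : ℤ, (a'.natAbs : ℤ) = ε * a' ∧ ε * ε = 1 := by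
    rcases Int.natAbs_eq a' with h | h
    · exact ⟨1, by rw [one_mul]; exact h.symm, by norm_num⟩
    · exact ⟨-1, by linarith, by norm_num⟩
  -- exponents
  have hmem : (a'.natAbs : ℤ) * b j ∈ I := by
    rw [ha', Ideal.mem_span_singleton]
    exact ⟨ε * b', by rw [hε, ha1, hb1]; ring⟩
  obtain ⟨s, hs⟩ := (Ideal.mem_span_range_iff_exists_fun (R := ℤ)).1 hmem
  let K : ℤ := ε * k0 * B
  refine ⟨a'.natAbs, fun i => if i = j then a'.natAbs else (-s i + N * |s i|).toNat,
    (K + N * |K|).toNat, by simpa using ha'0, by simp, ?_, ?_, ?_⟩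
  · have h1 : ∀ i, i ≠ j → ((-s i + N * |s i|).toNat : ℤ) = -s i + N * |s i| := by
      intro i _
      apply Int.toNat_of_nonneg
      have h2 : (1 : ℤ) ≤ N := by exact_mod_cast Nat.one_le_iff_ne_zero.2 hN
      have h3 := le_abs_self (s i)
      nlinarith [abs_nonneg (s i)]
    have h2 : ∑ i, ((if i = j then a'.natAbs else (-s i + N * |s i|).toNat : ℕ) : ℤ) * b i =
        ∑ i, ((if i = j then (a'.natAbs : ℤ) * b j + N * s j else N * |s i| * b i) - s i * v i) := by
      refine Finset.sum_congr rfl fun i _ => ?_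
      by_cases hi : i = j
      · subst hi; simp [v]; ring
      · simp only [hi, if_false, v]; rw [h1 i hi]; ring
    rw [h2, Finset.sum_sub_distrib, hs, ← Finset.add_sum_erase _ _ (Finset.mem_univ j), if_pos rfl]
    have h3 : (N : ℤ) ∣ ∑ i ∈ Finset.univ.erase j, (if i = j then (a'.natAbs : ℤ) * b j + N * s j else N * |s i| * b i) := by
      refine Finset.dvd_sum fun i hi => ?_
      rw [if_neg (Finset.ne_of_mem_erase hi), mul_assoc]
      exact dvd_mul_right _ _
    obtain ⟨z, hz⟩ := h3
    rw [hz]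
    exact ⟨s j + z, by ring⟩
  all_goals
    have hK : (((K + N * |K|).toNat : ℕ) : ℤ) = K + N * |K| := by
      apply Int.toNat_of_nonneg
      have h2 : (1 : ℤ) ≤ N := by exact_mod_cast Nat.one_le_iff_ne_zero.2 hN
      have h3 := neg_abs_le K
      nlinarith [abs_nonneg K]
    rw [hK]
  · intro i hi
    obtain ⟨z, hz⟩ := hab i hi
    refine ⟨ε * B * z + |K| * b i, ?_⟩
    have : K * b i = N * (ε * B * z) := by
      rw [hk0, hz]; ring
    linear_combination this
  · refine ⟨-(ε * A) + |K| * b j, ?_⟩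
    have h1 : (a'.natAbs : ℤ) * (K * b j) = N * (1 - a' * A) := by
      rw [hε, hk0]
      have : a' * A = 1 - b' * B := by linarith
      rw [this]
      have e : ε * a' * (ε * k0 * B * b j) = (ε * ε) * (a' * k0 * B * b j) := by ring
      change ε * a' * (ε * k0 * B * b j) = _
      rw [e, hε2, hb1, ha1]; ring
    have h2 : (a'.natAbs : ℤ) * ε = a' := by
      rw [hε]; linear_combination a' * hε2
    linear_combination h1 + N * A * h2

theorem diag_coeff {δ : GL (Fin n) ℂ} {l : Fin n → ℂ} (hδ : δ.1 = Matrix.diagonal l)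
    (p : MvPolynomial (Fin n) ℂ) (m : Fin n →₀ ℕ) :
    (glAct δ p).coeff m = (∏ i, l i ^ m i) * p.coeff m := by
  classical
  have hX : ∀ i, glAct δ (MvPolynomial.X i) = MvPolynomial.C (l i) * MvPolynomial.X i := by
    intro i
    rw [glAct_X, hδ, Finset.sum_eq_single i]
    · rw [Matrix.diagonal_apply_eq, MvPolynomial.smul_eq_C_mul]
    · intro b _ hb
      rw [Matrix.diagonal_apply_ne _ hb.symm, zero_smul]
    · simp
  induction p using MvPolynomial.induction_on' with
  | add p q hp hq => rw [map_add, MvPolynomial.coeff_add, MvPolynomial.coeff_add, hp, hq, mul_add]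
  | monomial u a =>
    have h1 : glAct δ (MvPolynomial.monomial u a) = MvPolynomial.monomial u ((∏ i, l i ^ u i) * a) := by
      rw [MvPolynomial.monomial_eq, MvPolynomial.monomial_eq, map_mul,
        Finsupp.prod_fintype _ _ (by simp), map_prod]
      simp only [map_pow, hX, mul_pow]
      rw [Finset.prod_mul_distrib]
      have : glAct δ (MvPolynomial.C a) = MvPolynomial.C a := (glAct δ).commutes a
      rw [this]
      simp only [map_mul, map_prod, map_pow]
      ring
    rw [h1, MvPolynomial.coeff_monomial, MvPolynomial.coeff_monomial]
    split_ifs with h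
    · rw [h]
    · rw [mul_zero]

theorem mem_inv_zpowers {g : GL (Fin n) ℂ} {p : MvPolynomial (Fin n) ℂ} (h : glAct g p = p) :
    p ∈ invariantRing (Subgroup.zpowers g) := by
  have h' : glAct g⁻¹ p = p := by
    conv_lhs => rw [← h]
    rw [glAct_mul, mul_inv_cancel, glAct_one]
  rintro _ ⟨k, rfl⟩
  dsimp only
  induction k using Int.induction_on with
  | zero => rw [_root_.zpow_zero, glAct_one]
  | succ i ih => rw [_root_.zpow_add_one, ← glAct_mul, ih, h]
  | pred i ih => rw [_root_.zpow_sub_one, ← glAct_mul, ih, h']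

theorem diag_data (δ : GL (Fin n) ℂ) (β : Fin n → ℚ) (hδ : δ.1 = Matrix.diagonal (fun i => ee (β i)))
    (N : ℕ) (hN : N ≠ 0) (b : Fin n → ℤ) (hβ : ∀ i, β i = b i / N)
    (Y : Fin n → MvPolynomial (Fin n) ℂ)
    (hY : ∀ k : ℕ, IsQuasiReflection ((δ ^ k : GL (Fin n) ℂ) : Matrix (Fin n) (Fin n) ℂ) →
      ∀ i, glAct (δ ^ k) (Y i) = Y i) (j : Fin n) :
    ∃ (u : Fin n → MvPolynomial (Fin n) ℂ) (s : ℂ) (f : Fin n → ℕ) (q : ℕ),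
      (∀ i, u i ∈ invariantRing (Subgroup.zpowers δ)) ∧ s ≠ 0 ∧ f j = 0 ∧
      jac u = MvPolynomial.C s * MvPolynomial.X j ^ q * mon f ∧ MvPolynomial.X j ^ q ∣ jac Y := by
  classical
  obtain ⟨d, e, k, hd, hed, hsum, hk, t, ht⟩ := arith_d j N hN b
  have hNQ : (N : ℚ) ≠ 0 := by exact_mod_cast hN
  have hdQ : (d : ℚ) ≠ 0 := by exact_mod_cast hd
  obtain ⟨s, f, hs, hf, hjac⟩ := jac_u j N hN e (by rw [hed]; exact hd)
  have hmon : ∀ (a : Fin n → ℕ), (N : ℤ) ∣ ∑ i, (a i : ℤ) * b i →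
      mon a ∈ invariantRing (Subgroup.zpowers δ) := by
    intro a ⟨z, hz⟩
    apply mem_inv_zpowers
    ext m
    rw [diag_coeff hδ, mon_eq, MvPolynomial.coeff_monomial]
    split_ifs with h
    · have h1 : ∀ i, m i = a i := by intro i; rw [← h]; rfl
      simp only [h1, ← ee_natmul]
      rw [← ee_sum]
      have : ∑ i, (a i : ℚ) * β i = (z : ℚ) := by
        have h2 : ((∑ i, (a i : ℤ) * b i : ℤ) : ℚ) = N * z := by rw [hz]; push_cast; rfl
        push_cast at h2
        simp only [hβ, mul_div_assoc', ← Finset.sum_div]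
        rw [h2]; field_simp
      rw [this, ee_int, mul_one]
    · rw [mul_zero]
  have hkβ : ∀ i, i ≠ j → ee (β i) ^ k = 1 := by
    intro i hi
    obtain ⟨z, hz⟩ := hk i hi
    rw [← ee_natmul]
    have : (k : ℚ) * β i = (z : ℚ) := by
      have h2 : ((k * b i : ℤ) : ℚ) = N * z := by rw [hz]; push_cast; rfl
      push_cast at h2
      rw [hβ, mul_div_assoc', h2]; field_simp
    rw [this, ee_int]
  have hkj : ee (β j) ^ k = ee (1 / d) := by
    rw [← ee_natmul]
    have : (k : ℚ) * β j = 1 / d + (t : ℚ) := by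
      have h2 : ((d * (k * b j) : ℤ) : ℚ) = N * (1 + d * t) := by rw [ht]; push_cast; rfl
      push_cast at h2
      rw [hβ]; field_simp; linarith
    rw [this, ee_add, ee_int, mul_one]
  have hδk : (δ ^ k : GL (Fin n) ℂ).1 = Matrix.diagonal (fun i => ee (β i) ^ k) := by
    rw [Units.val_pow_eq_pow_val, hδ, Matrix.diagonal_pow]; rfl
  refine ⟨fun k => mon (if k = j then e else Pi.single k N), s, f, d - 1, ?_, hs, hf, by rw [hed] at hjac; exact hjac, ?_⟩
  · intro i
    dsimp only
    apply hmon
    by_cases hi : i = j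
    · simpa [hi] using hsum
    · simp only [hi, if_false]
      rw [Finset.sum_eq_single i]
      · simp
      · intro c _ hc; simp [hc]
      · simp
  · apply jac_dvd
    intro i m hm
    by_cases hd1 : d = 1
    · rw [hd1]; exact one_dvd _
    have hq : IsQuasiReflection ((δ ^ k : GL (Fin n) ℂ) : Matrix (Fin n) (Fin n) ℂ) := by
      rw [quasi_of_conj (P := 1) (d := fun i => ee (β i) ^ k) (by simpa using hδk)]
      refine ⟨j, ?_, hkβ⟩
      rw [hkj]
      intro h1
      obtain ⟨z, hz⟩ := ee_eq_one h1
      have h2 : (1 : ℚ) = d * z := by rw [← hz]; field_simp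
      have h3 : (1 : ℤ) = d * z := by exact_mod_cast h2
      have h4 : (d : ℤ) ∣ 1 := ⟨z, h3⟩
      have h5 : d ∣ 1 := by exact_mod_cast h4
      exact hd1 (Nat.dvd_one.1 h5)
    have h1 := congrArg (MvPolynomial.coeff m) (hY k hq i)
    rw [diag_coeff hδk, Finset.prod_eq_single j (by intro c _ hc; rw [hkβ c hc, one_pow]) (by simp),
      hkj, ← ee_natmul] at h1
    have h2 : ee (m j * (1 / d)) = 1 := by
      have h3 := MvPolynomial.mem_support_iff.1 hm
      exact mul_right_cancel₀ h3 (by rw [h1, one_mul])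
    obtain ⟨z, hz⟩ := ee_eq_one h2
    have h3 : (m j : ℚ) = d * z := by rw [← hz]; field_simp
    have h4 : ((m j : ℕ) : ℤ) = d * z := by exact_mod_cast h3
    have h5 : (d : ℤ) ∣ (m j : ℤ) := ⟨z, h4⟩
    exact_mod_cast h5

end arith

open Matrix Polynomial

set_option linter.unusedSectionVars false
section keyineq
variable {n : ℕ} {L : Type} [Field L] [Algebra ℂ L]

theorem om_const (a : ℂ) : (0 : WithTop ℚ) ≤ (algebraMap ℂ (Om L) a).orderTop := by
  rw [omAlg_apply]
  by_cases h : algebraMap ℂ L a = 0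
  · rw [h, map_zero, HahnSeries.orderTop_zero]; exact le_top
  · rw [HahnSeries.C_apply, HahnSeries.orderTop_single h]; exact le_rfl

theorem om_poly (κ : MvPolynomial (Fin n) ℂ →ₐ[ℂ] Om L)
    (hZ : ∀ k, (0 : WithTop ℚ) ≤ (κ (MvPolynomial.X k)).orderTop) (p : MvPolynomial (Fin n) ℂ) :
    (0 : WithTop ℚ) ≤ (κ p).orderTop := by
  rw [← mem_omO]
  induction p using MvPolynomial.induction_on with
  | C a =>
    have : κ (MvPolynomial.C a) = algebraMap ℂ (Om L) a := κ.commutes a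
    rw [this, mem_omO]; exact om_const a
  | add p q hp hq => rw [map_add]; exact add_mem hp hq
  | mul_X p i hp => rw [map_mul]; exact mul_mem hp (mem_omO.2 (hZ i))

theorem mv_prime_X (j : Fin n) : Prime (MvPolynomial.X j : MvPolynomial (Fin n) ℂ) := by
  rw [← irreducible_iff_prime]
  apply MvPolynomial.irreducible_of_totalDegree_eq_one (MvPolynomial.totalDegree_X j)
  intro x hx
  have := hx (Finsupp.single j 1)
  rw [MvPolynomial.coeff_X, if_pos rfl] at this
  exact isUnit_of_dvd_one this

theorem not_X_dvd_mon (j : Fin n) (f : Fin n → ℕ) (hf : f j = 0) :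
    ¬ (MvPolynomial.X j : MvPolynomial (Fin n) ℂ) ∣ mon f := by
  intro h
  have hp : Prime (MvPolynomial.X j : MvPolynomial (Fin n) ℂ) := mv_prime_X j
  obtain ⟨i, _, hi⟩ := (hp.dvd_finset_prod_iff _).1 h
  have hij : i ≠ j := by
    rintro rfl
    rw [hf, pow_zero] at hi
    exact hp.not_unit (isUnit_of_dvd_one hi)
  have h2 := hp.dvd_of_dvd_pow hi
  rw [MvPolynomial.X_dvd_X] at h2
  exact hij h2.symm

theorem descend (κ : MvPolynomial (Fin n) ℂ →ₐ[ℂ] Om L) (hκ : Function.Injective κ) (x : Om L)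
    (hx : ∀ j, ∃ f : Fin n → ℕ, f j = 0 ∧ ∃ q, x * κ (mon f) = κ q) (t : ℕ) (e : Fin n → ℕ)
    (ht : ∑ i, e i = t) (he : ∃ q, x * κ (mon e) = κ q) : ∃ q, x = κ q := by
  classical
  induction t generalizing e with
  | zero =>
    have h1 : e = 0 := by
      funext i
      exact (Finset.sum_eq_zero_iff.1 ht) i (Finset.mem_univ i)
    obtain ⟨q, hq⟩ := he
    refine ⟨q, ?_⟩
    rw [← hq, h1]
    simp [mon]
  | succ t ih =>
    obtain ⟨q, hq⟩ := he
    obtain ⟨j, hj⟩ : ∃ j, e j ≠ 0 := by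
      by_contra h
      push Not at h
      simp [h] at ht
    have he' : e = Function.update e j (e j - 1) + Pi.single j 1 := by
      funext i
      by_cases hi : i = j
      · subst hi; simp; omega
      · simp [hi]
    have hmon : mon e = mon (Function.update e j (e j - 1)) * MvPolynomial.X j := by
      conv_lhs => rw [he', mon_add]
      congr 1
      rw [mon, Finset.prod_eq_single j]
      · simp
      · intro b _ hb; simp [hb]
      · simp
    have hsum : ∑ i, Function.update e j (e j - 1) i = t := by
      have : ∑ i, e i = ∑ i, Function.update e j (e j - 1) i + 1 := by
        conv_lhs => rw [he']
        simp [Finset.sum_add_distrib]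
      omega
    apply ih _ hsum
    obtain ⟨f, hf, q', hq'⟩ := hx j
    have h1 : q * mon f = q' * mon e := by
      apply hκ
      rw [map_mul, map_mul, ← hq, ← hq']; ring
    have hp : Prime (MvPolynomial.X j : MvPolynomial (Fin n) ℂ) := mv_prime_X j
    have h2 : (MvPolynomial.X j : MvPolynomial (Fin n) ℂ) ∣ q * mon f := by
      rw [h1, hmon, ← mul_assoc]; exact dvd_mul_left _ _
    rcases hp.dvd_or_dvd h2 with ⟨r, hr⟩ | h3
    · refine ⟨r, ?_⟩
      have hXne : κ (MvPolynomial.X j) ≠ 0 := by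
        rw [Ne, map_eq_zero_iff κ hκ]; exact hp.ne_zero
      apply mul_right_cancel₀ hXne
      rw [mul_assoc, ← map_mul, ← hmon, hq, ← map_mul, hr, mul_comm]
    · exact absurd h3 (not_X_dvd_mon j f hf)

theorem key_ineq (D : Fin n → Derivation ℂ (Om L) (Om L))
    (κ κ' : MvPolynomial (Fin n) ℂ →ₐ[ℂ] Om L)
    (hdet : (dmat D (fun k => κ (MvPolynomial.X k))).det ≠ 0)
    (hZ : ∀ k, (0 : WithTop ℚ) ≤ (κ (MvPolynomial.X k)).orderTop)
    (δ : GL (Fin n) ℂ) (β : Fin n → ℚ) (hδ : δ.1 = Matrix.diagonal (fun i => ee (β i)))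
    (N : ℕ) (hN : N ≠ 0) (b : Fin n → ℤ) (hβ : ∀ i, β i = b i / N)
    (Y : Fin n → MvPolynomial (Fin n) ℂ)
    (hY : ∀ k : ℕ, IsQuasiReflection ((δ ^ k : GL (Fin n) ℂ) : Matrix (Fin n) (Fin n) ℂ) →
      ∀ i, glAct (δ ^ k) (Y i) = Y i) (j0 : Fin n)
    (G : Subgroup (GL (Fin n) ℂ)) [Finite G]
    (θ : invariantRing (Subgroup.zpowers δ) ≃ₐ[ℂ] invariantRing G)
    (hθ : ∀ u, κ' (θ u).1 = κ u.1) :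
    (dmat D (fun k => κ' (MvPolynomial.X k))).det ≠ 0 ∧
    (dmat D (fun k => κ' (MvPolynomial.X k))).det.orderTop ≤ (dmat D (fun k => κ (Y k))).det.orderTop := by
  have := Fintype.ofFinite G
  set E := (dmat D (fun k => κ (MvPolynomial.X k))).det with hE
  set F := (dmat D (fun k => κ' (MvPolynomial.X k))).det with hF
  set W := (dmat D (fun k => κ (Y k))).det with hW
  have hκ : Function.Injective κ := by
    refine (injective_iff_map_eq_zero _).2 fun p hp => ?_
    refine indep_of_det D _ hdet p ?_
    rw [← hp]
    exact (congrArg (fun k => k p) (MvPolynomial.aeval_unique κ)).symm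
  have hWE : W = E * κ (jac Y) := det_chain D κ Y
  have hdata := fun j => diag_data δ β hδ N hN b hβ Y hY j
  choose u s f q hu hs hf hju hjY using hdata
  have hrel : ∀ j, E * κ (jac (u j)) = F * κ' (jac (fun k => (θ ⟨u j k, hu j k⟩).1)) := by
    intro j
    rw [hE, ← det_chain, hF, ← det_chain]
    simp only [hθ]
  have hju0 : ∀ j, jac (u j) ≠ 0 := by
    intro j
    rw [hju]
    exact mul_ne_zero (mul_ne_zero (by simpa using hs j) (pow_ne_zero _ (MvPolynomial.X_ne_zero j))) (mon_ne _)
  have hF0 : F ≠ 0 := by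
    intro h
    have := hrel j0
    rw [h, zero_mul] at this
    exact mul_ne_zero hdet ((map_ne_zero_iff κ hκ).2 (hju0 j0)) this
  refine ⟨hF0, ?_⟩
  set x := W / F with hx
  have hxF : F * x = W := by rw [hx]; field_simp
  set M := Fintype.card G with hM
  have hMpos : 0 < M := Fintype.card_pos
  have hloc : ∀ j, ∃ f : Fin n → ℕ, f j = 0 ∧ ∃ q, x ^ M * κ (mon f) = κ q := by
    intro j
    refine ⟨fun i => M * f j i, by simp [hf], ?_⟩
    obtain ⟨e, he⟩ := hjY j
    have h1 : x * κ (MvPolynomial.C (s j) * mon (f j)) =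
        κ' (jac (fun k => (θ ⟨u j k, hu j k⟩).1)) * κ e := by
      apply mul_left_cancel₀ hF0
      rw [← mul_assoc, ← mul_assoc, hxF, ← hrel, hWE, he, hju]
      simp only [map_mul]; ring
    have h2 : jac (fun k => (θ ⟨u j k, hu j k⟩).1) ^ M ∈ invariantRing G :=
      jac_pow_inv G _ fun k => (θ _).2
    have h3 : κ' (jac (fun k => (θ ⟨u j k, hu j k⟩).1)) ^ M =
        κ (θ.symm ⟨_, h2⟩).1 := by
      rw [← hθ, AlgEquiv.apply_symm_apply, map_pow]
    have h4 := congrArg (· ^ M) h1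
    simp only [mul_pow, h3, map_mul] at h4
    rw [← map_pow κ (mon (f j)), mon_pow] at h4
    have h5 : κ (MvPolynomial.C ((s j)⁻¹)) * κ (MvPolynomial.C (s j)) = 1 := by
      rw [← map_mul, ← map_mul, inv_mul_cancel₀ (hs j), map_one, map_one]
    refine ⟨MvPolynomial.C ((s j)⁻¹) ^ M * ((θ.symm ⟨_, h2⟩).1 * e ^ M), ?_⟩
    rw [map_mul, map_mul, map_pow, map_pow, ← h4]
    have h6 : κ (MvPolynomial.C ((s j)⁻¹)) ^ M * κ (MvPolynomial.C (s j)) ^ M = 1 := by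
      rw [← mul_pow, h5, one_pow]
    linear_combination (- (x ^ M * κ (mon fun i => M * f j i))) * h6
  obtain ⟨f0, _, hf0⟩ := hloc j0
  obtain ⟨r, hr⟩ := descend κ hκ _ hloc _ f0 rfl hf0
  have hxM : x ^ M ∈ omO L := mem_omO.2 (by rw [hr]; exact om_poly κ hZ r)
  have hxi : IsIntegral (omO L) (x ^ M) :=
    isIntegral_algebraMap (R := omO L) (A := Om L) (x := ⟨x ^ M, hxM⟩)
  have hx0 := om_integral (hxi.of_pow hMpos)
  rw [← hxF, HahnSeries.orderTop_mul]
  exact le_add_of_nonneg_right hx0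

end keyineq

open Matrix Polynomial

set_option linter.unusedSectionVars false
section finage
variable {n : ℕ} {L : Type} [Field L] [Algebra ℂ L]

theorem glAct_diag_X {δ : GL (Fin n) ℂ} {l : Fin n → ℂ} (h : δ.1 = Matrix.diagonal l) (k : Fin n) :
    glAct δ (MvPolynomial.X k) = l k • MvPolynomial.X k := by
  rw [glAct_X, h, Finset.sum_eq_single k]
  · simp
  · intro b _ hb
    rw [Matrix.diagonal_apply_ne _ hb.symm, zero_smul]
  · simp

theorem diag_act {P g : GL (Fin n) ℂ} {l : Fin n → ℂ}
    (h : ((P * g * P⁻¹ : GL (Fin n) ℂ) : Matrix (Fin n) (Fin n) ℂ) = Matrix.diagonal l) (k : Fin n) :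
    glAct g (glAct P (MvPolynomial.X k)) = l k • glAct P (MvPolynomial.X k) := by
  have h1 : P * g = (P * g * P⁻¹) * P := by group
  rw [glAct_mul, h1, ← glAct_mul, glAct_diag_X h, map_smul]

theorem omD_S (δ : Derivation ℂ L L) (x : Om L) : omS L (omD δ 0 x) = omD δ 0 (omS L x) := by
  ext q
  rw [omS_coeff, omD_coeff, omD_coeff, omS_coeff]
  simp

theorem fin_age (δ' : Fin n → Derivation ℂ L L) (κ' : MvPolynomial (Fin n) ℂ →ₐ[ℂ] Om L)
    (g : GL (Fin n) ℂ) {m : ℕ} (hm : 0 < m) (hg : g ^ m = 1)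
    (hage : g ≠ 1 → 1 ≤ reidTaiSum (g : Matrix (Fin n) (Fin n) ℂ))
    (hσ : ∀ p, omS L (κ' p) = κ' (glAct g p))
    (hZ : ∀ k, (0 : WithTop ℚ) ≤ (κ' (MvPolynomial.X k)).orderTop)
    (P : MvPolynomial (Fin n) ℂ) (hP0 : P ≠ 0) (hP : 0 < (κ' P).orderTop) :
    ((1 : ℚ) : WithTop ℚ) ≤
      (dmat (fun i => omD (δ' i) 0) (fun k => κ' (MvPolynomial.X k))).det.orderTop := by
  set D := fun i => omD (δ' i) 0 with hD
  by_cases hg1 : g = 1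
  · have hfix : ∀ p, omS L (κ' p) = κ' p := fun p => by rw [hσ, hg1, glAct_one]
    have hdetfix : omS L (dmat D (fun k => κ' (MvPolynomial.X k))).det =
        (dmat D (fun k => κ' (MvPolynomial.X k))).det := by
      rw [AlgHom.map_det]
      congr 1
      ext1 i j
      change omS L (omD (δ' i) 0 (κ' (MvPolynomial.X j))) = omD (δ' i) 0 (κ' (MvPolynomial.X j))
      rw [omD_S, hfix]
    have h0 : (0 : WithTop ℚ) ≤ (dmat D (fun k => κ' (MvPolynomial.X k))).det.orderTop := by
      have := om_det δ' (fun k => κ' (MvPolynomial.X k)) (fun _ => 0) (fun j => by exact_mod_cast hZ j)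
      simpa using this
    rw [om_le_iff]
    intro i hi
    by_contra hc
    obtain ⟨k, hk⟩ := omS_eig (β := 0) (by rw [hdetfix, ee_zero, one_smul]) hc
    have hi0 : 0 ≤ i := by
      by_contra hneg
      exact hc ((om_le_iff (q := 0)).1 (by exact_mod_cast h0) i (not_le.1 hneg))
    have hk0 : k = 0 := by
      rw [zero_add] at hk
      rw [hk] at hi hi0
      have : (k : ℤ) < 1 := by exact_mod_cast hi
      have : (0 : ℤ) ≤ k := by exact_mod_cast hi0
      omega
    rw [hk, hk0] at hc
    simp only [Int.cast_zero, add_zero] at hc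
    -- residue matrix
    set x : Fin n → L := fun k => (κ' (MvPolynomial.X k)).coeff 0 with hx
    have hdet : (dmat δ' x).det ≠ 0 := by
      let M : Matrix (Fin n) (Fin n) (omO L) := Matrix.of fun i j =>
        ⟨D i (κ' (MvPolynomial.X j)), mem_omO.2 ((hZ j).trans (omD_order _ _ _))⟩
      have h1 : (omO L).subtype M.det = (dmat D (fun k => κ' (MvPolynomial.X k))).det := by
        rw [RingHom.map_det]; rfl
      have h2 : omRes L M.det = (dmat δ' x).det := by
        rw [RingHom.map_det]
        congr 1
        ext i j
        change (omD (δ' i) 0 (κ' (MvPolynomial.X j))).coeff 0 = δ' i (x j)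
        rw [omD_coeff]; simp [hx]
      rw [← h2, omRes_apply]
      intro h3
      apply hc
      rw [← h1]
      exact h3
    apply hP0
    refine indep_of_det δ' x hdet P ?_
    have hhom : ∀ p, MvPolynomial.aeval x p = (κ' p).coeff 0 := by
      intro p
      let r : MvPolynomial (Fin n) ℂ →+* omO L :=
        κ'.toRingHom.codRestrict (omO L) (fun p => mem_omO.2 (om_poly κ' hZ p))
      have : (MvPolynomial.aeval x).toRingHom = (omRes L).comp r := by
        apply MvPolynomial.ringHom_ext
        · intro a
          change MvPolynomial.aeval x (MvPolynomial.C a) = (κ' (MvPolynomial.C a)).coeff 0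
          have h1 : κ' (MvPolynomial.C a) = algebraMap ℂ (Om L) a := κ'.commutes a
          rw [h1, omAlg_apply, MvPolynomial.aeval_C, HahnSeries.C_apply]
          simp
        · intro i
          change MvPolynomial.aeval x (MvPolynomial.X i) = (κ' (MvPolynomial.X i)).coeff 0
          rw [MvPolynomial.aeval_X]
      exact congrArg (fun f => f p) this
    rw [hhom]
    exact om_coeff_zero_of_pos hP
  · obtain ⟨Q, c, hc, hd, hage'⟩ := diag_exists g hm hg
    have h1 := hage hg1
    rw [hage'] at h1
    have h1' : (1 : ℚ) ≤ ∑ i, c i := by exact_mod_cast h1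
    set κ'' := κ'.comp (glAct Q) with hκ''
    have hZ'' : ∀ k, (0 : WithTop ℚ) ≤ (κ'' (MvPolynomial.X k)).orderTop := fun k => om_poly κ' hZ _
    have hv : ∀ k, (c k : WithTop ℚ) ≤ (κ'' (MvPolynomial.X k)).orderTop := by
      intro k
      refine omS_eig_order ?_ (hZ'' k) (hc k).2
      change omS L (κ' (glAct Q (MvPolynomial.X k))) = ee (c k) • κ' (glAct Q (MvPolynomial.X k))
      rw [hσ, diag_act hd, map_smul]
    have h2 := om_det δ' (fun k => κ'' (MvPolynomial.X k)) c hv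
    have h3 := det_chain D κ'' (fun k => glAct Q⁻¹ (MvPolynomial.X k))
    have h4 : ∀ k, κ'' (glAct Q⁻¹ (MvPolynomial.X k)) = κ' (MvPolynomial.X k) := by
      intro k
      change κ' (glAct Q (glAct Q⁻¹ (MvPolynomial.X k))) = _
      rw [glAct_mul, inv_mul_cancel, glAct_one]
    simp only [h4] at h3
    rw [h3, HahnSeries.orderTop_mul]
    refine le_trans ?_ (h2.trans (le_add_of_nonneg_right (om_poly κ'' hZ'' _)))
    exact_mod_cast h1'

end finage

open Matrix Polynomial

set_option linter.unusedSectionVars false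
section core2
variable {n : ℕ} {L : Type} [Field L] [Algebra ℂ L]

theorem om_int_of (R : Subalgebra ℂ (MvPolynomial (Fin n) ℂ)) (hIntg : ∀ s : MvPolynomial (Fin n) ℂ, IsIntegral R s)
    (κ : MvPolynomial (Fin n) ℂ →ₐ[ℂ] Om L)
    (h : ∀ r ∈ R, (0 : WithTop ℚ) ≤ (κ r).orderTop) (s : MvPolynomial (Fin n) ℂ) :
    (0 : WithTop ℚ) ≤ (κ s).orderTop := by
  apply om_integral
  obtain ⟨p, hm, hp⟩ := hIntg s
  let r : R →+* omO L := (κ.toRingHom.comp R.subtype).codRestrict (omO L)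
    (fun p => mem_omO.2 (h p.1 p.2))
  refine ⟨p.map r, hm.map r, ?_⟩
  rw [Polynomial.eval₂_map]
  have := congrArg κ.toRingHom hp
  rw [Polynomial.hom_eval₂, map_zero] at this
  exact this

theorem dmat_diag (w : Fin n → L) (D : Fin n → Derivation ℂ L L)
    (hD : ∀ i j, D i (w j) = if i = j then w j else 0) (c : Fin n → ℚ) :
    dmat (fun i => omD (D i) 0) (fun i => (HahnSeries.single (c i) (w i) : Om L)) =
      Matrix.diagonal (fun i => (HahnSeries.single (c i) (w i) : Om L)) := by
  ext1 i j
  rw [dmat_apply]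
  ext q
  rw [omD_coeff, HahnSeries.coeff_single]
  by_cases hij : i = j
  · subst hij
    rw [Matrix.diagonal_apply_eq, HahnSeries.coeff_single]
    split_ifs
    · simp [hD]
    · simp
  · rw [Matrix.diagonal_apply_ne _ hij]
    split_ifs
    · simp [hD, hij]
    · simp

theorem det_diag_ne (w : Fin n → L) (D : Fin n → Derivation ℂ L L) (hw : ∀ i, w i ≠ 0)
    (hD : ∀ i j, D i (w j) = if i = j then w j else 0) (c : Fin n → ℚ) :
    (dmat (fun i => omD (D i) 0) (fun i => (HahnSeries.single (c i) (w i) : Om L))).det ≠ 0 := by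
  rw [dmat_diag w D hD, Matrix.det_diagonal]
  exact Finset.prod_ne_zero_iff.2 fun i _ => HahnSeries.single_ne_zero (hw i)

theorem det_diag_order (w : Fin n → L) (D : Fin n → Derivation ℂ L L) (hw : ∀ i, w i ≠ 0)
    (hD : ∀ i j, D i (w j) = if i = j then w j else 0) (c : Fin n → ℚ) :
    (dmat (fun i => omD (D i) 0) (fun i => (HahnSeries.single (c i) (w i) : Om L))).det.orderTop =
      ((∑ i, c i : ℚ) : WithTop ℚ) := by
  rw [dmat_diag w D hD, Matrix.det_diagonal, om_prod]
  push_cast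
  exact Finset.sum_congr rfl fun i _ => HahnSeries.orderTop_single (hw i)

theorem core2 [IsAlgClosed L] (w : Fin n → L) (D : Fin n → Derivation ℂ L L) (hw : ∀ i, w i ≠ 0)
    (hD : ∀ i j, D i (w j) = if i = j then w j else 0)
    (κ : MvPolynomial (Fin n) ℂ →ₐ[ℂ] Om L)
    (hZ : ∀ k, (0 : WithTop ℚ) ≤ (κ (MvPolynomial.X k)).orderTop)
    (δ : GL (Fin n) ℂ) (β : Fin n → ℚ) (hδ : δ.1 = Matrix.diagonal (fun i => ee (β i)))
    {m : ℕ} (hm : 0 < m) (hδm : δ ^ m = 1)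
    (hσ : ∀ p, omS L (κ p) = κ (glAct δ p))
    (Y : Fin n → MvPolynomial (Fin n) ℂ) (c : Fin n → ℚ)
    (hκY : ∀ i, κ (Y i) = HahnSeries.single (c i) (w i))
    (hY : ∀ k : ℕ, IsQuasiReflection ((δ ^ k : GL (Fin n) ℂ) : Matrix (Fin n) (Fin n) ℂ) →
      ∀ i, glAct (δ ^ k) (Y i) = Y i)
    (hcan : HasCanonicalQuotSings (Subgroup.zpowers δ))
    (hc : ∀ i, 0 ≤ c i) (hc' : ∃ i, c i ≠ 0) : 1 ≤ ∑ i, c i := by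
  have : CharZero L := charZero_of_injective_algebraMap (algebraMap ℂ L).injective
  obtain ⟨j0, hj0⟩ := hc'
  obtain ⟨G, hGfin, -, ⟨θ⟩, hage⟩ := hcan
  set DD : Fin n → Derivation ℂ (Om L) (Om L) := fun i => omD (D i) 0 with hDD
  have hdetY : (dmat DD (fun k => κ (Y k))).det ≠ 0 := by
    simp only [hκY]; exact det_diag_ne w D hw hD c
  have hordY : (dmat DD (fun k => κ (Y k))).det.orderTop = ((∑ i, c i : ℚ) : WithTop ℚ) := by
    simp only [hκY]; exact det_diag_order w D hw hD c
  have hdet : (dmat DD (fun k => κ (MvPolynomial.X k))).det ≠ 0 := by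
    rw [det_chain] at hdetY
    exact left_ne_zero_of_mul hdetY
  have hκ : Function.Injective κ := by
    refine (injective_iff_map_eq_zero _).2 fun p hp => ?_
    refine indep_of_det DD _ hdet p ?_
    rw [← hp]
    exact (congrArg (fun k => k p) (MvPolynomial.aeval_unique κ)).symm
  have hβ : ∀ i, ∃ b : ℤ, β i = b / m := by
    intro i
    have h1 : (δ ^ m).1 = 1 := by rw [hδm]; rfl
    rw [Units.val_pow_eq_pow_val, hδ, Matrix.diagonal_pow] at h1
    have h2 := congrFun (congrFun h1 i) i
    rw [Matrix.diagonal_apply_eq, Matrix.one_apply_eq, Pi.pow_apply, ← ee_natmul] at h2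
    obtain ⟨k, hk⟩ := ee_eq_one h2
    refine ⟨k, ?_⟩
    rw [← hk]; field_simp
  choose b hb using hβ
  -- lift to the other cover
  obtain ⟨κ', hκ'⟩ := ext_lift (invariantRing G) (integral_invariantRing G)
    ((κ.comp (invariantRing (Subgroup.zpowers δ)).val).comp θ.symm.toAlgHom)
    (by
      intro a b hab
      exact θ.symm.injective (Subtype.ext (hκ hab)))
  have hθ : ∀ u, κ' (θ u).1 = κ u.1 := by
    intro u
    rw [hκ' (θ u)]
    change κ (θ.symm (θ u)).1 = _
    rw [AlgEquiv.symm_apply_apply]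
  have hκ'inv : ∀ p (hp : p ∈ invariantRing G), κ' p = κ (θ.symm ⟨p, hp⟩).1 :=
    fun p hp => hκ' ⟨p, hp⟩
  obtain ⟨g, hgG, hg⟩ := gal_exists G κ' ((omS L).comp κ') (by
    intro p hp
    change κ' p = omS L (κ' p)
    rw [hκ'inv p hp, hσ]
    congr 1
    exact ((θ.symm ⟨p, hp⟩).2 δ (Subgroup.mem_zpowers δ)).symm)
  have hZ' : ∀ s, (0 : WithTop ℚ) ≤ (κ' s).orderTop :=
    om_int_of (invariantRing G) (integral_invariantRing G) κ' (by
      intro r hr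
      rw [hκ'inv r hr]
      exact om_poly κ hZ _)
  obtain ⟨hF, hle⟩ := key_ineq DD κ κ' hdet hZ δ β hδ m hm.ne' b hb Y hY j0 G θ hθ
  -- the positive element
  have hYm : glAct δ (Y j0 ^ (c j0).den) = Y j0 ^ (c j0).den := by
    apply hκ
    rw [← hσ, map_pow, map_pow, hκY, omS_t, _root_.smul_pow, ← ee_natmul]
    have : ((c j0).den : ℚ) * c j0 = ((c j0).num : ℤ) := by
      rw [mul_comm]; exact Rat.mul_den_eq_num _
    rw [this, ee_int, one_smul]
  have hmem := mem_inv_zpowers hYm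
  have hposc : 0 < c j0 := lt_of_le_of_ne (hc j0) (Ne.symm hj0)
  have hPos : 0 < (κ' (θ ⟨_, hmem⟩).1).orderTop := by
    rw [hθ]
    change 0 < (κ (Y j0 ^ (c j0).den)).orderTop
    rw [map_pow, hκY, HahnSeries.single_pow, HahnSeries.orderTop_single (pow_ne_zero _ (hw j0))]
    have : (0 : ℚ) < (c j0).den • c j0 := nsmul_pos hposc (c j0).den_ne_zero
    exact_mod_cast this
  have hne : (θ ⟨_, hmem⟩).1 ≠ 0 := by
    intro h0
    have h1 := hθ ⟨_, hmem⟩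
    rw [h0, map_zero] at h1
    change 0 = κ (Y j0 ^ (c j0).den) at h1
    rw [map_pow, hκY] at h1
    exact pow_ne_zero _ (HahnSeries.single_ne_zero (hw j0)) h1.symm
  have hgord : g ^ Nat.card G = 1 := by
    have : (⟨g, hgG⟩ : G) ^ Nat.card G = 1 := pow_card_eq_one'
    exact congrArg Subtype.val this
  have h1 := fin_age D κ' g (Nat.card_pos (α := G)) hgord (hage g hgG) hg (fun k => hZ' _) _ hne hPos
  have h2 := h1.trans hle
  rw [hordY] at h2
  exact_mod_cast h2

end core2

open Matrix Polynomial

set_option linter.unusedSectionVars false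
section core
variable {n : ℕ}

theorem quasi_conj {P g : GL (Fin n) ℂ}
    (h : IsQuasiReflection ((P * g * P⁻¹ : GL (Fin n) ℂ) : Matrix (Fin n) (Fin n) ℂ)) :
    IsQuasiReflection (g : Matrix (Fin n) (Fin n) ℂ) := by
  have e : ((P * g * P⁻¹ : GL (Fin n) ℂ) : Matrix (Fin n) (Fin n) ℂ).charpoly =
      (g : Matrix (Fin n) (Fin n) ℂ).charpoly := by
    rw [Units.val_mul, Units.val_mul, Matrix.coe_units_inv]
    exact Matrix.charpoly_units_conj P g.1
  unfold IsQuasiReflection at h ⊢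
  rwa [e] at h

theorem can_conj (P γ : GL (Fin n) ℂ) (h : HasCanonicalQuotSings (Subgroup.zpowers γ)) :
    HasCanonicalQuotSings (Subgroup.zpowers (P * γ * P⁻¹)) := by
  obtain ⟨G, h1, h2, ⟨θ⟩, h3⟩ := h
  refine ⟨G, h1, h2, ⟨AlgEquiv.trans ?_ θ⟩, h3⟩
  have hmem : ∀ p, glAct P p ∈ invariantRing (Subgroup.zpowers γ) ↔
      p ∈ invariantRing (Subgroup.zpowers (P * γ * P⁻¹)) := by
    intro p
    have e : glAct γ (glAct P p) = glAct P (glAct (P * γ * P⁻¹) p) := by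
      rw [glAct_mul, glAct_mul, inv_mul_cancel_right]
    constructor
    · intro hp
      apply mem_inv_zpowers
      apply glAct_inj P
      rw [← e]
      exact hp γ (Subgroup.mem_zpowers γ)
    · intro hp
      apply mem_inv_zpowers
      rw [e, hp _ (Subgroup.mem_zpowers _)]
  let φ : invariantRing (Subgroup.zpowers (P * γ * P⁻¹)) →ₐ[ℂ] invariantRing (Subgroup.zpowers γ) :=
    ((glAct P).comp (invariantRing (Subgroup.zpowers (P * γ * P⁻¹))).val).codRestrict _
      (fun p => (hmem _).2 p.2)
  refine AlgEquiv.ofBijective φ ⟨?_, ?_⟩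
  · intro a b hab
    exact Subtype.ext (glAct_inj P (congrArg Subtype.val hab))
  · rintro ⟨p, hp⟩
    have e : glAct P (glAct P⁻¹ p) = p := by rw [glAct_mul, inv_mul_cancel, glAct_one]
    refine ⟨⟨glAct P⁻¹ p, (hmem _).1 (by rw [e]; exact hp)⟩, Subtype.ext e⟩

theorem core (G : Subgroup (GL (Fin n) ℂ)) [Finite G]
    (h : ∀ g ∈ G, HasCanonicalQuotSings (Subgroup.zpowers g))
    (y : Fin n → MvPolynomial (Fin n) ℂ) (hy : AlgebraicIndependent ℂ y)
    (hr : Algebra.adjoin ℂ (Set.range y) = invariantRing (reflGrp G))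
    (g : GL (Fin n) ℂ) (hg : g ∈ G) (c : Fin n → ℚ) (hc : ∀ i, 0 ≤ c i) (hc' : ∃ i, c i ≠ 0)
    (hgy : ∀ i, glAct g (y i) = ee (c i) • y i) : 1 ≤ ∑ i, c i := by
  obtain ⟨L, _, _, _, w, D, hw, hD⟩ := exists_logfield n
  have : CharZero L := charZero_of_injective_algebraMap (algebraMap ℂ L).injective
  have : Finite (reflGrp G) := Finite.of_injective _ (Subgroup.inclusion_injective (reflGrp_le G))
  set t : Fin n → Om L := fun i => HahnSeries.single (c i) (w i) with ht
  have htinj : Function.Injective (MvPolynomial.aeval t : MvPolynomial (Fin n) ℂ →ₐ[ℂ] Om L) :=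
    (injective_iff_map_eq_zero _).2 fun p hp =>
      indep_of_det _ t (det_diag_ne w D hw hD c) p hp
  have hIntg : ∀ s : MvPolynomial (Fin n) ℂ, IsIntegral (Algebra.adjoin ℂ (Set.range y)) s := by
    rw [hr]; exact integral_invariantRing (reflGrp G)
  obtain ⟨ι, hι⟩ := ext_lift (Algebra.adjoin ℂ (Set.range y)) hIntg
    ((MvPolynomial.aeval t).comp hy.aevalEquiv.symm.toAlgHom)
    (htinj.comp hy.aevalEquiv.symm.injective)
  have hιy : ∀ i, ι (y i) = t i := by
    intro i
    have h1 := hι (hy.aevalEquiv (MvPolynomial.X i))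
    have h2 : ((MvPolynomial.aeval t).comp hy.aevalEquiv.symm.toAlgHom)
        (hy.aevalEquiv (MvPolynomial.X i)) = t i := by
      change MvPolynomial.aeval t (hy.aevalEquiv.symm (hy.aevalEquiv (MvPolynomial.X i))) = _
      rw [AlgEquiv.symm_apply_apply, MvPolynomial.aeval_X]
    rw [h2] at h1
    have h3 : ((hy.aevalEquiv (MvPolynomial.X i) : Algebra.adjoin ℂ (Set.range y)) :
        MvPolynomial (Fin n) ℂ) = y i :=
      (hy.algebraMap_aevalEquiv (MvPolynomial.X i)).trans (MvPolynomial.aeval_X _ _)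
    rw [← h1, h3]
  have hιq : ∀ q : MvPolynomial (Fin n) ℂ, ι (MvPolynomial.aeval y q) = MvPolynomial.aeval t q := by
    intro q
    rw [← AlgHom.comp_apply, MvPolynomial.comp_aeval]
    congr 2
    funext i; exact hιy i
  have hpoly : ∀ r ∈ invariantRing (reflGrp G), ∃ q : MvPolynomial (Fin n) ℂ, r = MvPolynomial.aeval y q := by
    intro r hr'
    rw [← hr, Algebra.adjoin_range_eq_range_aeval] at hr'
    obtain ⟨q, hq⟩ := hr'
    exact ⟨q, hq.symm⟩
  have hSg : ∀ q : MvPolynomial (Fin n) ℂ, omS L (ι (MvPolynomial.aeval y q)) = ι (glAct g (MvPolynomial.aeval y q)) := by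
    intro q
    have : ((omS L).comp ι).comp (MvPolynomial.aeval y) = (ι.comp (glAct g)).comp (MvPolynomial.aeval y) := by
      apply MvPolynomial.algHom_ext
      intro i
      change omS L (ι (MvPolynomial.aeval y (MvPolynomial.X i))) =
        ι (glAct g (MvPolynomial.aeval y (MvPolynomial.X i)))
      rw [MvPolynomial.aeval_X, hgy, map_smul, hιy]
      exact omS_t _ _
    exact congrArg (fun f => f q) this
  obtain ⟨γ, hγG, hγ⟩ := gal_exists G ι ((omS L).comp ι) (by
    intro p hp
    obtain ⟨q, rfl⟩ := hpoly p (fun a ha => hp a (reflGrp_le G ha))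
    change _ = omS L (ι _)
    rw [hSg, hp g hg])
  have hZ : ∀ s, (0 : WithTop ℚ) ≤ (ι s).orderTop := by
    refine om_int_of (invariantRing (reflGrp G)) (integral_invariantRing _) ι ?_
    intro r hr'
    obtain ⟨q, rfl⟩ := hpoly r hr'
    rw [hιq]
    refine om_poly (MvPolynomial.aeval t) ?_ q
    intro k
    rw [MvPolynomial.aeval_X, ht]
    rw [HahnSeries.orderTop_single (hw k)]
    exact_mod_cast hc k
  have hγord : γ ^ Nat.card G = 1 := by
    have : (⟨γ, hγG⟩ : G) ^ Nat.card G = 1 := pow_card_eq_one'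
    exact congrArg Subtype.val this
  obtain ⟨P, β, hβ, hd, -⟩ := diag_exists γ (Nat.card_pos (α := G)) hγord
  have hPP : ∀ p, glAct P (glAct P⁻¹ p) = p := fun p => by
    rw [glAct_mul, inv_mul_cancel, glAct_one]
  refine core2 w D hw hD (ι.comp (glAct P)) (fun k => hZ _) (P * γ * P⁻¹) β hd
    (Nat.card_pos (α := G)) ?_ ?_ (fun i => glAct P⁻¹ (y i)) c ?_ ?_ (can_conj P γ (h γ hγG)) hc hc'
  · rw [conj_pow, hγord]; group
  · intro p
    have e : glAct γ (glAct P p) = glAct P (glAct (P * γ * P⁻¹) p) := by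
      rw [glAct_mul, glAct_mul, inv_mul_cancel_right]
    change omS L (ι (glAct P p)) = ι (glAct P (glAct (P * γ * P⁻¹) p))
    rw [← e]
    exact hγ _
  · intro i
    change ι (glAct P (glAct P⁻¹ (y i))) = _
    rw [hPP, hιy]
  · intro k hk i
    rw [conj_pow] at hk ⊢
    have h1 : γ ^ k ∈ reflGrp G := reflGrp_mem (G.pow_mem hγG k) (quasi_conj hk)
    have h2 : y i ∈ invariantRing (reflGrp G) := by
      rw [← hr]; exact Algebra.subset_adjoin ⟨i, rfl⟩
    have e : glAct (P * γ ^ k * P⁻¹) (glAct P⁻¹ (y i)) = glAct P⁻¹ (glAct (γ ^ k) (y i)) := by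
      have e' : P⁻¹ * (P * γ ^ k * P⁻¹) = γ ^ k * P⁻¹ := by group
      rw [glAct_mul, glAct_mul, e']
    rw [e, h2 _ h1]

end core

/-- If `G < GL(n,ℂ)` is finite and `ℂⁿ/⟨g⟩` has canonical singularities for
every `g ∈ G`, then `ℂⁿ/G` has canonical singularities. -/
theorem stmt_7 (n : ℕ) (G : Subgroup (GL (Fin n) ℂ)) (hfin : Finite G)
    (h : ∀ g ∈ G, HasCanonicalQuotSings (Subgroup.zpowers g)) :
    HasCanonicalQuotSings G := by
  obtain ⟨y, hy, hr, hspan⟩ := cst G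
  obtain ⟨A, hA⟩ := rep_exists G y hy hspan
  have hfinA : Finite A.range := Finite.of_surjective A.rangeRestrict A.rangeRestrict_surjective
  have hord : ∀ g' ∈ A.range, g' ^ Nat.card G = 1 := by
    rintro _ ⟨g, rfl⟩
    rw [← map_pow, pow_card_eq_one', map_one]
  have hage : ∀ g' ∈ A.range, g' ≠ 1 → 1 ≤ reidTaiSum (g' : Matrix (Fin n) (Fin n) ℂ) := by
    intro g' hg' hne
    obtain ⟨P, c, hc, hd, hsum⟩ := diag_exists g' (Nat.card_pos (α := G)) (hord g' hg')
    obtain ⟨g, rfl⟩ := hg'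
    rw [hsum]
    set y' : Fin n → MvPolynomial (Fin n) ℂ := fun i => ∑ j, P.1 i j • y j with hy'
    have hae : ∀ p : MvPolynomial (Fin n) ℂ, MvPolynomial.aeval y' p = MvPolynomial.aeval y (glAct P p) :=
      fun p => (glAct_aeval y P p).symm
    have hind : AlgebraicIndependent ℂ y' := by
      intro a b hab
      rw [hae, hae] at hab
      exact glAct_inj P (hy hab)
    have hadj : Algebra.adjoin ℂ (Set.range y') = invariantRing (reflGrp G) := by
      rw [← hr, Algebra.adjoin_range_eq_range_aeval, Algebra.adjoin_range_eq_range_aeval]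
      ext p
      constructor
      · rintro ⟨q, rfl⟩
        exact ⟨glAct P q, (hae q).symm⟩
      · rintro ⟨q, rfl⟩
        refine ⟨glAct P⁻¹ q, ?_⟩
        refine (hae _).trans ?_
        rw [glAct_mul, inv_mul_cancel, glAct_one]
        rfl
    have hyX : ∀ i, y' i = MvPolynomial.aeval y (glAct P (MvPolynomial.X i)) := by
      intro i
      rw [← hae, MvPolynomial.aeval_X]
    have hgy : ∀ i, glAct g.1 (y' i) = ee (c i) • y' i := by
      intro i
      rw [hyX, rep_act G y A hA, diag_act hd, map_smul]
    have hc' : ∃ i, c i ≠ 0 := by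
      by_contra hcon
      push Not at hcon
      apply hne
      have h1 : P * A g * P⁻¹ = 1 := by
        apply Units.ext
        rw [hd]
        simp [hcon, ee_zero]
      have h2 : A g = P⁻¹ * (P * A g * P⁻¹) * P := by group
      rw [h2, h1]; group
    have := core G h y' hind hadj g.1 g.2 c (fun i => (hc i).1) hc' hgy
    exact_mod_cast this
  exact ⟨A.range, hfinA, fun g hg => not_quasi_of_age g (Nat.card_pos (α := G)) (hord g hg) (hage g hg),
    rep_iso G y hy hr A hA, hage⟩
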